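/- arXiv:1601.04858 — 2 statements merged into one kernel-verified Lean document; each statement's English description precedes it below -/
import Mathlib

section
/- Let $P_n(x)=\lambda_0+\lambda_1 x+\cdots+\lambda_n x^n$ with $n\ge 2$, where $\lambda_0,\ldots,\lambda_n$ are i.i.d. real random variables with $p_0:=\mathbb{P}\{\lambda_0=0\}<1$. Then $\mathbb{E}[N(P_n)\,\mathbf{1}_{\{P_n\neq 0\}}] \le C\log n + p_0/(1-p_0)$ for an absolute constant $C$, where $N(P_n)$ is the total number of real zeroes counted with multiplicity. -/
open Finset Polynomial MeasureTheory
open scoped ENNReal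

section Stein
variable {ι : Type*} [Fintype ι] [DecidableEq ι]

/-- The linear statistic `∑ w i * a (σ i)`. -/
noncomputable def linStat (w a : ι → ℝ) (σ : Equiv.Perm ι) : ℝ := ∑ i, w i * a (σ i)

lemma linStat_swap (w a : ι → ℝ) (σ : Equiv.Perm ι) (i j : ι) :
    linStat w a (σ * Equiv.swap i j) = linStat w a σ - (w i - w j) * (a (σ i) - a (σ j)) := by
  unfold linStat
  by_cases hij : i = j
  · subst hij; simp
  have hj : j ∈ (univ.erase i : Finset ι) := by simp [Ne.symm hij]
  rw [← Finset.add_sum_erase univ _ (mem_univ i), ← Finset.add_sum_erase _ _ hj,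
    ← Finset.add_sum_erase univ (fun k => w k * a (σ k)) (mem_univ i),
    ← Finset.add_sum_erase _ (fun k => w k * a (σ k)) hj]
  have : ∑ x ∈ (univ.erase i).erase j, w x * a ((σ * Equiv.swap i j) x)
      = ∑ x ∈ (univ.erase i).erase j, w x * a (σ x) := by
    apply Finset.sum_congr rfl
    intro x hx
    simp only [mem_erase, mem_univ, and_true] at hx
    rw [Equiv.Perm.mul_apply, Equiv.swap_apply_of_ne_of_ne hx.2 hx.1]
  rw [this]
  simp only [Equiv.Perm.mul_apply, Equiv.swap_apply_left, Equiv.swap_apply_right]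
  ring

lemma sum_mul_swap (f : Equiv.Perm ι → ℝ) (i j : ι) :
    ∑ σ, f (σ * Equiv.swap i j) = ∑ σ, f σ :=
  Equiv.sum_comp (Equiv.mulRight (Equiv.swap i j)) f

lemma stein_pair (X φ : Equiv.Perm ι → ℝ) (i j : ι) :
    ∑ σ, (X σ - X (σ * Equiv.swap i j)) * φ σ
      = 1 / 2 * ∑ σ, (X σ - X (σ * Equiv.swap i j)) * (φ σ - φ (σ * Equiv.swap i j)) := by
  have h := sum_mul_swap (fun σ => (X σ - X (σ * Equiv.swap i j)) * φ σ) i j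
  simp only [mul_assoc, Equiv.swap_mul_self, mul_one] at h
  have h2 : ∑ σ, (X σ - X (σ * Equiv.swap i j)) * (φ σ - φ (σ * Equiv.swap i j))
      = ∑ σ, (X σ - X (σ * Equiv.swap i j)) * φ σ
        + ∑ σ, (X (σ * Equiv.swap i j) - X σ) * φ (σ * Equiv.swap i j) := by
    rw [← Finset.sum_add_distrib]
    exact Finset.sum_congr rfl fun σ _ => by ring
  rw [h2, h]; ring

/-- Weights describing uniform choice inside a class. -/
structure ClassWt (ω : ι → ι → ℝ) : Prop where
  sym : ∀ i j, ω i j = ω j i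
  nn : ∀ i j, 0 ≤ ω i j
  row : ∀ i, ∑ j, ω i j = 1
  cls : ∀ i j, ω i j ≠ 0 → ∀ k, ω i k = ω j k

/-- class average -/
noncomputable def clAvg (ω : ι → ι → ℝ) (u : ι → ℝ) (i : ι) : ℝ := ∑ j, ω i j * u j

lemma clAvg_eq {ω : ι → ι → ℝ} (hω : ClassWt ω) (u : ι → ℝ) {i j : ι} (h : ω i j ≠ 0) :
    clAvg ω u i = clAvg ω u j := by
  unfold clAvg
  exact Finset.sum_congr rfl fun k _ => by rw [hω.cls i j h k]

lemma drift {ω : ι → ι → ℝ} (hω : ClassWt ω) (u b : ι → ℝ) :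
    ∑ i, ∑ j, ω i j * ((u i - u j) * (b i - b j))
      = 2 * (∑ i, u i * b i - ∑ i, clAvg ω u i * b i) := by
  have e1 : ∑ i, ∑ j, ω i j * (u i * b i) = ∑ i, u i * b i := by
    refine Finset.sum_congr rfl fun i _ => ?_
    rw [← Finset.sum_mul, hω.row, one_mul]
  have e2 : ∑ i, ∑ j, ω i j * (u j * b j) = ∑ i, u i * b i := by
    rw [Finset.sum_comm]
    refine Finset.sum_congr rfl fun i _ => ?_
    rw [← Finset.sum_mul]
    simp_rw [hω.sym _ i]
    rw [hω.row, one_mul]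
  have e3 : ∑ i, ∑ j, ω i j * (u j * b i) = ∑ i, clAvg ω u i * b i := by
    refine Finset.sum_congr rfl fun i _ => ?_
    unfold clAvg
    rw [Finset.sum_mul]
    exact Finset.sum_congr rfl fun j _ => by ring
  have e4 : ∑ i, ∑ j, ω i j * (u i * b j) = ∑ i, clAvg ω u i * b i := by
    rw [← e3, Finset.sum_comm]
    refine Finset.sum_congr rfl fun i _ => Finset.sum_congr rfl fun j _ => ?_
    rw [hω.sym]
  have : ∀ i j, ω i j * ((u i - u j) * (b i - b j)) = ω i j * (u i * b i) + ω i j * (u j * b j)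
      - ω i j * (u j * b i) - ω i j * (u i * b j) := fun i j => by ring
  simp_rw [this, Finset.sum_sub_distrib, Finset.sum_add_distrib]
  rw [e1, e2, e3, e4]; ring

/-- Stein identity. -/
lemma stein {ω : ι → ι → ℝ} (hω : ClassWt ω) (u a : ι → ℝ) (φ : Equiv.Perm ι → ℝ) :
    ∑ σ, 2 * (linStat u a σ - linStat (clAvg ω u) a σ) * φ σ
      = 1 / 2 * ∑ σ, ∑ i, ∑ j, ω i j * ((linStat u a σ - linStat u a (σ * Equiv.swap i j)) *
          (φ σ - φ (σ * Equiv.swap i j))) := by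
  have h1 : ∀ σ : Equiv.Perm ι, 2 * (linStat u a σ - linStat (clAvg ω u) a σ) * φ σ
      = ∑ i, ∑ j, ω i j * ((linStat u a σ - linStat u a (σ * Equiv.swap i j)) * φ σ) := by
    intro σ
    have := drift hω u (fun i => a (σ i))
    unfold linStat at *
    rw [← this, Finset.sum_mul]
    refine Finset.sum_congr rfl fun i _ => ?_
    rw [Finset.sum_mul]
    refine Finset.sum_congr rfl fun j _ => ?_
    have := linStat_swap u a σ i j
    unfold linStat at this
    rw [this]; ring
  simp_rw [h1]
  rw [Finset.sum_comm]
  rw [Finset.sum_comm (s := univ) (t := univ) (f := fun σ i => ∑ j, ω i j * ((linStat u a σ - linStat u a (σ * Equiv.swap i j)) *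
          (φ σ - φ (σ * Equiv.swap i j))))]
  rw [Finset.mul_sum]
  refine Finset.sum_congr rfl fun i _ => ?_
  rw [Finset.sum_comm, Finset.sum_comm (s := univ) (t := univ) (f := fun σ j => ω i j * ((linStat u a σ - linStat u a (σ * Equiv.swap i j)) *
          (φ σ - φ (σ * Equiv.swap i j))))]
  rw [Finset.mul_sum]
  refine Finset.sum_congr rfl fun j _ => ?_
  rw [← Finset.mul_sum, ← Finset.mul_sum, stein_pair]; ring

/-- Energies. -/
noncomputable def energy (ω : ι → ι → ℝ) (b : ι → ℝ) : ℝ := ∑ i, ∑ j, ω i j * (b i - b j) ^ 2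

noncomputable def wEnergy (ω : ι → ι → ℝ) (u b : ι → ℝ) : ℝ :=
  ∑ i, ∑ j, ω i j * ((u i - u j) * (b i - b j)) ^ 2

lemma energy_nonneg {ω : ι → ι → ℝ} (hω : ClassWt ω) (b : ι → ℝ) : 0 ≤ energy ω b :=
  Finset.sum_nonneg fun i _ => Finset.sum_nonneg fun j _ => mul_nonneg (hω.nn i j) (sq_nonneg _)

lemma cls_swap {ω : ι → ι → ℝ} (hω : ClassWt ω) {i j : ι} (h : ω i j ≠ 0) (k l : ι) :
    ω (Equiv.swap i j k) l = ω k l := by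
  rw [Equiv.swap_apply_def]
  split_ifs with h1 h2
  · subst h1; exact (hω.cls _ _ h l).symm
  · subst h2; exact hω.cls _ _ h l
  · rfl

lemma energy_swap {ω : ι → ι → ℝ} (hω : ClassWt ω) (a : ι → ℝ) (σ : Equiv.Perm ι) {i j : ι}
    (h : ω i j ≠ 0) :
    energy ω (fun k => a ((σ * Equiv.swap i j) k)) = energy ω (fun k => a (σ k)) := by
  unfold energy
  rw [← Equiv.sum_comp (Equiv.swap i j)]
  refine Finset.sum_congr rfl fun k _ => ?_
  rw [← Equiv.sum_comp (Equiv.swap i j)]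
  refine Finset.sum_congr rfl fun l _ => ?_
  rw [cls_swap hω h, hω.sym, cls_swap hω h, hω.sym]
  simp

lemma wEnergy_le {ω : ι → ι → ℝ} (hω : ClassWt ω) (u b : ι → ℝ) (U : ℝ)
    (hU : ∀ i j, |u i - u j| ≤ U) : wEnergy ω u b ≤ U ^ 2 * energy ω b := by
  unfold wEnergy energy
  rw [Finset.mul_sum]
  refine Finset.sum_le_sum fun i _ => ?_
  rw [Finset.mul_sum]
  refine Finset.sum_le_sum fun j _ => ?_
  have : (u i - u j) ^ 2 ≤ U ^ 2 := by
    rw [← sq_abs]; exact pow_le_pow_left₀ (abs_nonneg _) (hU i j) 2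
  rw [mul_pow]
  have h2 := mul_le_mul_of_nonneg_right this (sq_nonneg (b i - b j))
  have h3 := mul_le_mul_of_nonneg_left h2 (hω.nn i j)
  linarith

open scoped Classical in
lemma le_wEnergy {ω : ι → ι → ℝ} (hω : ClassWt ω) (u b : ι → ℝ) (v : ℝ)
    (hv : 0 ≤ v) (hd : ∀ i, ∑ k, ω i k * (if |u i - u k| < v then 1 else 0) ≤ 1 / 4) :
    v ^ 2 * energy ω b ≤ 8 * wEnergy ω u b := by
  set g : ι → ι → ℝ := fun i k => if |u i - u k| < v then 0 else 1 with hg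
  have hgn : ∀ i k, 0 ≤ g i k := fun i k => by simp only [hg]; split_ifs <;> norm_num
  -- step 1
  have key : ∀ i j, ω i j * (b i - b j) ^ 2 ≤ ∑ k, 4 * (ω i j * ω i k *
      (g i k * (b i - b k) ^ 2) + ω i j * ω j k * (g j k * (b j - b k) ^ 2)) := by
    intro i j
    by_cases h : ω i j = 0
    · simp [h]
    have hc := hω.cls i j h
    have h1 : ∀ k, ω i j * ω i k * (1 - (if |u i - u k| < v then 1 else 0)
        - (if |u j - u k| < v then 1 else 0)) * (b i - b j) ^ 2 ≤ 2 * (ω i j * ω i k *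
      (g i k * (b i - b k) ^ 2) + ω i j * ω j k * (g j k * (b j - b k) ^ 2)) := by
      intro k
      rw [← hc k]
      have hp : 0 ≤ ω i j * ω i k := mul_nonneg (hω.nn _ _) (hω.nn _ _)
      have hq : (1 - (if |u i - u k| < v then 1 else 0)
        - (if |u j - u k| < v then 1 else 0)) * (b i - b j) ^ 2 ≤
        2 * (g i k * (b i - b k) ^ 2 + g j k * (b j - b k) ^ 2) := by
        simp only [hg]
        split_ifs
        · nlinarith [sq_nonneg (b i - b j)]
        · nlinarith [sq_nonneg (b i - b j), sq_nonneg (b j - b k)]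
        · nlinarith [sq_nonneg (b i - b j), sq_nonneg (b i - b k)]
        · nlinarith [sq_nonneg (b i - b k + (b j - b k))]
      have := mul_le_mul_of_nonneg_left hq hp
      linarith
    have h2 := Finset.sum_le_sum fun k (_ : k ∈ univ) => h1 k
    have h3 : ∑ k, ω i j * ω i k * (1 - (if |u i - u k| < v then 1 else 0)
        - (if |u j - u k| < v then 1 else 0)) * (b i - b j) ^ 2
        = ω i j * (b i - b j) ^ 2 * (∑ k, ω i k - ∑ k, ω i k * (if |u i - u k| < v then 1 else 0)
          - ∑ k, ω j k * (if |u j - u k| < v then 1 else 0)) := by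
      rw [← Finset.sum_sub_distrib, ← Finset.sum_sub_distrib, Finset.mul_sum]
      refine Finset.sum_congr rfl fun k _ => ?_
      rw [← hc k]; ring
    rw [h3, hω.row] at h2
    have h4 := hd i
    have h5 := hd j
    have h6 : 0 ≤ ω i j * (b i - b j) ^ 2 := mul_nonneg (hω.nn _ _) (sq_nonneg _)
    rw [← Finset.mul_sum] at h2 ⊢
    nlinarith
  have e1 : ∑ i, ∑ j, ∑ k, ω i j * ω i k * (g i k * (b i - b k) ^ 2)
      = ∑ i, ∑ k, ω i k * (g i k * (b i - b k) ^ 2) := by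
    refine Finset.sum_congr rfl fun i _ => ?_
    rw [Finset.sum_comm]
    refine Finset.sum_congr rfl fun k _ => ?_
    simp_rw [mul_assoc]
    rw [← Finset.sum_mul, hω.row, one_mul]
  have e2 : ∑ i, ∑ j, ∑ k, ω i j * ω j k * (g j k * (b j - b k) ^ 2)
      = ∑ i, ∑ k, ω i k * (g i k * (b i - b k) ^ 2) := by
    rw [Finset.sum_comm, ← e1]
    refine Finset.sum_congr rfl fun i _ => Finset.sum_congr rfl fun j _ => ?_
    rw [hω.sym]
  have h7 : energy ω b ≤ 8 * ∑ i, ∑ k, ω i k * (g i k * (b i - b k) ^ 2) := by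
    unfold energy
    refine (Finset.sum_le_sum fun i _ => Finset.sum_le_sum fun j _ => key i j).trans ?_
    simp_rw [← Finset.mul_sum, Finset.sum_add_distrib]
    rw [e1, e2]; linarith
  have h8 : v ^ 2 * ∑ i, ∑ k, ω i k * (g i k * (b i - b k) ^ 2) ≤ wEnergy ω u b := by
    unfold wEnergy
    rw [Finset.mul_sum]
    refine Finset.sum_le_sum fun i _ => ?_
    rw [Finset.mul_sum]
    refine Finset.sum_le_sum fun k _ => ?_
    simp only [hg]
    split_ifs with h
    · have := mul_nonneg (hω.nn i k) (sq_nonneg ((u i - u k) * (b i - b k)))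
      simpa using this
    · push Not at h
      have : v ^ 2 ≤ (u i - u k) ^ 2 := by
        rw [← sq_abs (u i - u k)]; exact pow_le_pow_left₀ hv h 2
      have h2 := mul_le_mul_of_nonneg_right this (sq_nonneg (b i - b k))
      have h3 := mul_le_mul_of_nonneg_left h2 (hω.nn i k)
      rw [mul_pow]; linarith
  nlinarith [mul_le_mul_of_nonneg_left h7 (sq_nonneg v)]

end Stein

section LemS
variable {ι : Type*} [Fintype ι] [DecidableEq ι]

/-- invariance under class swaps -/
def ClsInv (ω : ι → ι → ℝ) (f : Equiv.Perm ι → ℝ) : Prop :=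
  ∀ σ i j, ω i j ≠ 0 → f (σ * Equiv.swap i j) = f σ

lemma clsInv_linStat {ω : ι → ι → ℝ} (w a : ι → ℝ) (hw : ∀ i j, ω i j ≠ 0 → w i = w j) :
    ClsInv ω (linStat w a) := by
  intro σ i j h
  rw [linStat_swap, hw i j h]; ring

lemma stein_energy_zero {ω : ι → ι → ℝ} (hω : ClassWt ω) (u a : ι → ℝ) (σ : Equiv.Perm ι)
    (h : energy ω (fun k => a (σ k)) = 0) : linStat u a σ = linStat (clAvg ω u) a σ := by
  have hd := drift hω u (fun i => a (σ i))
  have hz : ∑ i, ∑ j, ω i j * ((u i - u j) * (a (σ i) - a (σ j))) = 0 := by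
    refine Finset.sum_eq_zero fun i _ => Finset.sum_eq_zero fun j _ => ?_
    unfold energy at h
    rw [Finset.sum_eq_zero_iff_of_nonneg (fun i _ => Finset.sum_nonneg fun j _ =>
      mul_nonneg (hω.nn i j) (sq_nonneg _))] at h
    have h1 := h i (mem_univ i)
    rw [Finset.sum_eq_zero_iff_of_nonneg (fun j _ => mul_nonneg (hω.nn i j) (sq_nonneg _))] at h1
    have h2 := h1 j (mem_univ j)
    rcases mul_eq_zero.1 h2 with h3 | h3
    · simp [h3]
    · rw [pow_eq_zero_iff (by norm_num)] at h3
      rw [h3]; ring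
  rw [hz] at hd
  unfold linStat
  linarith

/-- second moment, weighted -/
lemma stein_var {ω : ι → ι → ℝ} (hω : ClassWt ω) (u a : ι → ℝ) (g : Equiv.Perm ι → ℝ)
    (hg : ClsInv ω g) :
    ∑ σ, 2 * (linStat u a σ - linStat (clAvg ω u) a σ) ^ 2 * g σ
      = 1 / 2 * ∑ σ, g σ * wEnergy ω u (fun k => a (σ k)) := by
  have h := stein hω u a (fun σ => g σ * (linStat u a σ - linStat (clAvg ω u) a σ))
  have hM := clsInv_linStat (ω := ω) (clAvg ω u) a (fun i j h => clAvg_eq hω u h)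
  calc _ = ∑ σ, 2 * (linStat u a σ - linStat (clAvg ω u) a σ) *
            (g σ * (linStat u a σ - linStat (clAvg ω u) a σ)) :=
        Finset.sum_congr rfl fun σ _ => by ring
    _ = _ := h
    _ = _ := by
        congr 1
        refine Finset.sum_congr rfl fun σ _ => ?_
        unfold wEnergy
        rw [Finset.mul_sum]
        refine Finset.sum_congr rfl fun i _ => ?_
        rw [Finset.mul_sum]
        refine Finset.sum_congr rfl fun j _ => ?_
        by_cases h0 : ω i j = 0
        · simp [h0]
        rw [hg σ i j h0, hM σ i j h0, linStat_swap]
        ring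

/-- truncation -/
noncomputable def trunc (L z : ℝ) : ℝ := min (max z (-(3 * L))) (3 * L) - 3 * L

lemma trunc_mono (L z z' : ℝ) : 0 ≤ (z - z') * (trunc L z - trunc L z') := by
  unfold trunc
  rcases le_total z z' with h | h
  · have : min (max z (-(3 * L))) (3 * L) ≤ min (max z' (-(3 * L))) (3 * L) := by gcongr
    nlinarith
  · have : min (max z' (-(3 * L))) (3 * L) ≤ min (max z (-(3 * L))) (3 * L) := by gcongr
    nlinarith

lemma trunc_eq (L z : ℝ) (h : |z| ≤ 3 * L) : trunc L z = z - 3 * L := by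
  unfold trunc
  rw [abs_le] at h
  rw [max_eq_left h.1, min_eq_left h.2]

lemma trunc_drift (L z M : ℝ) (hL : 0 < L) (hM : 8 * L < M) :
    2 * (z - M) * trunc L z ≤ 24 * (L / M) * (z - M) ^ 2 := by
  have hM0 : 0 < M := by linarith
  have hr : 0 ≤ 24 * (L / M) * (z - M) ^ 2 := by positivity
  by_cases hz : 3 * L ≤ z
  · have : trunc L z = 0 := by
      unfold trunc
      rw [min_eq_right (le_trans hz (le_max_left _ _))]; ring
    rw [this]; linarith
  push Not at hz
  have h1 : -(6 * L) ≤ trunc L z := by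
    unfold trunc
    have : -(3 * L) ≤ min (max z (-(3 * L))) (3 * L) := le_min (le_max_right _ _) (by linarith)
    linarith
  have h2 : 2 * (z - M) * trunc L z ≤ 12 * L * (M - z) := by nlinarith
  refine h2.trans ?_
  have h3 : 24 * (L / M) * (z - M) ^ 2 = 12 * L * (M - z) * (2 * (M - z) / M) := by
    field_simp; ring
  rw [h3]
  have h4 : 1 ≤ 2 * (M - z) / M := by rw [le_div_iff₀ hM0]; linarith
  have h5 : 0 ≤ 12 * L * (M - z) := mul_nonneg (by linarith) (by linarith)
  nlinarith

open scoped Classical in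
lemma lemS_pos {ω : ι → ι → ℝ} (hω : ClassWt ω) (u a : ι → ℝ) (ψ L : Equiv.Perm ι → ℝ)
    (hψ : ClsInv ω ψ) (hL : ClsInv ω L) (hψ0 : ∀ σ, 0 ≤ ψ σ) (hL0 : ∀ σ, 0 < L σ)
    (U D v : ℝ) (hU : ∀ i j, |u i - u j| ≤ U) (hD : ∀ i j, |a i - a j| ≤ D)
    (hUD : ∀ σ, U * D ≤ 2 * L σ) (hv : 0 < v)
    (hd : ∀ i, ∑ k, ω i k * (if |u i - u k| < v then 1 else 0) ≤ 1 / 4) :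
    v ^ 2 * ∑ σ, (if 8 * L σ < linStat (clAvg ω u) a σ then
        (if |linStat u a σ| ≤ L σ then ψ σ else 0) else 0)
      ≤ 96 * U ^ 2 * ∑ σ, (if 8 * L σ < linStat (clAvg ω u) a σ then
        ψ σ * (L σ / linStat (clAvg ω u) a σ) else 0) := by
  set M := linStat (clAvg ω u) a with hMdef
  set X := linStat u a with hXdef
  set e : Equiv.Perm ι → ℝ := fun σ => energy ω (fun k => a (σ k)) with he
  have hM : ClsInv ω M := clsInv_linStat (clAvg ω u) a (fun i j h => clAvg_eq hω u h)
  have hE : ClsInv ω e := fun σ i j h => energy_swap hω a σ h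
  have he0 : ∀ σ, 0 ≤ e σ := fun σ => energy_nonneg hω _
  set g : Equiv.Perm ι → ℝ := fun σ => if 8 * L σ < M σ then ψ σ / e σ else 0 with hg
  have hgI : ClsInv ω g := by
    intro σ i j h
    simp only [hg]
    rw [hψ σ i j h, hM σ i j h, hE σ i j h, hL σ i j h]
  have hg0 : ∀ σ, 0 ≤ g σ := by
    intro σ; simp only [hg]; split_ifs
    · exact div_nonneg (hψ0 σ) (he0 σ)
    · exact le_rfl
  set g2 : Equiv.Perm ι → ℝ := fun σ => g σ * (L σ / M σ) with hg2
  have hg2I : ClsInv ω g2 := by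
    intro σ i j h
    simp only [hg2]
    rw [hgI σ i j h, hM σ i j h, hL σ i j h]
  have hg2_le : ∀ σ, g2 σ * e σ ≤ (if 8 * L σ < M σ then ψ σ * (L σ / M σ) else 0) := by
    intro σ
    simp only [hg2, hg]
    split_ifs with h
    · have hMp : 0 < M σ := by linarith [hL0 σ]
      have h1 : ψ σ / e σ * e σ ≤ ψ σ := by
        by_cases hz : e σ = 0
        · rw [hz]; simpa using hψ0 σ
        · rw [div_mul_cancel₀ _ hz]
      have h2 : 0 ≤ L σ / M σ := (div_pos (hL0 σ) hMp).le
      nlinarith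
    · simp
  have hg20 : ∀ σ, 0 ≤ g2 σ := by
    intro σ
    by_cases h : 8 * L σ < M σ
    · have hMp : 0 < M σ := by linarith [hL0 σ]
      exact mul_nonneg (hg0 σ) (div_pos (hL0 σ) hMp).le
    · simp [hg2, hg, h]
  -- upper bound
  have hup : ∑ σ, 2 * (X σ - M σ) * (g σ * trunc (L σ) (X σ)) ≤ 6 * U ^ 2 *
      ∑ σ, (if 8 * L σ < M σ then ψ σ * (L σ / M σ) else 0) := by
    have s1 : ∑ σ, 2 * (X σ - M σ) * (g σ * trunc (L σ) (X σ)) ≤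
        12 * ∑ σ, 2 * (X σ - M σ) ^ 2 * g2 σ := by
      rw [Finset.mul_sum]
      refine Finset.sum_le_sum fun σ _ => ?_
      by_cases h : 8 * L σ < M σ
      · have := mul_le_mul_of_nonneg_left (trunc_drift (L σ) (X σ) (M σ) (hL0 σ) h) (hg0 σ)
        simp only [hg2]; linarith
      · simp [hg2, hg, h]
    have s2 := stein_var hω u a g2 hg2I
    rw [← hMdef, ← hXdef] at s2
    rw [s2] at s1
    refine s1.trans ?_
    have s3 : ∑ σ, g2 σ * wEnergy ω u (fun k => a (σ k)) ≤
        ∑ σ, U ^ 2 * (if 8 * L σ < M σ then ψ σ * (L σ / M σ) else 0) := by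
      refine Finset.sum_le_sum fun σ _ => ?_
      have := mul_le_mul_of_nonneg_left (wEnergy_le hω u (fun k => a (σ k)) U hU) (hg20 σ)
      refine this.trans ?_
      have h2 := mul_le_mul_of_nonneg_left (hg2_le σ) (sq_nonneg U)
      simp only [he] at h2
      linarith
    rw [← Finset.mul_sum] at s3
    linarith
  -- lower bound
  have hst := stein hω u a (fun σ => g σ * trunc (L σ) (X σ))
  rw [← hMdef, ← hXdef] at hst
  rw [hst] at hup
  have hlow : v ^ 2 * ∑ σ, (if 8 * L σ < M σ then (if |X σ| ≤ L σ then ψ σ else 0) else 0)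
      ≤ 8 * ∑ σ, ∑ i, ∑ j, ω i j * ((X σ - X (σ * Equiv.swap i j)) *
        (g σ * trunc (L σ) (X σ) - g (σ * Equiv.swap i j) *
          trunc (L (σ * Equiv.swap i j)) (X (σ * Equiv.swap i j)))) := by
    rw [Finset.mul_sum, Finset.mul_sum]
    refine Finset.sum_le_sum fun σ _ => ?_
    have ht : ∀ i j, ω i j * ((X σ - X (σ * Equiv.swap i j)) *
        (g σ * trunc (L σ) (X σ) - g (σ * Equiv.swap i j) *
          trunc (L (σ * Equiv.swap i j)) (X (σ * Equiv.swap i j))))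
        = ω i j * (g σ * ((X σ - X (σ * Equiv.swap i j)) *
        (trunc (L σ) (X σ) - trunc (L σ) (X (σ * Equiv.swap i j))))) := by
      intro i j
      by_cases h : ω i j = 0
      · simp [h]
      rw [hgI σ i j h, hL σ i j h]; ring
    have hnn : 0 ≤ ∑ i, ∑ j, ω i j * ((X σ - X (σ * Equiv.swap i j)) *
        (g σ * trunc (L σ) (X σ) - g (σ * Equiv.swap i j) *
          trunc (L (σ * Equiv.swap i j)) (X (σ * Equiv.swap i j)))) := by
      refine Finset.sum_nonneg fun i _ => Finset.sum_nonneg fun j _ => ?_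
      rw [ht]
      exact mul_nonneg (hω.nn i j) (mul_nonneg (hg0 σ) (trunc_mono _ _ _))
    split_ifs with h1 h2
    · have hen : e σ ≠ 0 := by
        intro h0
        have := stein_energy_zero hω u a σ h0
        rw [← hXdef, ← hMdef] at this
        rw [this] at h2
        have := le_abs_self (M σ)
        linarith [hL0 σ]
      have heq : ∑ i, ∑ j, ω i j * ((X σ - X (σ * Equiv.swap i j)) *
        (g σ * trunc (L σ) (X σ) - g (σ * Equiv.swap i j) *
          trunc (L (σ * Equiv.swap i j)) (X (σ * Equiv.swap i j))))
          = g σ * wEnergy ω u (fun k => a (σ k)) := by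
        unfold wEnergy
        rw [Finset.mul_sum]
        refine Finset.sum_congr rfl fun i _ => ?_
        rw [Finset.mul_sum]
        refine Finset.sum_congr rfl fun j _ => ?_
        rw [ht]
        have hx := linStat_swap u a σ i j
        rw [← hXdef] at hx
        have hab : |(u i - u j) * (a (σ i) - a (σ j))| ≤ 2 * L σ := by
          rw [abs_mul]
          exact (mul_le_mul (hU i j) (hD _ _) (abs_nonneg _)
            ((abs_nonneg _).trans (hU i j))).trans (hUD σ)
        rw [trunc_eq _ _ (by linarith [hL0 σ]), trunc_eq, hx]
        · ring
        · rw [hx]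
          have := abs_sub (X σ) ((u i - u j) * (a (σ i) - a (σ j)))
          linarith
      rw [heq]
      have := le_wEnergy hω u (fun k => a (σ k)) v hv.le hd
      have h3 := mul_le_mul_of_nonneg_left this (hg0 σ)
      have h4 : g σ * e σ = ψ σ := by simp only [hg, if_pos h1]; rw [div_mul_cancel₀ _ hen]
      rw [← h4]; simp only [he]; linarith
    · simp only [mul_zero]; linarith
    · simp only [mul_zero]; linarith
  linarith

lemma clAvg_neg (ω : ι → ι → ℝ) (u : ι → ℝ) : clAvg ω (fun i => - u i) = fun i => - clAvg ω u i := by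
  funext i; simp [clAvg]

lemma linStat_neg (u a : ι → ℝ) (σ) : linStat (fun i => - u i) a σ = - linStat u a σ := by
  simp [linStat]

open scoped Classical in
lemma lemS {ω : ι → ι → ℝ} (hω : ClassWt ω) (u a : ι → ℝ) (ψ L : Equiv.Perm ι → ℝ)
    (hψ : ClsInv ω ψ) (hL : ClsInv ω L) (hψ0 : ∀ σ, 0 ≤ ψ σ) (hL0 : ∀ σ, 0 < L σ)
    (U D v : ℝ) (hU : ∀ i j, |u i - u j| ≤ U) (hD : ∀ i j, |a i - a j| ≤ D)
    (hUD : ∀ σ, U * D ≤ 2 * L σ) (hv : 0 < v)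
    (hd : ∀ i, ∑ k, ω i k * (if |u i - u k| < v then 1 else 0) ≤ 1 / 4) :
    v ^ 2 * ∑ σ, (if 8 * L σ < |linStat (clAvg ω u) a σ| then
        (if |linStat u a σ| ≤ L σ then ψ σ else 0) else 0)
      ≤ 96 * U ^ 2 * ∑ σ, (if 8 * L σ < |linStat (clAvg ω u) a σ| then
        ψ σ * (L σ / |linStat (clAvg ω u) a σ|) else 0) := by
  have h1 := lemS_pos hω u a ψ L hψ hL hψ0 hL0 U D v hU hD hUD hv hd
  have h2 := lemS_pos hω (fun i => - u i) a ψ L hψ hL hψ0 hL0 U D v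
    (fun i j => by have := hU j i; rwa [show - u i - - u j = u j - u i by ring]) hD hUD hv
    (fun i => by
      have := hd i
      refine le_trans (le_of_eq ?_) this
      refine Finset.sum_congr rfl fun k _ => ?_
      rw [show - u i - - u k = -(u i - u k) by ring, abs_neg])
  simp only [clAvg_neg, linStat_neg, abs_neg] at h2
  have key : ∀ (f : Equiv.Perm ι → ℝ → ℝ), ∑ σ, (if 8 * L σ < |linStat (clAvg ω u) a σ| then
        f σ |linStat (clAvg ω u) a σ| else 0)
      = ∑ σ, (if 8 * L σ < linStat (clAvg ω u) a σ then f σ (linStat (clAvg ω u) a σ) else 0)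
       + ∑ σ, (if 8 * L σ < - linStat (clAvg ω u) a σ then f σ (-linStat (clAvg ω u) a σ) else 0) := by
    intro f
    rw [← Finset.sum_add_distrib]
    refine Finset.sum_congr rfl fun σ _ => ?_
    have := hL0 σ
    rcases le_total 0 (linStat (clAvg ω u) a σ) with h | h
    · rw [abs_of_nonneg h, if_neg (show ¬ (8 * L σ < - linStat (clAvg ω u) a σ) by linarith), add_zero]
    · rw [abs_of_nonpos h, if_neg (show ¬ (8 * L σ < linStat (clAvg ω u) a σ) by linarith), zero_add]
  rw [key (fun σ _ => if |linStat u a σ| ≤ L σ then ψ σ else 0), key (fun σ m => ψ σ * (L σ / m))]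
  linarith

end LemS

section Chain
variable {Ω : Type*} [Fintype Ω] [DecidableEq Ω]

structure ChainData (Φ : Ω → Ω) (A : ℕ → Ω → Prop) (X Y S : Ω → ℝ) (D R : ℝ) : Prop where
  step : ∀ t σ, A (t + 1) σ → A t (Φ σ)
  one : ∀ t σ, A (t + 1) σ → A 1 σ
  inj : ∀ σ τ, A 1 σ → A 1 τ → Φ σ = Φ τ → σ = τ
  inc : ∀ σ, A 1 σ → X σ + D ≤ X (Φ σ)
  bd : ∀ σ, A 1 σ → X (Φ σ) - X σ ≤ Y (Φ σ) - Y σ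
  Seq : ∀ σ, A 1 σ → S (Φ σ) = S σ
  Ynn : ∀ σ, 0 ≤ Y σ
  YR : ∀ σ, Y σ ≤ R
  Dpos : 0 < D

variable {Φ : Ω → Ω} {A : ℕ → Ω → Prop} {X Y S : Ω → ℝ} {D R : ℝ}

lemma ChainData.iter (h : ChainData Φ A X Y S D R) (k t : ℕ) :
    ∀ σ, A (t + k) σ → A k (Φ^[t] σ) ∧ X σ + t * D ≤ X (Φ^[t] σ) ∧
      X (Φ^[t] σ) - X σ ≤ Y (Φ^[t] σ) - Y σ ∧ S (Φ^[t] σ) = S σ := by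
  induction t with
  | zero => intro σ hσ; simpa using hσ
  | succ t ih =>
    intro σ hσ
    rw [show t + 1 + k = (t + k) + 1 by ring] at hσ
    obtain ⟨h1, h2, h3, h4⟩ := ih (Φ σ) (h.step _ _ hσ)
    have h0 := h.one _ _ hσ
    rw [Function.iterate_succ_apply]
    have e1 := h.inc σ h0
    have e2 := h.bd σ h0
    have e3 := h.Seq σ h0
    refine ⟨h1, ?_, ?_, ?_⟩
    · push_cast; linarith
    · linarith
    · rw [h4, e3]

lemma ChainData.iter_inj (h : ChainData Φ A X Y S D R) (t : ℕ) :
    ∀ σ τ, A t σ → A t τ → Φ^[t] σ = Φ^[t] τ → σ = τ := by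
  induction t with
  | zero => intro σ τ _ _ h; simpa using h
  | succ t ih =>
    intro σ τ hσ hτ he
    rw [Function.iterate_succ_apply, Function.iterate_succ_apply] at he
    exact h.inj _ _ (h.one _ _ hσ) (h.one _ _ hτ)
      (ih _ _ (h.step _ _ hσ) (h.step _ _ hτ) he)

lemma card_le_of_diff (F : Finset ℕ) (K : ℝ) (hK : 0 ≤ K)
    (h : ∀ s ∈ F, ∀ t ∈ F, s ≤ t → (t : ℝ) - s ≤ K) : (F.card : ℝ) ≤ K + 1 := by
  rcases F.eq_empty_or_nonempty with rfl | hne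
  · simp; linarith
  have hsub : F ⊆ Finset.Icc (F.min' hne) (F.min' hne + ⌊K⌋₊) := by
    intro t ht
    rw [Finset.mem_Icc]
    have h1 := F.min'_le t ht
    refine ⟨h1, ?_⟩
    have h2 := h _ (F.min'_mem hne) t ht h1
    have : t - F.min' hne ≤ ⌊K⌋₊ := by
      apply Nat.le_floor
      rw [Nat.cast_sub h1]; exact h2
    omega
  have := Finset.card_le_card hsub
  rw [Nat.card_Icc] at this
  have h3 : F.card ≤ ⌊K⌋₊ + 1 := by omega
  have h4 : (F.card : ℝ) ≤ ⌊K⌋₊ + 1 := by exact_mod_cast h3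
  linarith [Nat.floor_le hK]


open scoped Classical in
lemma ChainData.count (h : ChainData Φ A X Y S D R)
    (hmono : ∀ s t σ, s ≤ t → A t σ → A s σ) (Mc N : ℕ) (hMN : Mc ≤ N) :
    (Mc : ℝ) * ((univ.filter fun σ => A Mc σ ∧ |X σ| ≤ |S σ|).card : ℝ) ≤
      ∑ τ, (if |X τ| ≤ |S τ| + R then min (N : ℝ) (2 * |S τ| / D + 1) else 0) := by
  set E := univ.filter fun σ => A Mc σ ∧ |X σ| ≤ |S σ| with hE
  have hD := h.Dpos
  have hc : (E ×ˢ Finset.range Mc).card = Mc * E.card := by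
    rw [Finset.card_product, Finset.card_range, mul_comm]
  have hf := Finset.card_eq_sum_card_fiberwise (s := E ×ˢ Finset.range Mc) (t := univ)
    (f := fun p => Φ^[p.2] p.1) (fun _ _ => by simp)
  rw [hc] at hf
  have hf' : (Mc : ℝ) * (E.card : ℝ) = ∑ τ, (((E ×ˢ Finset.range Mc).filter
    fun p => Φ^[p.2] p.1 = τ).card : ℝ) := by exact_mod_cast hf
  rw [hf']
  refine Finset.sum_le_sum fun τ _ => ?_
  set F := (E ×ˢ Finset.range Mc).filter fun p => Φ^[p.2] p.1 = τ with hF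
  have memF : ∀ p ∈ F, A Mc p.1 ∧ |X p.1| ≤ |S p.1| ∧ p.2 < Mc ∧ Φ^[p.2] p.1 = τ := by
    intro p hp
    simp only [hF, hE, mem_filter, mem_product, mem_univ, true_and, Finset.mem_range] at hp
    tauto
  have hmem2 : ∀ p ∈ F, A p.2 p.1 := fun p hp =>
    hmono _ _ _ (memF p hp).2.2.1.le (memF p hp).1
  have hS : ∀ p ∈ F, S τ = S p.1 := by
    intro p hp
    have := h.iter 0 p.2 p.1 (hmem2 p hp)
    rw [(memF p hp).2.2.2] at this
    exact this.2.2.2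
  have hX : ∀ p ∈ F, |X τ| ≤ |S τ| + R := by
    intro p hp
    have h1 := h.iter 0 p.2 p.1 (hmem2 p hp)
    have h2 := (memF p hp).2.1
    rw [(memF p hp).2.2.2] at h1
    rw [hS p hp]
    rw [abs_le] at h2 ⊢
    have h3 := h.Ynn p.1
    have h4 := h.YR τ
    have h5 : 0 ≤ (p.2 : ℝ) * D := by positivity
    have h6 := h.Ynn τ
    constructor <;> linarith
  have hinj : Set.InjOn (Prod.snd : Ω × ℕ → ℕ) F := by
    rintro ⟨σ, t⟩ hp ⟨σ', t'⟩ hq heq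
    simp only at heq
    subst heq
    have := h.iter_inj t σ σ' (hmem2 _ hp) (hmem2 _ hq)
      ((memF _ hp).2.2.2.trans (memF _ hq).2.2.2.symm)
    rw [this]
  have hcard : (F.image Prod.snd).card = F.card := Finset.card_image_of_injOn hinj
  rcases F.eq_empty_or_nonempty with h0 | ⟨p0, hp0⟩
  · rw [h0]; simp only [card_empty, Nat.cast_zero]
    split_ifs
    · positivity
    · exact le_rfl
  rw [if_pos (hX p0 hp0), ← hcard]
  refine le_min ?_ ?_
  · have : F.image Prod.snd ⊆ Finset.range Mc := by
      intro t ht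
      obtain ⟨p, hp, rfl⟩ := Finset.mem_image.1 ht
      exact Finset.mem_range.2 (memF p hp).2.2.1
    have := Finset.card_le_card this
    rw [Finset.card_range] at this
    exact_mod_cast this.trans hMN
  · apply card_le_of_diff _ _ (by positivity)
    intro s hs t ht hst
    obtain ⟨⟨σ, s'⟩, hp, rfl⟩ := Finset.mem_image.1 hs
    obtain ⟨⟨σ', t'⟩, hq, rfl⟩ := Finset.mem_image.1 ht
    simp only at hst ⊢
    obtain ⟨d, rfl⟩ := Nat.exists_eq_add_of_le hst
    obtain ⟨a1, a2, a3, a4⟩ := memF _ hp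
    obtain ⟨b1, b2, b3, b4⟩ := memF _ hq
    simp only at a1 a2 a3 a4 b1 b2 b3 b4
    have hAd := h.iter s' d σ' (by rw [add_comm]; exact hmem2 _ hq)
    have he : Φ^[d] σ' = σ := by
      apply h.iter_inj s' _ _ hAd.1 (hmem2 _ hp)
      rw [a4, ← Function.iterate_add_apply, b4]
    rw [he] at hAd
    have hs1 := hS _ hp
    have hs2 := hS _ hq
    simp only at hs1 hs2
    rw [← hs1] at a2
    rw [← hs2] at b2
    rw [abs_le] at a2 b2
    rw [le_div_iff₀ hD]
    push_cast
    nlinarith [hAd.2.1]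

end Chain

section ChainApp
variable {N : ℕ}

lemma eta_sq {η : ℝ} (hη : η = 1 ∨ η = -1) : η ^ 2 = 1 := by rcases hη with h | h <;> rw [h] <;> norm_num

lemma eta_par {η : ℝ} (hη : η = 1 ∨ η = -1) {i j : ℕ} (h : i % 2 = j % 2) : η ^ i = η ^ j := by
  have h2 := eta_sq hη
  rw [← Nat.div_add_mod i 2, ← Nat.div_add_mod j 2, pow_add, pow_add, pow_mul, pow_mul, h2, h]
  simp

lemma eta_abs {η : ℝ} (hη : η = 1 ∨ η = -1) (i : ℕ) : |η ^ i| = 1 := by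
  rw [abs_pow]; rcases hη with h | h <;> rw [h] <;> simp

lemma eta_mul_self {η : ℝ} (hη : η = 1 ∨ η = -1) (i : ℕ) : η ^ i * η ^ i = 1 := by
  rw [← pow_add, ← two_mul, pow_mul, eta_sq hη, one_pow]

/-- weights -/
noncomputable def uW (N : ℕ) (η : ℝ) (i : Fin N) : ℝ := η ^ (i : ℕ) * (i : ℕ)
noncomputable def sW (N : ℕ) (η : ℝ) (i : Fin N) : ℝ := η ^ (i : ℕ)

open scoped Classical in
/-- Positions beyond the position of `h` of the same parity with label in `T`. -/
noncomputable def beyond (κ : Fin N → ℤ) (T : Fin N → Prop) (h : Fin N)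
    (σ : Equiv.Perm (Fin N)) : Finset (Fin N) :=
  univ.filter fun q => κ (σ.symm h) < κ q ∧ (q : ℕ) % 2 = (σ.symm h : ℕ) % 2 ∧ T (σ q)

lemma mem_beyond {κ : Fin N → ℤ} {T : Fin N → Prop} {h : Fin N} {σ : Equiv.Perm (Fin N)} {q : Fin N} :
    q ∈ beyond κ T h σ ↔ κ (σ.symm h) < κ q ∧ (q : ℕ) % 2 = (σ.symm h : ℕ) % 2 ∧ T (σ q) := by
  simp [beyond]

open scoped Classical in
noncomputable def nxt (κ : Fin N → ℤ) (T : Fin N → Prop) (h : Fin N)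
    (σ : Equiv.Perm (Fin N)) : Fin N :=
  if hn : (beyond κ T h σ).Nonempty then (Finset.exists_min_image (beyond κ T h σ) κ hn).choose
  else σ.symm h

lemma nxt_spec (κ : Fin N → ℤ) (T : Fin N → Prop) (h : Fin N)
    (σ : Equiv.Perm (Fin N)) (hn : 1 ≤ (beyond κ T h σ).card) :
    nxt κ T h σ ∈ beyond κ T h σ ∧ ∀ q ∈ beyond κ T h σ, κ (nxt κ T h σ) ≤ κ q := by
  have hn' : (beyond κ T h σ).Nonempty := Finset.card_pos.1 (by omega)
  unfold nxt
  rw [dif_pos hn']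
  exact (Finset.exists_min_image (beyond κ T h σ) κ hn').choose_spec

noncomputable def push1 (κ : Fin N → ℤ) (T : Fin N → Prop) (h : Fin N)
    (σ : Equiv.Perm (Fin N)) : Equiv.Perm (Fin N) :=
  σ * Equiv.swap (σ.symm h) (nxt κ T h σ)

lemma push1_symm (κ : Fin N → ℤ) (T : Fin N → Prop) (h : Fin N) (σ : Equiv.Perm (Fin N)) :
    (push1 κ T h σ).symm h = nxt κ T h σ := by
  rw [Equiv.symm_apply_eq]
  simp [push1]

lemma push1_nxt (κ : Fin N → ℤ) (T : Fin N → Prop) (h : Fin N) (σ : Equiv.Perm (Fin N)) :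
    push1 κ T h σ (σ.symm h) = σ (nxt κ T h σ) := by
  simp [push1]

lemma push1_other (κ : Fin N → ℤ) (T : Fin N → Prop) (h : Fin N) (σ : Equiv.Perm (Fin N))
    (q : Fin N) (h1 : q ≠ σ.symm h) (h2 : q ≠ nxt κ T h σ) : push1 κ T h σ q = σ q := by
  simp [push1, Equiv.swap_apply_of_ne_of_ne h1 h2]

lemma chainApp (η : ℝ) (hη : η = 1 ∨ η = -1) (a : Fin N → ℝ) (κ : Fin N → ℤ) (ε : ℤ)
    (hε : ε = 1 ∨ ε = -1) (hκ : ∀ i j, κ i - κ j = ε * ((i : ℕ) - (j : ℕ))) (hκ0 : ∀ i, 0 ≤ κ i)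
    (hκN : ∀ i, κ i ≤ N) (h : Fin N) (D : ℝ) (hD : 0 < D) (hh : ∀ r, a h - a r ≤ D)
    (T : Fin N → Prop) (hT : ∀ r, T r → D / 2 ≤ a h - a r) :
    ChainData (push1 κ T h) (fun t σ => t ≤ (beyond κ T h σ).card)
      (fun σ => ε * η ^ (σ.symm h : ℕ) * linStat (uW N η) a σ)
      (fun σ => D * κ (σ.symm h)) (linStat (sW N η) a) D (D * N) := by
  have hεε : (ε : ℝ) * ε = 1 := by rcases hε with h | h <;> rw [h] <;> norm_num
  have hκinj : ∀ i j, κ i = κ j → i = j := by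
    intro i j hij
    have := hκ i j
    rw [hij, sub_self] at this
    have h2 : (i : ℤ) - (j : ℤ) = 0 := by rcases hε with h | h <;> rw [h] at this <;> push_cast at * <;> linarith
    ext; omega
  have hXdiff : ∀ σ, 1 ≤ (beyond κ T h σ).card →
      ε * η ^ ((push1 κ T h σ).symm h : ℕ) * linStat (uW N η) a (push1 κ T h σ)
      = ε * η ^ (σ.symm h : ℕ) * linStat (uW N η) a σ +
        ((κ (nxt κ T h σ) - κ (σ.symm h) : ℤ) : ℝ) * (a h - a (σ (nxt κ T h σ))) := by
    intro σ hσ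
    obtain ⟨hm, -⟩ := nxt_spec κ T h σ hσ
    rw [mem_beyond] at hm
    rw [push1_symm]
    unfold push1
    rw [linStat_swap, Equiv.apply_symm_apply]
    set p := nxt κ T h σ
    set y := σ.symm h
    have e1 : η ^ (p : ℕ) = η ^ (y : ℕ) := eta_par hη hm.2.1
    have e2 := eta_mul_self hη (y : ℕ)
    unfold uW
    rw [e1, hκ]
    push_cast
    linear_combination (ε * ((p:ℝ) - y) * (a h - a (σ p))) * e2
  have hgap : ∀ σ, 1 ≤ (beyond κ T h σ).card → 2 ≤ κ (nxt κ T h σ) - κ (σ.symm h) := by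
    intro σ hσ
    obtain ⟨hm, -⟩ := nxt_spec κ T h σ hσ
    rw [mem_beyond] at hm
    have h1 := hκ (nxt κ T h σ) (σ.symm h)
    have h2 := hm.2.1
    have h3 := hm.1
    rcases hε with h | h <;> rw [h] at h1 <;> omega
  refine ⟨?_, ?_, ?_, ?_, ?_, ?_, ?_, ?_, hD⟩
  · intro t σ hσ
    obtain ⟨hm, hmin⟩ := nxt_spec κ T h σ (by omega)
    have hsub : (beyond κ T h σ).erase (nxt κ T h σ) ⊆ beyond κ T h (push1 κ T h σ) := by
      intro q hq
      rw [mem_erase] at hq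
      have hq2 := hmin q hq.2
      rw [mem_beyond] at hm
      have hq3 := mem_beyond.1 hq.2
      rw [mem_beyond, push1_symm]
      refine ⟨lt_of_le_of_ne hq2 fun he => hq.1 (hκinj _ _ he).symm, ?_, ?_⟩
      · rw [hq3.2.1, hm.2.1]
      · rw [push1_other _ _ _ _ _ _ hq.1]
        · exact hq3.2.2
        · rintro rfl; exact lt_irrefl _ hq3.1
    have := Finset.card_le_card hsub
    rw [Finset.card_erase_of_mem hm] at this
    omega
  · intro t σ hσ; omega
  · intro σ τ hσ hτ he
    obtain ⟨hm, hmin⟩ := nxt_spec κ T h σ hσ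
    obtain ⟨hm', hmin'⟩ := nxt_spec κ T h τ hτ
    have hp : nxt κ T h σ = nxt κ T h τ := by rw [← push1_symm, he, push1_symm]
    have aux : ∀ σ τ, 1 ≤ (beyond κ T h σ).card → 1 ≤ (beyond κ T h τ).card →
        push1 κ T h σ = push1 κ T h τ → nxt κ T h σ = nxt κ T h τ →
        ¬ κ (σ.symm h) < κ (τ.symm h) := by
      intro σ τ hσ hτ he hp hlt
      obtain ⟨hm, hmin⟩ := nxt_spec κ T h σ hσ
      obtain ⟨hm', hmin'⟩ := nxt_spec κ T h τ hτ
      rw [mem_beyond] at hm hm'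
      have h1 : push1 κ T h σ (τ.symm h) = τ (nxt κ T h τ) := by rw [he, push1_nxt]
      rw [push1_other] at h1
      · have : τ.symm h ∈ beyond κ T h σ := by
          rw [mem_beyond, h1]
          refine ⟨hlt, ?_, hm'.2.2⟩
          rw [← hm'.2.1, ← hp, hm.2.1]
        have h3 := hmin _ this
        rw [hp] at h3
        have := hm'.1
        omega
      · intro h0; rw [h0] at hlt; exact lt_irrefl _ hlt
      · intro h0; have := hm'.1; rw [h0, ← hp] at this; exact lt_irrefl _ this
    have hy : σ.symm h = τ.symm h := by
      apply hκinj
      have := aux σ τ hσ hτ he hp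
      have := aux τ σ hτ hσ he.symm hp.symm
      omega
    unfold push1 at he
    rw [hp, hy] at he
    exact mul_right_cancel he
  · intro σ hσ
    rw [hXdiff σ hσ]
    obtain ⟨hm, -⟩ := nxt_spec κ T h σ hσ
    rw [mem_beyond] at hm
    have h1 := hT _ hm.2.2
    have h2 : (2 : ℝ) ≤ ((κ (nxt κ T h σ) - κ (σ.symm h) : ℤ) : ℝ) := by exact_mod_cast hgap σ hσ
    nlinarith
  · intro σ hσ
    rw [hXdiff σ hσ, push1_symm]
    have h2 : (2 : ℝ) ≤ ((κ (nxt κ T h σ) - κ (σ.symm h) : ℤ) : ℝ) := by exact_mod_cast hgap σ hσ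
    have := mul_le_mul_of_nonneg_left (hh (σ (nxt κ T h σ))) (by linarith : 0 ≤ ((κ (nxt κ T h σ) - κ (σ.symm h) : ℤ) : ℝ))
    push_cast at *
    linarith
  · intro σ hσ
    obtain ⟨hm, -⟩ := nxt_spec κ T h σ hσ
    rw [mem_beyond] at hm
    unfold push1
    rw [linStat_swap]
    unfold sW
    rw [eta_par hη hm.2.1]; ring
  · intro σ
    have : (0 : ℝ) ≤ κ (σ.symm h) := by exact_mod_cast hκ0 _
    positivity
  · intro σ
    have : (κ (σ.symm h) : ℝ) ≤ N := by exact_mod_cast hκN _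
    exact mul_le_mul_of_nonneg_left this hD.le

open scoped Classical in
lemma chainCount (η : ℝ) (hη : η = 1 ∨ η = -1) (a : Fin N → ℝ) (κ : Fin N → ℤ) (ε : ℤ)
    (hε : ε = 1 ∨ ε = -1) (hκ : ∀ i j, κ i - κ j = ε * ((i : ℕ) - (j : ℕ))) (hκ0 : ∀ i, 0 ≤ κ i)
    (hκN : ∀ i, κ i ≤ N) (h : Fin N) (D : ℝ) (hD : 0 < D) (hh : ∀ r, a h - a r ≤ D)
    (T : Fin N → Prop) (hT : ∀ r, T r → D / 2 ≤ a h - a r) (Mc : ℕ) (hMc : Mc ≤ N) :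
    (Mc : ℝ) * ((univ.filter fun σ : Equiv.Perm (Fin N) => Mc ≤ (beyond κ T h σ).card ∧
        |linStat (uW N η) a σ| ≤ |linStat (sW N η) a σ|).card : ℝ) ≤
      ∑ τ, (if |linStat (uW N η) a τ| ≤ |linStat (sW N η) a τ| + D * N then
        min (N : ℝ) (2 * |linStat (sW N η) a τ| / D + 1) else 0) := by
  have h1 := (chainApp η hη a κ ε hε hκ hκ0 hκN h D hD hh T hT).count
    (fun s t σ hst hA => hst.trans hA) Mc N hMc
  have habs : ∀ σ : Equiv.Perm (Fin N), |(ε : ℝ) * η ^ (σ.symm h : ℕ) * linStat (uW N η) a σ|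
      = |linStat (uW N η) a σ| := by
    intro σ
    rw [abs_mul, abs_mul, eta_abs hη]
    have : |(ε : ℝ)| = 1 := by rcases hε with h | h <;> rw [h] <;> simp
    rw [this]; ring
  simp only [habs] at h1
  exact h1

end ChainApp

section S2
variable {ι : Type*} [Fintype ι] [DecidableEq ι]

open scoped Classical in
lemma lemS2 {ω : ι → ι → ℝ} (hω : ClassWt ω) (u a : ι → ℝ) (ψ L : Equiv.Perm ι → ℝ)
    (hψ : ClsInv ω ψ) (hL : ClsInv ω L) (hψ0 : ∀ σ, 0 ≤ ψ σ) (hL0 : ∀ σ, 0 < L σ)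
    (U D v : ℝ) (hU : ∀ i j, |u i - u j| ≤ U) (hD : ∀ i j, |a i - a j| ≤ D)
    (hUD : ∀ σ, U * D ≤ 2 * L σ) (hv : 0 < v) (hUv : U = 64 * v)
    (hd : ∀ i, ∑ k, ω i k * (if |u i - u k| < v then 1 else 0) ≤ 1 / 4) (B : ℝ) (hB : 0 ≤ B)
    (hBM : ∀ σ, ψ σ * L σ ≤ B * |linStat (clAvg ω u) a σ|) :
    ∑ σ, (if |linStat u a σ| ≤ L σ then ψ σ else 0) ≤
      400000 * B * (Fintype.card (Equiv.Perm ι) : ℝ) := by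
  have h := lemS hω u a ψ L hψ hL hψ0 hL0 U D v hU hD hUD hv hd
  set M := linStat (clAvg ω u) a
  set X := linStat u a
  have h1 : ∑ σ, (if 8 * L σ < |M σ| then ψ σ * (L σ / |M σ|) else 0) ≤
      B * (Fintype.card (Equiv.Perm ι) : ℝ) := by
    rw [mul_comm, ← nsmul_eq_mul, ← Finset.card_univ, ← Finset.sum_const]
    refine Finset.sum_le_sum fun σ _ => ?_
    split_ifs with h2
    · have := hL0 σ
      rw [← mul_div_assoc, div_le_iff₀ (by linarith)]
      exact hBM σ
    · exact hB
  have h2 : ∑ σ, (if |X σ| ≤ L σ then ψ σ else 0) ≤ 8 * B * (Fintype.card (Equiv.Perm ι) : ℝ) +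
      ∑ σ, (if 8 * L σ < |M σ| then (if |X σ| ≤ L σ then ψ σ else 0) else 0) := by
    rw [mul_comm (8 * B), ← nsmul_eq_mul, ← Finset.card_univ, ← Finset.sum_const,
      ← Finset.sum_add_distrib]
    refine Finset.sum_le_sum fun σ _ => ?_
    by_cases h3 : 8 * L σ < |M σ|
    · rw [if_pos h3]; linarith
    · rw [if_neg h3, add_zero]
      have := hL0 σ
      have h5 : ψ σ ≤ 8 * B := by
        have h4 := hBM σ
        have : ψ σ * L σ ≤ (8 * B) * L σ := by nlinarith
        exact le_of_mul_le_mul_right this (hL0 σ)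
      split_ifs
      · exact h5
      · linarith
  rw [hUv] at h
  have h3 : ∑ σ, (if 8 * L σ < |M σ| then (if |X σ| ≤ L σ then ψ σ else 0) else 0) ≤
      393216 * ∑ σ, (if 8 * L σ < |M σ| then ψ σ * (L σ / |M σ|) else 0) := by
    have hv2 : 0 < v ^ 2 := by positivity
    refine le_of_mul_le_mul_left ?_ hv2
    linarith
  have h4 : 0 ≤ B * (Fintype.card (Equiv.Perm ι) : ℝ) := by positivity
  linarith
end S2

section Weights
variable {N : ℕ}

noncomputable def pcls (i : Fin N) : Finset (Fin N) := univ.filter fun k => (k : ℕ) % 2 = (i : ℕ) % 2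

noncomputable def wPar (N : ℕ) (i j : Fin N) : ℝ :=
  if (i : ℕ) % 2 = (j : ℕ) % 2 then 1 / ((pcls i).card : ℝ) else 0

noncomputable def wUni (N : ℕ) (_ _ : Fin N) : ℝ := 1 / (N : ℝ)

lemma pcls_eq {i j : Fin N} (h : (i : ℕ) % 2 = (j : ℕ) % 2) : pcls i = pcls j := by
  unfold pcls; rw [h]

lemma pcls_pos (i : Fin N) : 0 < (pcls i).card :=
  Finset.card_pos.2 ⟨i, by simp [pcls]⟩

lemma wPar_cls (N : ℕ) : ClassWt (wPar N) where
  sym i j := by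
    unfold wPar
    by_cases h : (i : ℕ) % 2 = (j : ℕ) % 2
    · rw [if_pos h, if_pos h.symm, pcls_eq h]
    · rw [if_neg h, if_neg (fun h' => h h'.symm)]
  nn i j := by unfold wPar; split_ifs <;> positivity
  row i := by
    unfold wPar
    rw [← Finset.sum_filter]
    rw [Finset.sum_const, nsmul_eq_mul]
    have : (univ.filter fun j : Fin N => (i : ℕ) % 2 = (j : ℕ) % 2) = pcls i := by
      ext j; simp [pcls, eq_comm]
    rw [this]
    have := pcls_pos i
    field_simp
  cls i j h k := by
    unfold wPar at *
    have h' : (i : ℕ) % 2 = (j : ℕ) % 2 := by by_contra h0; simp [h0] at h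
    rw [pcls_eq h', h']

lemma wPar_ne {i j : Fin N} (h : wPar N i j ≠ 0) : (i : ℕ) % 2 = (j : ℕ) % 2 := by
  by_contra h0; simp [wPar, h0] at h

lemma wUni_cls (hN : 0 < N) : ClassWt (wUni N) where
  sym i j := rfl
  nn i j := by unfold wUni; positivity
  row i := by
    unfold wUni; simp; field_simp
  cls i j h k := rfl

lemma card_even (q : ℕ) : ((Finset.range (2 * q)).filter fun k => k % 2 = 0).card = q ∧
    ((Finset.range (2 * q)).filter fun k => k % 2 = 1).card = q := by
  induction q with
  | zero => simp
  | succ q ih =>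
    rw [show 2 * (q + 1) = 2 * q + 1 + 1 by ring, Finset.range_add_one, Finset.range_add_one]
    simp only [Finset.filter_insert]
    rw [if_neg (by omega), if_pos (by omega), if_pos (by omega), if_neg (by omega)]
    rw [Finset.card_insert_of_notMem (by simp), Finset.card_insert_of_notMem (by simp), ih.1, ih.2]
    exact ⟨rfl, rfl⟩

lemma sum_even (q : ℕ) : (∑ k ∈ (Finset.range (2 * q)).filter (fun k => k % 2 = 0), (k : ℝ)) = q * (q - 1) ∧
    (∑ k ∈ (Finset.range (2 * q)).filter (fun k => k % 2 = 1), (k : ℝ)) = q * q := by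
  induction q with
  | zero => simp
  | succ q ih =>
    rw [show 2 * (q + 1) = 2 * q + 1 + 1 by ring, Finset.range_add_one, Finset.range_add_one]
    simp only [Finset.filter_insert]
    rw [if_neg (by omega), if_pos (by omega), if_pos (by omega), if_neg (by omega)]
    rw [Finset.sum_insert (by simp), Finset.sum_insert (by simp), ih.1, ih.2]
    push_cast
    constructor <;> ring

lemma pcls_sum (i : Fin N) (f : ℕ → ℝ) :
    ∑ k ∈ pcls i, f k = ∑ k ∈ (Finset.range N).filter (fun k => k % 2 = (i : ℕ) % 2), f k := by
  unfold pcls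
  rw [Finset.sum_filter, Finset.sum_filter, Finset.sum_range]

lemma pcls_card (i : Fin N) : ((pcls i).card : ℝ) =
    (((Finset.range N).filter (fun k => k % 2 = (i : ℕ) % 2)).card : ℝ) := by
  have := pcls_sum i (fun _ => 1)
  simpa using this

lemma pcls_card_ge (i : Fin N) : ((N : ℝ) - 1) / 2 ≤ ((pcls i).card : ℝ) := by
  rw [pcls_card]
  have hsub : (Finset.range (2 * (N / 2))).filter (fun k => k % 2 = (i : ℕ) % 2) ⊆
      (Finset.range N).filter (fun k => k % 2 = (i : ℕ) % 2) := by
    intro k hk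
    simp only [mem_filter, Finset.mem_range] at hk ⊢
    exact ⟨by omega, hk.2⟩
  have h1 := Finset.card_le_card hsub
  have h2 : ((Finset.range (2 * (N / 2))).filter (fun k => k % 2 = (i : ℕ) % 2)).card = N / 2 := by
    rcases Nat.mod_two_eq_zero_or_one (i : ℕ) with h | h <;> rw [h]
    · exact (card_even _).1
    · exact (card_even _).2
  rw [h2] at h1
  have h3 : N ≤ 2 * (N / 2) + 1 := by omega
  have h4 : (N : ℝ) ≤ 2 * ((N / 2 : ℕ) : ℝ) + 1 := by exact_mod_cast h3
  have h5 : ((N / 2 : ℕ) : ℝ) ≤ (((Finset.range N).filter (fun k => k % 2 = (i : ℕ) % 2)).card : ℝ) := by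
    exact_mod_cast h1
  linarith

lemma clAvg_par (η : ℝ) (hη : η = 1 ∨ η = -1) (i : Fin N) :
    clAvg (wPar N) (uW N η) i = η ^ (i : ℕ) * ((∑ k ∈ pcls i, ((k : ℕ) : ℝ)) / ((pcls i).card : ℝ)) := by
  unfold clAvg wPar uW
  have : ∀ j : Fin N, (if (i : ℕ) % 2 = (j : ℕ) % 2 then 1 / ((pcls i).card : ℝ) else 0) *
      (η ^ (j : ℕ) * (j : ℕ)) = if (j : ℕ) % 2 = (i : ℕ) % 2 then
        η ^ (i : ℕ) * (((j : ℕ) : ℝ) / ((pcls i).card : ℝ)) else 0 := by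
    intro j
    by_cases h : (i : ℕ) % 2 = (j : ℕ) % 2
    · rw [if_pos h, if_pos h.symm, eta_par hη h]; ring
    · rw [if_neg h, if_neg (fun h' => h h'.symm)]; ring
  simp_rw [this]
  rw [← Finset.sum_filter, ← Finset.mul_sum, Finset.sum_div]
  rfl

lemma clAvg_par_even (q : ℕ) (hq : 0 < q) (η : ℝ) (hη : η = 1 ∨ η = -1) (i : Fin (2 * q)) :
    clAvg (wPar (2 * q)) (uW (2 * q) η) i = ((2 * q - 1) * η ^ (i : ℕ) - (-η) ^ (i : ℕ)) / 2 := by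
  rw [clAvg_par η hη, pcls_sum i (fun k => (k : ℝ)), pcls_card]
  rcases Nat.mod_two_eq_zero_or_one (i : ℕ) with h | h <;> rw [h]
  · rw [(sum_even q).1, (card_even q).1, Even.neg_pow (Nat.even_iff.2 h)]
    field_simp; ring
  · rw [(sum_even q).2, (card_even q).2, Odd.neg_pow (Nat.odd_iff.2 h)]
    field_simp; ring

lemma clAvg_par_odd (q : ℕ) (η : ℝ) (hη : η = 1 ∨ η = -1) (i : Fin (2 * q + 1)) :
    clAvg (wPar (2 * q + 1)) (uW (2 * q + 1) η) i = q * η ^ (i : ℕ) := by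
  rw [clAvg_par η hη, pcls_sum i (fun k => (k : ℝ)), pcls_card]
  rw [Finset.range_add_one]
  simp only [Finset.filter_insert]
  rcases Nat.mod_two_eq_zero_or_one (i : ℕ) with h | h <;> rw [h]
  · rw [if_pos (by omega), Finset.sum_insert (by simp), Finset.card_insert_of_notMem (by simp),
      (sum_even q).1, (card_even q).1]
    push_cast
    field_simp; ring
  · rw [if_neg (by omega), (sum_even q).2, (card_even q).2]
    have : q ≠ 0 := by have := i.2; omega
    field_simp

lemma sum_alt_even (q : ℕ) : ∑ k ∈ Finset.range (2 * q), (-1 : ℝ) ^ k = 0 := by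
  induction q with
  | zero => simp
  | succ q ih =>
    rw [show 2 * (q + 1) = 2 * q + 1 + 1 by ring, Finset.sum_range_succ, Finset.sum_range_succ, ih,
      pow_succ]; ring

lemma sum_alt_even_mul (q : ℕ) : ∑ k ∈ Finset.range (2 * q), (-1 : ℝ) ^ k * k = - q := by
  induction q with
  | zero => simp
  | succ q ih =>
    rw [show 2 * (q + 1) = 2 * q + 1 + 1 by ring, Finset.sum_range_succ, Finset.sum_range_succ, ih,
      pow_succ, pow_mul]; push_cast; norm_num; ring

lemma uW_diff (η : ℝ) (hη : η = 1 ∨ η = -1) (i j : Fin N) : |uW N η i - uW N η j| ≤ 2 * N := by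
  have h : ∀ i : Fin N, |uW N η i| ≤ N := by
    intro i
    unfold uW
    rw [abs_mul, eta_abs hη, one_mul, Nat.abs_cast]
    exact_mod_cast i.2.le
  have := abs_sub (uW N η i) (uW N η j)
  linarith [h i, h j]

open scoped Classical in
lemma uW_near (η : ℝ) (hη : η = 1 ∨ η = -1) (i : Fin N) :
    ((univ.filter fun k => |uW N η i - uW N η k| < (N : ℝ) / 32).card : ℝ) ≤ (N : ℝ) / 16 + 1 := by
  obtain ⟨z, hz⟩ : ∃ z : ℤ, (z : ℝ) = η := by
    rcases hη with h | h
    · exact ⟨1, by simp [h]⟩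
    · exact ⟨-1, by simp [h]⟩
  set w : Fin N → ℤ := fun k => z ^ (k : ℕ) * (k : ℕ) with hw
  have hwu : ∀ k, (w k : ℝ) = uW N η k := by intro k; simp [hw, uW, hz]
  have hwinj : ∀ k l, w k = w l → k = l := by
    intro k l h
    have h2 : |uW N η k| = |uW N η l| := by rw [← hwu, ← hwu, h]
    unfold uW at h2
    rw [abs_mul, abs_mul, eta_abs hη, eta_abs hη, one_mul, one_mul, Nat.abs_cast, Nat.abs_cast] at h2
    ext; exact_mod_cast h2
  have hsub : (univ.filter fun k => |uW N η i - uW N η k| < (N : ℝ) / 32).image w ⊆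
      Finset.Icc (w i - ((N / 32 : ℕ) : ℤ)) (w i + ((N / 32 : ℕ) : ℤ)) := by
    intro t ht
    obtain ⟨k, hk, rfl⟩ := Finset.mem_image.1 ht
    simp only [mem_filter, mem_univ, true_and] at hk
    rw [← hwu, ← hwu, abs_lt] at hk
    have h1 : (32 * (w i - w k) : ℤ) < N := by
      have : (32 * ((w i : ℝ) - w k)) < N := by linarith [hk.2]
      exact_mod_cast this
    have h2 : -(N : ℤ) < (32 * (w i - w k) : ℤ) := by
      have : -(N : ℝ) < (32 * ((w i : ℝ) - w k)) := by linarith [hk.1]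
      exact_mod_cast this
    rw [Finset.mem_Icc]
    constructor <;> omega
  have hc := Finset.card_le_card hsub
  rw [Finset.card_image_of_injective _ (fun k l h => hwinj k l h), Int.card_Icc] at hc
  have h3 : (univ.filter fun k => |uW N η i - uW N η k| < (N : ℝ) / 32).card ≤ 2 * (N / 32) + 1 := by
    omega
  have h4 : (((N / 32 : ℕ)) : ℝ) ≤ (N : ℝ) / 32 := by exact_mod_cast Nat.cast_div_le
  have h5 : ((univ.filter fun k => |uW N η i - uW N η k| < (N : ℝ) / 32).card : ℝ) ≤
      2 * ((N / 32 : ℕ) : ℝ) + 1 := by exact_mod_cast h3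
  linarith

open scoped Classical in
lemma uW_dens_par (hN : 18 ≤ N) (η : ℝ) (hη : η = 1 ∨ η = -1) (i : Fin N) :
    ∑ k, wPar N i k * (if |uW N η i - uW N η k| < (N : ℝ) / 32 then 1 else 0) ≤ 1 / 4 := by
  have h18 : (18 : ℝ) ≤ N := by exact_mod_cast hN
  have hc := pcls_card_ge i
  have hp : 0 < ((pcls i).card : ℝ) := by linarith
  have h1 : ∑ k, wPar N i k * (if |uW N η i - uW N η k| < (N : ℝ) / 32 then 1 else 0) ≤
      ∑ k, (if |uW N η i - uW N η k| < (N : ℝ) / 32 then 1 / ((pcls i).card : ℝ) else 0) := by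
    refine Finset.sum_le_sum fun k _ => ?_
    have : wPar N i k ≤ 1 / ((pcls i).card : ℝ) := by
      unfold wPar; split_ifs
      · exact le_rfl
      · positivity
    split_ifs <;> linarith
  refine h1.trans ?_
  rw [← Finset.sum_filter, Finset.sum_const, nsmul_eq_mul, mul_one_div, div_le_iff₀ hp]
  have := uW_near η hη i
  linarith

open scoped Classical in
lemma uW_dens_uni (hN : 18 ≤ N) (η : ℝ) (hη : η = 1 ∨ η = -1) (i : Fin N) :
    ∑ k, wUni N i k * (if |uW N η i - uW N η k| < (N : ℝ) / 32 then 1 else 0) ≤ 1 / 4 := by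
  have h18 : (18 : ℝ) ≤ N := by exact_mod_cast hN
  unfold wUni
  rw [← Finset.mul_sum, Finset.sum_boole]
  have := uW_near η hη i
  rw [one_div, inv_mul_le_iff₀ (by linarith)]
  linarith

lemma linStat_const_mul (c : ℝ) (w a : Fin N → ℝ) (σ) :
    linStat (fun i => c * w i) a σ = c * linStat w a σ := by
  unfold linStat; rw [Finset.mul_sum]; exact Finset.sum_congr rfl fun i _ => by ring

lemma M_odd (q : ℕ) (hN : N = 2 * q + 1) (η : ℝ) (hη : η = 1 ∨ η = -1) (a : Fin N → ℝ) (σ) :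
    linStat (clAvg (wPar N) (uW N η)) a σ = q * linStat (sW N η) a σ := by
  subst hN
  rw [← linStat_const_mul]
  congr 1
  funext i
  rw [clAvg_par_odd q η hη]; rfl

lemma M_even (q : ℕ) (hq : 0 < q) (hN : N = 2 * q) (η : ℝ) (hη : η = 1 ∨ η = -1) (a : Fin N → ℝ) (σ) :
    linStat (clAvg (wPar N) (uW N η)) a σ =
      ((N - 1) * linStat (sW N η) a σ - linStat (sW N (-η)) a σ) / 2 := by
  subst hN
  unfold linStat
  rw [Finset.mul_sum, ← Finset.sum_sub_distrib, Finset.sum_div]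
  refine Finset.sum_congr rfl fun i _ => ?_
  rw [clAvg_par_even q hq η hη]; unfold sW; push_cast; ring

lemma M_uni (q : ℕ) (hq : 0 < q) (hN : N = 2 * q) (a : Fin N → ℝ) (σ) :
    linStat (clAvg (wUni N) (uW N (-1))) a σ = - (∑ i, a i) / 2 := by
  subst hN
  have : ∀ i, clAvg (wUni (2 * q)) (uW (2 * q) (-1)) i = -1 / 2 := by
    intro i
    unfold clAvg wUni uW
    rw [← Finset.mul_sum]
    have := sum_alt_even_mul q
    rw [Finset.sum_range] at this
    rw [this]; push_cast; field_simp
  unfold linStat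
  simp_rw [this]
  rw [← Finset.mul_sum, Equiv.sum_comp σ a]; ring

lemma alt_bd (q : ℕ) (hq : 0 < q) (hN : N = 2 * q) (a : Fin N → ℝ) (D : ℝ)
    (hD : ∀ i j, |a i - a j| ≤ D) (σ) : |linStat (sW N (-1)) a σ| ≤ D * N := by
  have i0 : Fin N := ⟨0, by omega⟩
  have hz : ∑ i : Fin N, sW N (-1) i = 0 := by
    have := sum_alt_even q
    rw [← hN, Finset.sum_range] at this
    exact this
  have : linStat (sW N (-1)) a σ = ∑ i, sW N (-1) i * (a (σ i) - a i0) := by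
    simp_rw [mul_sub]
    rw [Finset.sum_sub_distrib, ← Finset.sum_mul, hz]
    simp [linStat]
  rw [this]
  refine (Finset.abs_sum_le_sum_abs _ _).trans ?_
  have : ∀ i ∈ (univ : Finset (Fin N)), |sW N (-1) i * (a (σ i) - a i0)| ≤ D := by
    intro i _
    rw [abs_mul]
    unfold sW
    rw [eta_abs (Or.inr rfl), one_mul]; exact hD _ _
  refine (Finset.sum_le_card_nsmul _ _ _ this).trans ?_
  rw [nsmul_eq_mul, Finset.card_univ, Fintype.card_fin]; linarith

end Weights

section Claims
variable {N : ℕ}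

open scoped Classical in
lemma claim1 (hN : 18 ≤ N) (η : ℝ) (hη : η = 1 ∨ η = -1) (a : Fin N → ℝ) (D : ℝ) (hD : 0 < D)
    (hDa : ∀ i j, |a i - a j| ≤ D) :
    ∑ τ, (if |linStat (uW N η) a τ| ≤ |linStat (sW N η) a τ| + D * N then
        min (N : ℝ) (2 * |linStat (sW N η) a τ| / D + 1) else 0) ≤
      20000000 * (Fintype.card (Equiv.Perm (Fin N)) : ℝ) := by
  have h18 : (18 : ℝ) ≤ N := by exact_mod_cast hN
  set X := linStat (uW N η) a with hX
  set S := linStat (sW N η) a with hS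
  set M := linStat (clAvg (wPar N) (uW N η)) a with hM
  set ψ : Equiv.Perm (Fin N) → ℝ := fun τ => min (N : ℝ) (2 * |S τ| / D + 1) with hψ
  set L : Equiv.Perm (Fin N) → ℝ := fun τ => |S τ| + D * N with hL
  set Q : Equiv.Perm (Fin N) → Prop := fun τ => 2 * D < |S τ| ∧ |S τ| * N / 8 ≤ |M τ| with hQ
  set ψ1 : Equiv.Perm (Fin N) → ℝ := fun τ => if Q τ then ψ τ else 0 with hψ1
  have hSI : ClsInv (wPar N) S := clsInv_linStat _ _ fun i j h => eta_par hη (wPar_ne h)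
  have hMI : ClsInv (wPar N) M := clsInv_linStat _ _ fun i j h => clAvg_eq (wPar_cls N) _ h
  have hψ0 : ∀ τ, 0 ≤ ψ τ := fun τ => le_min (by positivity) (by positivity)
  have hψN : ∀ τ, ψ τ ≤ N := fun τ => min_le_left _ _
  have hψS : ∀ τ, 2 * D < |S τ| → ψ τ * D ≤ 3 * |S τ| := by
    intro τ h
    have h1 : ψ τ ≤ 2 * |S τ| / D + 1 := min_le_right _ _
    have h2 := mul_le_mul_of_nonneg_right h1 hD.le
    have h3 : (2 * |S τ| / D + 1) * D = 2 * |S τ| + D := by field_simp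
    linarith
  have hDN : 0 < D * N := by positivity
  -- main term
  have hmain : ∑ τ, (if |X τ| ≤ L τ then ψ1 τ else 0) ≤
      400000 * 32 * (Fintype.card (Equiv.Perm (Fin N)) : ℝ) := by
    refine lemS2 (wPar_cls N) (uW N η) a ψ1 L ?_ ?_ ?_ ?_ (2 * N) D (N / 32) (uW_diff η hη) hDa ?_
      (by positivity) (by ring) (uW_dens_par hN η hη) 32 (by norm_num) ?_
    · intro σ i j h
      simp only [hψ1, hQ, hψ]
      rw [hSI σ i j h, hMI σ i j h]
    · intro σ i j h
      simp only [hL]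
      rw [hSI σ i j h]
    · intro σ; simp only [hψ1]; split_ifs
      · exact hψ0 σ
      · exact le_rfl
    · intro σ; simp only [hL]; positivity
    · intro σ; simp only [hL]; have := abs_nonneg (S σ); linarith
    · intro σ
      rw [← hM]
      simp only [hψ1]
      split_ifs with h
      · simp only [hL]
        have h1 := hψS σ h.1
        have h2 := h.2
        have h3 := mul_le_mul_of_nonneg_right (hψN σ) (abs_nonneg (S σ))
        have h4 := mul_le_mul_of_nonneg_right h1 (by positivity : (0:ℝ) ≤ N)
        linarith
      · simp
  have hc0 : (0:ℝ) ≤ (Fintype.card (Equiv.Perm (Fin N)) : ℝ) := by positivity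
  have hconst : ∑ τ : Equiv.Perm (Fin N), (5 : ℝ) = 5 * (Fintype.card (Equiv.Perm (Fin N)) : ℝ) := by
    rw [Finset.sum_const, nsmul_eq_mul, Finset.card_univ]; ring
  have hsmall : ∀ τ, |S τ| ≤ 2 * D → ψ τ ≤ 5 := by
    intro τ h
    refine (min_le_right _ _).trans ?_
    have : 2 * |S τ| / D ≤ 4 := by rw [div_le_iff₀ hD]; linarith
    linarith
  -- consequence of failing Q
  have hbad : ∀ τ, 2 * D < |S τ| → ¬ Q τ → η = -1 ∧ (∃ q, 0 < q ∧ N = 2 * q) ∧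
      N * |S τ| / 2 ≤ |∑ i, a i| := by
    intro τ h1 h2
    have h3 : |M τ| < |S τ| * N / 8 := by
      by_contra h4; exact h2 ⟨h1, not_lt.1 h4⟩
    have hSp : 0 < |S τ| := by linarith
    rcases Nat.even_or_odd' N with ⟨q, hq | hq⟩
    · have hqp : 0 < q := by omega
      have e := M_even q hqp hq η hη a τ
      rw [← hM, ← hS] at e
      have e2 : linStat (sW N (-η)) a τ = (N - 1) * S τ - 2 * M τ := by linarith
      have e3 : N * |S τ| / 2 ≤ |linStat (sW N (-η)) a τ| := by
        rw [e2]
        have t1 := abs_sub_abs_le_abs_sub ((N - 1) * S τ) (2 * M τ)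
        rw [abs_mul, abs_mul, abs_of_pos (by linarith : (0:ℝ) < N - 1),
          abs_of_pos (by norm_num : (0:ℝ) < 2)] at t1
        nlinarith
      rcases hη with h | h
      · exfalso
        rw [h] at e3
        have := alt_bd q hqp hq a D hDa τ
        have h5 : N * |S τ| / 2 ≤ D * N := e3.trans this
        nlinarith
      · refine ⟨h, ⟨q, hqp, hq⟩, ?_⟩
        rw [h] at e3
        have : linStat (sW N (-(-1))) a τ = ∑ i, a i := by
          simp only [linStat, sW, neg_neg, one_pow, one_mul]
          exact Equiv.sum_comp τ a
        rwa [this] at e3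
    · exfalso
      have e := M_odd q hq η hη a τ
      rw [← hM, ← hS] at e
      rw [e, abs_mul, Nat.abs_cast] at h3
      have : (N : ℝ) = 2 * q + 1 := by exact_mod_cast hq
      nlinarith
  by_cases hcase : η = -1 ∧ (∃ q, 0 < q ∧ N = 2 * q)
  · obtain ⟨hη1, q, hq, hNq⟩ := hcase
    set t := |∑ i, a i| with ht
    set c := min (N : ℝ) (6 * t / (N * D)) with hc
    set L0 := 2 * t / N + D * N with hL0
    have ht0 : 0 ≤ t := abs_nonneg _
    have hc00 : 0 ≤ c := le_min (by positivity) (by positivity)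
    have hcN : c ≤ N := min_le_left _ _
    have hct : c * (D * N) ≤ 6 * t := by
      have : c ≤ 6 * t / (N * D) := min_le_right _ _
      rw [le_div_iff₀ (by positivity)] at this
      linarith
    have h2 : ∑ τ, (if |X τ| ≤ (fun _ => L0) τ then (fun _ => c) τ else 0) ≤
        400000 * 16 * (Fintype.card (Equiv.Perm (Fin N)) : ℝ) := by
      refine lemS2 (wUni_cls (by omega)) (uW N η) a (fun _ => c) (fun _ => L0) ?_ ?_ ?_ ?_ (2 * N) D (N / 32)
        (uW_diff η hη) hDa ?_ (by positivity) (by ring) (uW_dens_uni hN η hη) 16 (by norm_num) ?_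
      · intro σ i j _; rfl
      · intro σ i j _; rfl
      · intro σ; exact hc00
      · intro σ; simp only [hL0]; positivity
      · intro σ; simp only [hL0]; have : 0 ≤ 2 * t / N := by positivity
        linarith
      · intro σ
        rw [hη1, M_uni q hq hNq, abs_div, abs_neg, ← ht]
        simp only [hL0]
        have h5 : c * (2 * t / N) ≤ 2 * t := by
          rw [← mul_div_assoc, div_le_iff₀ (by positivity)]
          nlinarith
        rw [abs_of_pos (by norm_num : (0:ℝ) < 2)]
        linarith
    have hpt : ∀ τ, (if |X τ| ≤ L τ then ψ τ else 0) ≤ 5 + (if |X τ| ≤ L τ then ψ1 τ else 0) +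
        (if |X τ| ≤ (fun _ => L0) τ then (fun _ => c) τ else 0) := by
      intro τ
      have hz : (0:ℝ) ≤ (if |X τ| ≤ (fun _ => L0) τ then (fun _ => c) τ else 0) := by
        split_ifs
        · exact hc00
        · exact le_rfl
      have hz1 : (0:ℝ) ≤ ψ1 τ := by
        simp only [hψ1]; split_ifs
        · exact hψ0 τ
        · exact le_rfl
      by_cases hx : |X τ| ≤ L τ
      · rw [if_pos hx, if_pos hx]
        by_cases hs : |S τ| ≤ 2 * D
        · linarith [hsmall τ hs]
        push Not at hs
        by_cases hQ' : Q τ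
        · have : ψ1 τ = ψ τ := if_pos hQ'
          linarith
        · obtain ⟨-, -, h3⟩ := hbad τ hs hQ'
          have hSt : |S τ| ≤ 2 * t / N := by rw [le_div_iff₀ (by positivity)]; linarith
          have hψc : ψ τ ≤ c := by
            refine le_min (hψN τ) ?_
            rw [le_div_iff₀ (by positivity)]
            have := mul_le_mul_of_nonneg_right (hψS τ hs) (by positivity : (0:ℝ) ≤ N)
            nlinarith
          have : |X τ| ≤ L0 := by
            refine hx.trans ?_
            simp only [hL, hL0]; linarith
          rw [if_pos this]
          simp only
          linarith
      · rw [if_neg hx, if_neg hx]; linarith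
    have := Finset.sum_le_sum fun τ (_ : τ ∈ univ) => hpt τ
    rw [Finset.sum_add_distrib, Finset.sum_add_distrib, hconst] at this
    refine this.trans ?_
    linarith
  · have hpt : ∀ τ, (if |X τ| ≤ L τ then ψ τ else 0) ≤ 5 + (if |X τ| ≤ L τ then ψ1 τ else 0) := by
      intro τ
      have hz1 : (0:ℝ) ≤ ψ1 τ := by
        simp only [hψ1]; split_ifs
        · exact hψ0 τ
        · exact le_rfl
      by_cases hx : |X τ| ≤ L τ
      · rw [if_pos hx, if_pos hx]
        by_cases hs : |S τ| ≤ 2 * D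
        · linarith [hsmall τ hs]
        push Not at hs
        by_cases hQ' : Q τ
        · have : ψ1 τ = ψ τ := if_pos hQ'
          linarith
        · obtain ⟨h1, h2, -⟩ := hbad τ hs hQ'
          exact absurd ⟨h1, h2⟩ hcase
      · rw [if_neg hx, if_neg hx]; linarith
    have := Finset.sum_le_sum fun τ (_ : τ ∈ univ) => hpt τ
    rw [Finset.sum_add_distrib, hconst] at this
    refine this.trans ?_
    linarith

open scoped Classical in
/-- far labels in the parity class of the position of `h`. -/
noncomputable def farCls (T : Fin N → Prop) (h : Fin N) (σ : Equiv.Perm (Fin N)) : Finset (Fin N) :=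
  univ.filter fun q => (q : ℕ) % 2 = (σ.symm h : ℕ) % 2 ∧ T (σ q)

lemma sum_alt_abs (N : ℕ) : |∑ k ∈ Finset.range N, (-1 : ℝ) ^ k| ≤ 1 := by
  rcases Nat.even_or_odd' N with ⟨q, hq | hq⟩
  · rw [hq, sum_alt_even]; simp
  · rw [hq, Finset.sum_range_succ, sum_alt_even, pow_mul]; simp

open scoped Classical in
lemma claim2 (hN : 18 ≤ N) (T : Fin N → Prop) (h : Fin N) (hT : N ≤ 2 * (univ.filter T).card) :
    (N : ℝ) * ((univ.filter fun σ : Equiv.Perm (Fin N) => 8 * (farCls T h σ).card < N).card : ℝ) ≤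
      64 * (Fintype.card (Equiv.Perm (Fin N)) : ℝ) := by
  have h18 : (18 : ℝ) ≤ N := by exact_mod_cast hN
  set b : Fin N → ℝ := fun r => if T r then 1 else 0 with hb
  set Y := linStat (sW N (-1)) b with hY
  set M := linStat (clAvg (wUni N) (sW N (-1))) b with hM
  have hM1 : ∀ σ, |M σ| ≤ 1 := by
    intro σ
    have e : ∀ i, clAvg (wUni N) (sW N (-1)) i = (∑ k ∈ Finset.range N, (-1 : ℝ) ^ k) / N := by
      intro i; unfold clAvg wUni sW
      rw [← Finset.mul_sum, Finset.sum_range]; ring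
    simp only [hM, linStat, e]
    rw [← Finset.mul_sum, abs_mul, abs_div, Nat.abs_cast]
    have h1 := sum_alt_abs N
    have h2 : |∑ i, b (σ i)| ≤ N := by
      refine (Finset.abs_sum_le_sum_abs _ _).trans ?_
      have : ∀ i ∈ (univ : Finset (Fin N)), |b (σ i)| ≤ 1 := by
        intro i _; simp only [hb]; split_ifs <;> simp
      refine (Finset.sum_le_card_nsmul _ _ _ this).trans ?_
      simp
    calc _ ≤ 1 / (N : ℝ) * N := by gcongr
      _ = 1 := by field_simp
  have hvar := stein_var (wUni_cls (by omega : 0 < N)) (sW N (-1)) b (fun _ => 1) (fun _ _ _ _ => rfl)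
  rw [← hY, ← hM] at hvar
  have hw : ∀ σ : Equiv.Perm (Fin N), wEnergy (wUni N) (sW N (-1)) (fun k => b (σ k)) ≤ 4 * N := by
    intro σ
    unfold wEnergy wUni
    have : ∀ i j : Fin N, 1 / (N : ℝ) * ((sW N (-1) i - sW N (-1) j) * (b (σ i) - b (σ j))) ^ 2 ≤ 4 / N := by
      intro i j
      have h1 : |sW N (-1) i - sW N (-1) j| ≤ 2 := by
        have := abs_sub (sW N (-1) i) (sW N (-1) j)
        unfold sW at *
        rw [eta_abs (Or.inr rfl), eta_abs (Or.inr rfl)] at this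
        linarith
      have h2 : |b (σ i) - b (σ j)| ≤ 1 := by
        simp only [hb]; split_ifs <;> simp
      have h3 : |(sW N (-1) i - sW N (-1) j) * (b (σ i) - b (σ j))| ≤ 2 := by
        rw [abs_mul]
        calc _ ≤ (2:ℝ) * 1 := by gcongr
          _ = 2 := by norm_num
      have h4 : ((sW N (-1) i - sW N (-1) j) * (b (σ i) - b (σ j))) ^ 2 ≤ 4 := by
        rw [← sq_abs]; nlinarith [abs_nonneg ((sW N (-1) i - sW N (-1) j) * (b (σ i) - b (σ j)))]
      calc _ ≤ 1 / (N : ℝ) * 4 := by gcongr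
        _ = 4 / N := by ring
    calc _ ≤ ∑ i : Fin N, ∑ j : Fin N, 4 / (N : ℝ) :=
          Finset.sum_le_sum fun i _ => Finset.sum_le_sum fun j _ => this i j
      _ = 4 * N := by simp; field_simp
  have hv2 : ∑ σ, (Y σ - M σ) ^ 2 ≤ N * (Fintype.card (Equiv.Perm (Fin N)) : ℝ) := by
    have h1 : ∑ σ : Equiv.Perm (Fin N), 1 * wEnergy (wUni N) (sW N (-1)) (fun k => b (σ k)) ≤
        ∑ σ : Equiv.Perm (Fin N), 4 * (N : ℝ) := Finset.sum_le_sum fun σ _ => by rw [one_mul]; exact hw σ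
    rw [Finset.sum_const, nsmul_eq_mul, Finset.card_univ] at h1
    have h2 : ∑ σ, 2 * (Y σ - M σ) ^ 2 * 1 = 2 * ∑ σ, (Y σ - M σ) ^ 2 := by
      rw [Finset.mul_sum]; exact Finset.sum_congr rfl fun σ _ => by ring
    rw [h2] at hvar
    linarith
  -- event
  have hev : ∀ σ : Equiv.Perm (Fin N), 8 * (farCls T h σ).card < N → (N : ℝ) / 4 ≤ |Y σ| := by
    intro σ hσ
    set G := univ.filter fun q => T (σ q) with hG
    have hGc : G.card = (univ.filter T).card := by
      refine Finset.card_bij (fun q _ => σ q) ?_ ?_ ?_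
      · intro q hq; simpa [hG] using hq
      · intro q _ r _ hqr; exact σ.injective hqr
      · intro r hr; exact ⟨σ.symm r, by simpa [hG] using hr, by simp⟩
    set y := σ.symm h with hy
    have hYe : (-1 : ℝ) ^ (y : ℕ) * Y σ = 2 * ((farCls T h σ).card : ℝ) - G.card := by
      have e1 : (-1 : ℝ) ^ (y : ℕ) * Y σ = ∑ q ∈ G, (-1 : ℝ) ^ (y : ℕ) * (-1) ^ (q : ℕ) := by
        simp only [hY, linStat, hb, sW, hG]
        rw [Finset.mul_sum, Finset.sum_filter]
        refine Finset.sum_congr rfl fun q _ => ?_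
        split_ifs <;> ring
      have e2 : ∀ q : Fin N, (-1 : ℝ) ^ (y : ℕ) * (-1) ^ (q : ℕ) =
          2 * (if (q : ℕ) % 2 = (y : ℕ) % 2 then 1 else 0) - 1 := by
        intro q
        split_ifs with h1
        · rw [eta_par (Or.inr rfl) h1, eta_mul_self (Or.inr rfl)]; ring
        · rw [← eta_par (η := (-1:ℝ)) (Or.inr rfl) (show ((q : ℕ) + 1) % 2 = (y : ℕ) % 2 by omega), pow_succ]
          have := eta_mul_self (η := (-1:ℝ)) (Or.inr rfl) (q : ℕ)
          linarith
      rw [e1]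
      simp_rw [e2]
      rw [Finset.sum_sub_distrib, ← Finset.mul_sum, Finset.sum_boole, Finset.sum_const, nsmul_eq_mul, mul_one]
      have : G.filter (fun q : Fin N => (q : ℕ) % 2 = (y : ℕ) % 2) = farCls T h σ := by
        ext q; simp [hG, farCls, hy, and_comm]
      rw [this]
    have h1 : |Y σ| = |2 * ((farCls T h σ).card : ℝ) - G.card| := by
      rw [← hYe, abs_mul, eta_abs (Or.inr rfl), one_mul]
    rw [h1, abs_sub_comm]
    refine le_trans ?_ (le_abs_self _)
    rw [hGc]
    have h2 : (N : ℝ) ≤ 2 * ((univ.filter T).card : ℝ) := by exact_mod_cast hT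
    have h3 : 8 * ((farCls T h σ).card : ℝ) < N := by exact_mod_cast hσ
    linarith
  set E := univ.filter fun σ : Equiv.Perm (Fin N) => 8 * (farCls T h σ).card < N with hE
  have h3 : (E.card : ℝ) * ((N : ℝ) / 8) ^ 2 ≤ ∑ σ, (Y σ - M σ) ^ 2 := by
    rw [← nsmul_eq_mul, ← Finset.sum_const]
    refine (Finset.sum_le_sum ?_).trans (Finset.sum_le_sum_of_subset_of_nonneg (Finset.subset_univ E)
      fun _ _ _ => sq_nonneg _)
    intro σ hσ
    have h1 := hev σ (by simpa [hE] using hσ)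
    have h2 := hM1 σ
    have h4 := abs_sub_abs_le_abs_sub (Y σ) (M σ)
    rw [← sq_abs (Y σ - M σ)]
    apply pow_le_pow_left₀ (by positivity)
    linarith
  have h4 := h3.trans hv2
  have hNp : (0:ℝ) < N := by linarith
  have h5 : (N:ℝ) * ((N : ℝ) * E.card) ≤ N * (64 * (Fintype.card (Equiv.Perm (Fin N)) : ℝ)) := by
    nlinarith
  exact le_of_mul_le_mul_left h5 hNp

end Claims

section Fixed
variable {N : ℕ}

open scoped Classical in
lemma fixed_core (hN : 18 ≤ N) (η : ℝ) (hη : η = 1 ∨ η = -1) (a : Fin N → ℝ) (D : ℝ) (hD : 0 < D)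
    (hDa : ∀ i j, |a i - a j| ≤ D) (h : Fin N)
    (hT : N ≤ 2 * (univ.filter fun r => D / 2 ≤ a h - a r).card) :
    (N : ℝ) * ((univ.filter fun σ : Equiv.Perm (Fin N) =>
        |linStat (uW N η) a σ| ≤ |linStat (sW N η) a σ|).card : ℝ) ≤
      700000000 * (Fintype.card (Equiv.Perm (Fin N)) : ℝ) := by
  set T : Fin N → Prop := fun r => D / 2 ≤ a h - a r with hTdef
  set Mc := (N + 15) / 16 with hMc
  have c2 := claim2 hN T h hT
  have c1 := claim1 hN η hη a D hD hDa
  have cu := chainCount η hη a (fun i => ((i : ℕ) : ℤ)) 1 (Or.inl rfl) (fun i j => by ring)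
    (fun i => by positivity) (fun i => by have := i.2; omega) h D hD
    (fun r => (le_abs_self _).trans (hDa h r)) T (fun r hr => hr) Mc (by omega)
  have cd := chainCount η hη a (fun i => (N : ℤ) - ((i : ℕ) : ℤ)) (-1) (Or.inr rfl) (fun i j => by ring)
    (fun i => by have := i.2; omega) (fun i => by have := i.2; omega) h D hD
    (fun r => (le_abs_self _).trans (hDa h r)) T (fun r hr => hr) Mc (by omega)
  set E := univ.filter fun σ : Equiv.Perm (Fin N) =>
        |linStat (uW N η) a σ| ≤ |linStat (sW N η) a σ| with hE
  set E0 := univ.filter fun σ : Equiv.Perm (Fin N) => 8 * (farCls T h σ).card < N with hE0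
  set E1 := univ.filter fun σ : Equiv.Perm (Fin N) =>
    Mc ≤ (beyond (fun i => ((i : ℕ) : ℤ)) T h σ).card ∧
        |linStat (uW N η) a σ| ≤ |linStat (sW N η) a σ| with hE1
  set E2 := univ.filter fun σ : Equiv.Perm (Fin N) =>
    Mc ≤ (beyond (fun i => (N : ℤ) - ((i : ℕ) : ℤ)) T h σ).card ∧
        |linStat (uW N η) a σ| ≤ |linStat (sW N η) a σ| with hE2
  have hsub : E ⊆ E0 ∪ (E1 ∪ E2) := by
    intro σ hσ
    have hσ' : |linStat (uW N η) a σ| ≤ |linStat (sW N η) a σ| := by simpa [hE] using hσ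
    simp only [mem_union, hE0, hE1, hE2, mem_filter, mem_univ, true_and, hσ', and_true]
    by_contra hcon
    push Not at hcon
    obtain ⟨h0, h1, h2⟩ := hcon
    have hsub2 : farCls T h σ ⊆ beyond (fun i => ((i : ℕ) : ℤ)) T h σ ∪
        beyond (fun i => (N : ℤ) - ((i : ℕ) : ℤ)) T h σ := by
      intro q hq
      simp only [farCls, mem_filter, mem_univ, true_and] at hq
      rw [mem_union, mem_beyond, mem_beyond]
      have hne : q ≠ σ.symm h := by
        rintro rfl
        have h5 := hq.2
        simp only [hTdef, Equiv.apply_symm_apply] at h5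
        linarith
      have hne' : (q : ℕ) ≠ (σ.symm h : ℕ) := fun h => hne (Fin.ext h)
      rcases Nat.lt_or_gt_of_ne hne' with h6 | h6
      · right; exact ⟨by omega, hq⟩
      · left; exact ⟨by omega, hq⟩
    have h3 := (Finset.card_le_card hsub2).trans (Finset.card_union_le _ _)
    omega
  have hcard := (Finset.card_le_card hsub).trans ((Finset.card_union_le _ _).trans
    (Nat.add_le_add_left (Finset.card_union_le _ _) _))
  have hcard' : (E.card : ℝ) ≤ E0.card + (E1.card + E2.card) := by exact_mod_cast hcard
  have hMN : (N : ℝ) ≤ 16 * Mc := by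
    have : N ≤ 16 * Mc := by omega
    exact_mod_cast this
  have h1 := cu.trans c1
  have h2 := cd.trans c1
  have h3 := mul_le_mul_of_nonneg_right hMN (Nat.cast_nonneg (α := ℝ) E1.card)
  have h4 := mul_le_mul_of_nonneg_right hMN (Nat.cast_nonneg (α := ℝ) E2.card)
  have h5 := mul_le_mul_of_nonneg_left hcard' (Nat.cast_nonneg (α := ℝ) N)
  have hc0 : (0:ℝ) ≤ (Fintype.card (Equiv.Perm (Fin N)) : ℝ) := by positivity
  linarith

lemma linStat_neg_right (u a : Fin N → ℝ) (σ) : linStat u (fun i => - a i) σ = - linStat u a σ := by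
  simp [linStat]

open scoped Classical in
lemma fixed_bound (hN : 18 ≤ N) (η : ℝ) (hη : η = 1 ∨ η = -1) (a : Fin N → ℝ) :
    (N : ℝ) * ((univ.filter fun σ : Equiv.Perm (Fin N) =>
        |linStat (uW N η) a σ| ≤ |linStat (sW N η) a σ| ∧ linStat (sW N η) a σ ≠ 0).card : ℝ) ≤
      700000000 * (Fintype.card (Equiv.Perm (Fin N)) : ℝ) := by
  have h18 : (18 : ℝ) ≤ N := by exact_mod_cast hN
  have hne : (univ : Finset (Fin N)).Nonempty := ⟨⟨0, by omega⟩, mem_univ _⟩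
  obtain ⟨h, -, hh⟩ := Finset.exists_max_image univ a hne
  obtain ⟨l, -, hl⟩ := Finset.exists_min_image univ a hne
  have hh' : ∀ r, a r ≤ a h := fun r => hh r (mem_univ r)
  have hl' : ∀ r, a l ≤ a r := fun r => hl r (mem_univ r)
  set D := a h - a l with hDdef
  have hDa : ∀ i j, |a i - a j| ≤ D := by
    intro i j; rw [abs_le]
    constructor <;> linarith [hh' i, hh' j, hl' i, hl' j]
  have hsubE : (univ.filter fun σ : Equiv.Perm (Fin N) =>
        |linStat (uW N η) a σ| ≤ |linStat (sW N η) a σ| ∧ linStat (sW N η) a σ ≠ 0) ⊆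
        univ.filter fun σ : Equiv.Perm (Fin N) =>
        |linStat (uW N η) a σ| ≤ |linStat (sW N η) a σ| := by
    intro σ hσ; simp only [mem_filter, mem_univ, true_and] at hσ ⊢; exact hσ.1
  have hcE : (N : ℝ) * ((univ.filter fun σ : Equiv.Perm (Fin N) =>
        |linStat (uW N η) a σ| ≤ |linStat (sW N η) a σ| ∧ linStat (sW N η) a σ ≠ 0).card : ℝ) ≤
        (N : ℝ) * ((univ.filter fun σ : Equiv.Perm (Fin N) =>
        |linStat (uW N η) a σ| ≤ |linStat (sW N η) a σ|).card : ℝ) := by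
    gcongr
  rcases (show 0 ≤ D by linarith [hh' l]).eq_or_lt with hD0 | hDp
  · -- constant labels
    have : (univ.filter fun σ : Equiv.Perm (Fin N) =>
        |linStat (uW N η) a σ| ≤ |linStat (sW N η) a σ| ∧ linStat (sW N η) a σ ≠ 0) = ∅ := by
      rw [Finset.filter_eq_empty_iff]
      rintro σ - ⟨h1, h2⟩
      have hconst : ∀ i j, a i = a j := by
        intro i j
        have := hDa i j
        rw [← hD0] at this
        have := abs_nonpos_iff.1 this
        linarith
      have hen : energy (wPar N) (fun k => a (σ k)) = 0 := by
        unfold energy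
        refine Finset.sum_eq_zero fun i _ => Finset.sum_eq_zero fun j _ => ?_
        simp only [hconst (σ i) (σ j)]; simp
      have hXM := stein_energy_zero (wPar_cls N) (uW N η) a σ hen
      rw [hXM] at h1
      have hSp : 0 < |linStat (sW N η) a σ| := abs_pos.2 h2
      rcases Nat.even_or_odd' N with ⟨q, hq | hq⟩
      · have hqp : 0 < q := by omega
        have halt := alt_bd q hqp hq a D hDa σ
        rw [← hD0, zero_mul] at halt
        have halt := abs_nonpos_iff.1 halt
        rcases hη with h | h
        · rw [M_even q hqp hq η (Or.inl h), h, halt, sub_zero, abs_div, abs_mul,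
            abs_of_pos (by linarith : (0:ℝ) < N - 1), abs_of_pos (by norm_num : (0:ℝ) < 2)] at h1
          rw [h] at hSp
          nlinarith
        · rw [h] at h2; exact h2 halt
      · rw [M_odd q hq η hη, abs_mul, Nat.abs_cast] at h1
        have : (9:ℝ) ≤ q + 1/2 := by
          have : (N : ℝ) = 2 * q + 1 := by exact_mod_cast hq
          linarith
        nlinarith
    rw [this]; simp
  refine hcE.trans ?_
  have hcover : N ≤ (univ.filter fun r => D / 2 ≤ a h - a r).card +
      (univ.filter fun r => D / 2 ≤ (-a l) - (-a r)).card := by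
    have h1 : (univ : Finset (Fin N)) ⊆ (univ.filter fun r => D / 2 ≤ a h - a r) ∪
      (univ.filter fun r => D / 2 ≤ (-a l) - (-a r)) := by
      intro r _
      simp only [mem_union, mem_filter, mem_univ, true_and]
      by_contra hcon
      push Not at hcon
      linarith [hcon.1, hcon.2]
    have := (Finset.card_le_card h1).trans (Finset.card_union_le _ _)
    rwa [Finset.card_univ, Fintype.card_fin] at this
  by_cases hc : N ≤ 2 * (univ.filter fun r => D / 2 ≤ a h - a r).card
  · exact fixed_core hN η hη a D hDp hDa h hc
  · have := fixed_core hN η hη (fun i => - a i) D hDp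
      (fun i j => by have := hDa j i; rwa [show - a i - - a j = a j - a i by ring]) l (by omega)
    simp only [linStat_neg_right, abs_neg] at this
    exact this

open scoped Classical in
lemma fixed_bound_all (hN : 0 < N) (η : ℝ) (hη : η = 1 ∨ η = -1) (a : Fin N → ℝ) :
    (N : ℝ) * ((univ.filter fun σ : Equiv.Perm (Fin N) =>
        |linStat (uW N η) a σ| ≤ |linStat (sW N η) a σ| ∧ linStat (sW N η) a σ ≠ 0).card : ℝ) ≤
      700000000 * (Fintype.card (Equiv.Perm (Fin N)) : ℝ) := by
  by_cases h : 18 ≤ N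
  · exact fixed_bound h η hη a
  · have h1 : (N : ℝ) ≤ 700000000 := by
      have : N ≤ 700000000 := by omega
      exact_mod_cast this
    have h2 : ((univ.filter fun σ : Equiv.Perm (Fin N) =>
        |linStat (uW N η) a σ| ≤ |linStat (sW N η) a σ| ∧ linStat (sW N η) a σ ≠ 0).card : ℝ) ≤
        (Fintype.card (Equiv.Perm (Fin N)) : ℝ) := by
      exact_mod_cast Finset.card_le_univ _
    exact mul_le_mul h1 h2 (by positivity) (by norm_num)

end Fixed

section Descartes

/-- Coefficients of `R / (1-x)^2`. -/
noncomputable def cSeq (R : ℝ[X]) (m : ℕ) : ℝ :=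
  ∑ j ∈ Finset.range (m + 1), ((m : ℝ) + 1 - j) * R.coeff j

lemma cSeq_zero (R : ℝ[X]) : cSeq R 0 = R.coeff 0 := by simp [cSeq]

lemma cSeq_succ (R : ℝ[X]) (m : ℕ) :
    cSeq R (m + 1) = cSeq R m + ∑ j ∈ Finset.range (m + 2), R.coeff j := by
  unfold cSeq
  rw [Finset.sum_range_succ, Finset.sum_range_succ _ (m + 1), ← add_assoc,
    ← Finset.sum_add_distrib]
  congr 1
  · refine Finset.sum_congr rfl fun j _ => ?_
    push_cast; ring
  · push_cast; ring

lemma cSeq_second (R : ℝ[X]) (m : ℕ) :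
    cSeq R (m + 2) - 2 * cSeq R (m + 1) + cSeq R m = R.coeff (m + 2) := by
  have h1 := cSeq_succ R m
  have h2 := cSeq_succ R (m + 1)
  rw [Finset.sum_range_succ] at h2
  rw [show m + 1 + 1 = m + 2 by ring] at *
  linarith

lemma cSeq_mul_zero (R : ℝ[X]) (ξ : ℝ) : cSeq ((X - C ξ) * R) 0 = - ξ * cSeq R 0 := by
  simp [cSeq_zero, sub_mul]

lemma cSeq_mul_succ (R : ℝ[X]) (ξ : ℝ) (m : ℕ) :
    cSeq ((X - C ξ) * R) (m + 1) = cSeq R m - ξ * cSeq R (m + 1) := by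
  have h : ∀ j, ((X - C ξ) * R).coeff j = (X * R).coeff j - ξ * R.coeff j := by
    intro j; rw [sub_mul, coeff_sub, coeff_C_mul]
  unfold cSeq
  simp_rw [h, mul_sub]
  rw [Finset.sum_sub_distrib]
  congr 1
  · rw [Finset.sum_range_succ']
    simp only [coeff_X_mul, coeff_X_mul_zero, mul_zero, add_zero]
    refine Finset.sum_congr rfl fun j _ => ?_
    push_cast; ring
  · rw [Finset.mul_sum]
    exact Finset.sum_congr rfl fun j _ => by ring

lemma cSeq_sq (W : ℝ[X]) (m : ℕ) : cSeq ((X - C 1) * ((X - C 1) * W)) (m + 2) = W.coeff (m + 2) := by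
  rw [cSeq_mul_succ, cSeq_mul_succ, cSeq_mul_succ, ← cSeq_second]; ring

lemma cSeq_lin (R : ℝ[X]) (n m : ℕ) (hR : R.natDegree ≤ n) (hm : n ≤ m + 1) :
    cSeq R (m + 1) = cSeq R m + R.eval 1 := by
  rw [cSeq_succ, eval_eq_sum_range' (n := m + 2) (by omega)]
  simp

lemma cSeq_lin' (R : ℝ[X]) (n m t : ℕ) (hR : R.natDegree ≤ n) (hm : n ≤ m + 1) :
    cSeq R (m + t) = cSeq R m + t * R.eval 1 := by
  induction t with
  | zero => simp
  | succ t ih =>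
    rw [← add_assoc, cSeq_lin R n (m + t) hR (by omega), ih]; push_cast; ring

lemma cSeq_ne (R : ℝ[X]) (hR : R ≠ 0) : ∃ m, cSeq R m ≠ 0 := by
  by_contra h
  push Not at h
  apply hR
  ext m
  rw [coeff_zero]
  match m with
  | 0 => rw [← cSeq_zero, h]
  | 1 =>
    have := cSeq_succ R 0
    rw [h, h] at this
    simp [Finset.sum_range_succ] at this
    have h0 : R.coeff 0 = 0 := by rw [← cSeq_zero, h]
    linarith
  | m + 2 => rw [← cSeq_second, h, h, h]; ring

lemma cSeq_tendsto (R : ℝ[X]) (ξ : ℝ) (h0 : 0 < ξ) (h1 : ξ < 1) :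
    Filter.Tendsto (fun m => cSeq R m * ξ ^ m) Filter.atTop (nhds 0) := by
  set n := R.natDegree with hn
  have hlim1 : Filter.Tendsto (fun t : ℕ => ξ ^ n * (cSeq R n * ξ ^ t + R.eval 1 * (t * ξ ^ t)))
      Filter.atTop (nhds (ξ ^ n * (cSeq R n * 0 + R.eval 1 * 0))) := by
    have e1 := tendsto_pow_atTop_nhds_zero_of_lt_one h0.le h1
    have e2 := tendsto_self_mul_const_pow_of_lt_one h0.le h1
    exact ((e1.const_mul _).add (e2.const_mul _)).const_mul _
  rw [← Filter.tendsto_add_atTop_iff_nat n]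
  simp only [mul_zero, add_zero] at hlim1
  refine hlim1.congr fun t => ?_
  rw [add_comm t n, cSeq_lin' R n n t hn.ge (by omega), pow_add]; ring

/-- at least `v` sign alternations -/
def AltSeq (c : ℕ → ℝ) (v : ℕ) : Prop :=
  ∃ (m : ℕ → ℕ) (ε : ℝ), (∀ k < v, m k < m (k + 1)) ∧ ∀ k ≤ v, 0 < ε * (-1) ^ k * c (m k)

lemma exists_incr (g : ℕ → ℝ) (p q : ℕ) (hpq : p ≤ q) (h : g p < g q) :
    ∃ i, p ≤ i ∧ i < q ∧ g i < g (i + 1) := by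
  by_contra hcon
  push Not at hcon
  have : ∀ t, p + t ≤ q → g (p + t) ≤ g p := by
    intro t
    induction t with
    | zero => intro _; exact le_rfl
    | succ t ih =>
      intro ht
      exact (hcon (p + t) (by omega) (by omega)).trans (ih (by omega))
  have := this (q - p) (by omega)
  rw [show p + (q - p) = q by omega] at this
  linarith

lemma AltSeq.step (d δ : ℕ → ℝ) (v : ℕ) (h : AltSeq d v) (hlim : Filter.Tendsto d Filter.atTop (nhds 0))
    (hδ0 : δ 0 = - d 0) (hδ : ∀ m, δ (m + 1) = d m - d (m + 1)) : AltSeq δ (v + 1) := by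
  obtain ⟨m, ε, hm, hs⟩ := h
  set g : ℕ → ℝ := fun k => Nat.casesOn k 0 d with hg
  have hg0 : g 0 = 0 := rfl
  have hgs : ∀ k, g (k + 1) = d k := fun k => rfl
  have hδg : ∀ k, δ k = g k - g (k + 1) := by
    intro k; cases k with
    | zero => rw [hg0, hgs, hδ0]; ring
    | succ k => rw [hgs, hgs, hδ]
  have key : ∀ k, k ≤ v + 1 → ∃ i, (∀ j, k = j + 1 → m j < i) ∧ (k ≤ v → i ≤ m k) ∧
      0 < (-ε) * (-1) ^ k * δ i := by
    intro k hk
    rcases Nat.eq_zero_or_pos k with rfl | hkp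
    · obtain ⟨i, -, h2, h3⟩ := exists_incr (fun k => ε * g k) 0 (m 0 + 1) (by omega) (by
        have := hs 0 (by omega)
        simp only [hg0, hgs]; simpa using this)
      refine ⟨i, by intro j hj; omega, fun _ => by omega, ?_⟩
      rw [hδg]; simp only [pow_zero]; linarith
    · obtain ⟨j, rfl⟩ : ∃ j, k = j + 1 := ⟨k - 1, by omega⟩
      have hj := hs j (by omega)
      by_cases hv : j + 1 ≤ v
      · have hj1 := hs (j + 1) hv
        have hmm := hm j (by omega)
        obtain ⟨i, h1, h2, h3⟩ := exists_incr (fun k => ε * (-1) ^ (j + 1) * g k) (m j + 1) (m (j + 1) + 1)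
          (by omega) (by
            simp only [hgs]
            rw [pow_succ] at *
            linarith)
        refine ⟨i, by intro j' hj'; have : j = j' := by omega
                      subst this; omega, fun _ => by omega, ?_⟩
        rw [hδg]; linarith
      · have hlim' : Filter.Tendsto (fun k => ε * (-1) ^ j * d k) Filter.atTop (nhds 0) := by
          have := hlim.const_mul (ε * (-1) ^ j)
          simpa using this
        obtain ⟨q, hq1, hq2⟩ := ((hlim'.eventually (gt_mem_nhds hj)).and
          (Filter.eventually_ge_atTop (m j))).exists
        obtain ⟨i, h1, h2, h3⟩ := exists_incr (fun k => ε * (-1) ^ (j + 1) * g k) (m j + 1) (q + 1)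
          (by omega) (by
            simp only [hgs]
            rw [pow_succ] at *
            linarith)
        refine ⟨i, by intro j' hj'; have : j = j' := by omega
                      subst this; omega, fun h => absurd h hv, ?_⟩
        rw [hδg]; linarith
  choose! i hi using key
  refine ⟨i, -ε, ?_, ?_⟩
  · intro k hk
    have h1 := (hi k (by omega)).2.1 (by omega)
    have h2 := (hi (k + 1) (by omega)).1 k rfl
    omega
  · intro k hk
    exact (hi k hk).2.2

lemma AltSeq.scale (c d : ℕ → ℝ) (r : ℕ → ℝ) (hr : ∀ m, 0 < r m) (hcd : ∀ m, c m = r m * d m) (v : ℕ)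
    (h : AltSeq d v) : AltSeq c v := by
  obtain ⟨m, ε, hm, hs⟩ := h
  refine ⟨m, ε, hm, fun k hk => ?_⟩
  rw [hcd, show ε * (-1) ^ k * (r (m k) * d (m k)) = r (m k) * (ε * (-1) ^ k * d (m k)) by ring]
  exact mul_pos (hr _) (hs k hk)

lemma AltSeq.root (R : ℝ[X]) (ξ : ℝ) (hξ : 0 < ξ) (v : ℕ)
    (hlim : Filter.Tendsto (fun m => cSeq R m * ξ ^ m) Filter.atTop (nhds 0))
    (h : AltSeq (cSeq R) v) : AltSeq (cSeq ((X - C ξ) * R)) (v + 1) := by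
  set d : ℕ → ℝ := fun m => cSeq R m * ξ ^ m with hd
  have hd1 : AltSeq d v := AltSeq.scale d (cSeq R) (fun m => ξ ^ m) (fun m => by positivity)
    (fun m => by simp only [hd]; ring) v h
  set δ : ℕ → ℝ := fun m => Nat.casesOn m (- d 0) (fun k => d k - d (k + 1)) with hδ
  have hd2 : AltSeq δ (v + 1) := AltSeq.step d δ v hd1 hlim rfl (fun m => rfl)
  refine AltSeq.scale _ δ (fun m => ξ * (ξ ^ m)⁻¹) (fun m => by positivity) (fun m => ?_) _ hd2
  cases m with
  | zero => rw [cSeq_mul_zero]; simp [hδ, hd]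
  | succ m =>
    rw [cSeq_mul_succ]
    simp only [hδ, hd]
    rw [pow_succ]
    field_simp

lemma AltSeq.base (R : ℝ[X]) (hR : R ≠ 0) : AltSeq (cSeq R) 0 := by
  obtain ⟨m, hm⟩ := cSeq_ne R hR
  refine ⟨fun _ => m, cSeq R m, by omega, fun k hk => ?_⟩
  have : k = 0 := by omega
  subst this
  simpa using mul_self_pos.2 hm

lemma AltSeq.prod (s : Multiset ℝ) (hs : ∀ ξ ∈ s, 0 < ξ ∧ ξ < 1) (R : ℝ[X]) (hR : R ≠ 0) :
    AltSeq (cSeq ((s.map fun ξ => X - C ξ).prod * R)) s.card := by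
  induction s using Multiset.induction_on with
  | empty => simpa using AltSeq.base R hR
  | cons ξ s ih =>
    rw [Multiset.map_cons, Multiset.prod_cons, Multiset.card_cons, mul_assoc]
    have h := hs ξ (Multiset.mem_cons_self _ _)
    exact AltSeq.root _ ξ h.1 _ (cSeq_tendsto _ ξ h.1 h.2)
      (ih fun x hx => hs x (Multiset.mem_cons_of_mem hx))

lemma AltSeq.ones (k : ℕ) (W : ℝ[X]) (hW : W ≠ 0) :
    AltSeq (cSeq ((X - C 1) ^ k * ((X - C 1) * ((X - C 1) * W)))) k := by
  induction k with
  | zero =>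
    rw [pow_zero, one_mul]
    exact AltSeq.base _ (mul_ne_zero (X_sub_C_ne_zero 1) (mul_ne_zero (X_sub_C_ne_zero 1) hW))
  | succ k ih =>
    rw [pow_succ', mul_assoc]
    refine AltSeq.root _ 1 one_pos _ ?_ ih
    have e : (X - C (1:ℝ)) ^ k * ((X - C 1) * ((X - C 1) * W)) =
      (X - C 1) * ((X - C 1) * ((X - C 1) ^ k * W)) := by ring
    rw [e]
    set V := (X - C (1:ℝ)) ^ k * W
    refine tendsto_const_nhds.congr' ?_
    filter_upwards [Filter.eventually_ge_atTop (V.natDegree + 3)] with m hm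
    obtain ⟨j, rfl⟩ : ∃ j, m = j + 2 := ⟨m - 2, by omega⟩
    rw [cSeq_sq, coeff_eq_zero_of_natDegree_lt (by omega)]; simp

open scoped Classical in
/-- number of events -/
noncomputable def evCount (n : ℕ) (c : ℕ → ℝ) : ℕ :=
  ((Finset.Icc 1 n).filter fun m => c (m - 1) * c m ≤ 0 ∧ c m ≠ 0).card

lemma exists_change (g : ℕ → ℝ) (p q : ℕ) (hpq : p ≤ q) (hp : 0 < g p) (hq : g q < 0) :
    ∃ i, p < i ∧ i ≤ q ∧ 0 ≤ g (i - 1) ∧ g i < 0 := by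
  by_contra hcon
  push Not at hcon
  have : ∀ t, p + t ≤ q → 0 ≤ g (p + t) := by
    intro t
    induction t with
    | zero => intro _; exact hp.le
    | succ t ih =>
      intro ht
      exact hcon (p + t + 1) (by omega) (by omega) (ih (by omega))
  have := this (q - p) (by omega)
  rw [show p + (q - p) = q by omega] at this
  linarith

lemma AltSeq.le_evCount (R : ℝ[X]) (n v : ℕ) (hR : R.natDegree ≤ n) (h : AltSeq (cSeq R) v) :
    v ≤ evCount n (cSeq R) + 1 := by
  obtain ⟨m, ε, hm, hs⟩ := h
  have key : ∀ k, k < v → ∃ i, m k < i ∧ i ≤ m (k + 1) ∧ 0 ≤ ε * (-1) ^ k * cSeq R (i - 1) ∧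
      ε * (-1) ^ k * cSeq R i < 0 := by
    intro k hk
    refine exists_change (fun j => ε * (-1) ^ k * cSeq R j) _ _ (hm k hk).le (hs k hk.le) ?_
    have := hs (k + 1) hk
    rw [pow_succ] at this
    linarith
  choose! i hi using key
  have hmono : ∀ k, k + 1 < v → i k < i (k + 1) := by
    intro k hk
    have h1 := hi k (by omega)
    have h2 := hi (k + 1) (by omega)
    omega
  have hmono2 : ∀ k l, k < l → l < v → i k < i l := by
    intro k l hkl
    induction l, hkl using Nat.le_induction with
    | base => exact hmono k
    | succ l _ ih => intro hl; exact (ih (by omega)).trans (hmono l hl)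
  have hcard : (Finset.range (v - 1)).card ≤ evCount n (cSeq R) := by
    unfold evCount
    refine Finset.card_le_card_of_injOn i ?_ ?_
    · intro k hk
      have hk' : k < v - 1 := by simpa using hk
      obtain ⟨h1, h2, h3, h4⟩ := hi k (by omega)
      simp only [Finset.coe_filter, Finset.mem_Icc, Set.mem_ofPred_eq]
      refine ⟨⟨by omega, ?_⟩, ?_, ?_⟩
      · by_contra hn
        push Not at hn
        have h5 := hs (k + 2) (by omega)
        have h6 := hm (k + 1) (by omega)
        have e1 := cSeq_lin' R n (i k - 1) 1 hR (by omega)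
        have e2 := cSeq_lin' R n (i k - 1) (m (k + 2) - (i k - 1)) hR (by omega)
        rw [show i k - 1 + 1 = i k by omega] at e1
        rw [show k + 1 + 1 = k + 2 by ring] at h6
        rw [show i k - 1 + (m (k + 2) - (i k - 1)) = m (k + 2) by omega] at e2
        have hT : (1 : ℝ) ≤ ((m (k + 2) - (i k - 1) : ℕ) : ℝ) := by
          have : 1 ≤ m (k + 2) - (i k - 1) := by omega
          exact_mod_cast this
        set t : ℝ := ((m (k + 2) - (i k - 1) : ℕ) : ℝ)
        rw [e2, pow_add] at h5
        rw [e1] at h4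
        push_cast at h4
        set z := ε * (-1) ^ k * R.eval 1 with hz
        set y := ε * (-1) ^ k * cSeq R (i k - 1) with hy
        have h7 : y + z < 0 := by rw [hz, hy]; linarith
        have h8 : 0 < y + t * z := by rw [hz, hy]; linarith
        nlinarith
      · have h9 : 0 ≤ (ε * (-1) ^ k) ^ 2 := sq_nonneg _
        have h10 : (ε * (-1) ^ k) ≠ 0 := by intro h0; rw [h0] at h4; simp at h4
        have h11 : 0 < (ε * (-1) ^ k) ^ 2 := by positivity
        by_contra h12
        push Not at h12
        have := mul_pos h11 h12
        nlinarith [mul_nonneg h3 (neg_nonneg.2 h4.le)]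
      · intro h0; rw [h0] at h4; simp at h4
    · intro k hk l hl hkl
      have hk' : k < v - 1 := by simpa using hk
      have hl' : l < v - 1 := by simpa using hl
      rcases Nat.lt_trichotomy k l with h | h | h
      · have := hmono2 k l h (by omega); omega
      · exact h
      · have := hmono2 l k h (by omega); omega
  rw [Finset.card_range] at hcard
  omega

end Descartes

section Roots

lemma countBound (P : ℝ[X]) (n : ℕ) (hP : P ≠ 0) (hn : P.natDegree ≤ n) (s : Multiset ℝ)
    (hs : ∀ ξ ∈ s, 0 < ξ ∧ ξ < 1) (hd : (s.map fun ξ => X - C ξ).prod ∣ P) :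
    s.card ≤ evCount n (cSeq P) + 1 := by
  obtain ⟨R, rfl⟩ := hd
  exact AltSeq.le_evCount _ n _ hn (AltSeq.prod s hs R (right_ne_zero_of_mul hP))

lemma oneBound (P : ℝ[X]) (n k : ℕ) (hP : P ≠ 0) (hn : P.natDegree ≤ n)
    (hd : (X - C 1) ^ k ∣ P) : k ≤ evCount n (cSeq P) + 3 := by
  by_cases hk : k ≤ 2
  · omega
  obtain ⟨W, rfl⟩ := hd
  obtain ⟨j, rfl⟩ : ∃ j, k = j + 2 := ⟨k - 2, by omega⟩
  have hW := right_ne_zero_of_mul hP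
  have e : (X - C (1:ℝ)) ^ (j + 2) * W = (X - C 1) ^ j * ((X - C 1) * ((X - C 1) * W)) := by ring
  rw [e] at hn ⊢
  have := AltSeq.le_evCount _ n _ hn (AltSeq.ones j W hW)
  omega

noncomputable def pol (n : ℕ) (η : ℝ) (lam : Fin (n + 1) → ℝ) : ℝ[X] :=
  ∑ k : Fin (n + 1), C (η ^ (k : ℕ) * lam k) * X ^ (k : ℕ)

lemma pol_coeff (n : ℕ) (η : ℝ) (lam : Fin (n + 1) → ℝ) (j : ℕ) :
    (pol n η lam).coeff j = if h : j < n + 1 then η ^ j * lam ⟨j, h⟩ else 0 := by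
  unfold pol
  rw [finset_sum_coeff]
  simp only [coeff_C_mul, coeff_X_pow]
  split_ifs with h
  · rw [Finset.sum_eq_single ⟨j, h⟩]
    · simp
    · intro k _ hk
      rw [if_neg, mul_zero]
      intro h2; apply hk; ext; exact h2.symm
    · simp
  · refine Finset.sum_eq_zero fun k _ => ?_
    rw [if_neg, mul_zero]
    have := k.2; omega

lemma pol_natDegree (n : ℕ) (η : ℝ) (lam : Fin (n + 1) → ℝ) : (pol n η lam).natDegree ≤ n := by
  rw [natDegree_le_iff_coeff_eq_zero]
  intro j hj
  rw [pol_coeff, dif_neg (by omega)]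

lemma pol_ne (n : ℕ) (η : ℝ) (hη : η = 1 ∨ η = -1) (lam : Fin (n + 1) → ℝ) (h : lam ≠ 0) :
    pol n η lam ≠ 0 := by
  intro h0
  apply h
  funext k
  have := pol_coeff n η lam k
  rw [h0, dif_pos k.2, coeff_zero] at this
  have h1 : η ^ (k : ℕ) ≠ 0 := by rcases hη with h | h <;> rw [h] <;> simp
  rcases mul_eq_zero.1 this.symm with h2 | h2
  · exact absurd h2 h1
  · simpa using h2

lemma pol_neg (n : ℕ) (lam : Fin (n + 1) → ℝ) : pol n (-1) lam = (pol n 1 lam).comp (-X) := by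
  unfold pol
  rw [Polynomial.sum_comp]
  refine Finset.sum_congr rfl fun k _ => ?_
  simp only [mul_comp, C_comp, pow_comp, X_comp, one_pow, one_mul]
  rw [neg_pow (X : ℝ[X]), C_mul, C_pow, C_neg, C_1]; ring

lemma pol_rev (n : ℕ) (lam : Fin (n + 1) → ℝ) :
    pol n 1 (fun i => lam (Fin.rev i)) = reflect n (pol n 1 lam) := by
  ext j
  rw [coeff_reflect, pol_coeff, pol_coeff]
  by_cases h : j < n + 1
  · have hr : revAt n j = n - j := revAt_le (by omega)
    rw [hr, dif_pos h, dif_pos (by omega)]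
    simp only [one_pow, one_mul]
    congr 1
    ext; simp [Fin.rev]
  · have hr : revAt n j = j := by rw [revAt_eq_self_of_lt]; omega
    rw [hr, dif_neg h, dif_neg h]

lemma reverse_dvd_reflect (n : ℕ) (P : ℝ[X]) (h : P.natDegree ≤ n) : P.reverse ∣ reflect n P := by
  have := reflect_mul P 1 le_rfl (show (1 : ℝ[X]).natDegree ≤ n - P.natDegree by simp)
  rw [mul_one, show P.natDegree + (n - P.natDegree) = n by omega] at this
  rw [this]
  exact Dvd.intro _ rfl

lemma negProd_dvd (s : Multiset ℝ) (P : ℝ[X]) (hd : (s.map fun ξ => X - C ξ).prod ∣ P) :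
    ((s.map fun ξ => -ξ).map fun ξ => X - C ξ).prod ∣ P.comp (-X) := by
  obtain ⟨R, rfl⟩ := hd
  rw [mul_comp]
  refine Dvd.dvd.mul_right ?_ _
  rw [multiset_prod_comp, Multiset.map_map, Multiset.map_map]
  refine Multiset.prod_dvd_prod_of_dvd _ _ fun ξ _ => ?_
  simp only [Function.comp, sub_comp, X_comp, C_comp, C_neg]
  exact ⟨-1, by ring⟩

lemma inv_dvd (s : Multiset ℝ) (hs : ∀ ξ ∈ s, ξ ≠ 0) (P : ℝ[X]) (hd : (s.map fun ξ => X - C ξ).prod ∣ P) :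
    ((s.map fun ξ => ξ⁻¹).map fun ξ => X - C ξ).prod ∣ P.reverse := by
  obtain ⟨R, rfl⟩ := hd
  rw [reverse_mul_of_domain]
  refine Dvd.dvd.mul_right ?_ _
  induction s using Multiset.induction_on with
  | empty => simp
  | cons ξ s ih =>
    simp only [Multiset.map_cons, Multiset.prod_cons]
    rw [reverse_mul_of_domain]
    refine mul_dvd_mul ?_ (ih fun x hx => hs x (Multiset.mem_cons_of_mem hx))
    rw [dvd_iff_isRoot, IsRoot.def]
    have h0 := hs ξ (Multiset.mem_cons_self _ _)
    letI : Invertible ξ := invertibleOfNonzero h0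
    have := (eval₂_reverse_eq_zero_iff (RingHom.id ℝ) ξ (X - C ξ)).2 (by simp)
    rwa [invOf_eq_inv] at this

lemma region_split (s : Multiset ℝ) : s.card ≤ (s.filter fun x => 0 < x ∧ x < 1).card + s.count 1 +
    (s.filter fun x => 1 < x).card + s.count 0 + (s.filter fun x => -1 < x ∧ x < 0).card +
    s.count (-1) + (s.filter fun x => x < -1).card := by
  simp only [← Multiset.countP_eq_card_filter, Multiset.count]
  induction s using Multiset.induction_on with
  | empty => simp
  | cons x s ih =>
    simp only [Multiset.countP_cons, Multiset.card_cons]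
    have : 1 ≤ (if 0 < x ∧ x < 1 then 1 else 0) + (if 1 = x then 1 else 0) + (if 1 < x then 1 else 0)
      + (if 0 = x then 1 else 0) + (if -1 < x ∧ x < 0 then 1 else 0) + (if -1 = x then 1 else 0) +
      (if x < -1 then 1 else 0) := by
      rcases lt_trichotomy x 0 with h | h | h
      · rcases lt_trichotomy x (-1) with h' | h' | h'
        · rw [if_pos h']; omega
        · rw [if_pos h'.symm]; omega
        · rw [if_pos (show -1 < x ∧ x < 0 from ⟨h', h⟩)]; omega
      · rw [if_pos h.symm]; omega
      · rcases lt_trichotomy x 1 with h' | h' | h'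
        · rw [if_pos (show 0 < x ∧ x < 1 from ⟨h, h'⟩)]; omega
        · rw [if_pos h'.symm]; omega
        · rw [if_pos h']; omega
    omega

lemma roots_card_le (n : ℕ) (lam : Fin (n + 1) → ℝ) (hlam : lam ≠ 0) :
    (pol n 1 lam).roots.card ≤ (pol n 1 lam).rootMultiplicity 0 +
      2 * evCount n (cSeq (pol n 1 lam)) + 2 * evCount n (cSeq (pol n (-1) lam)) +
      evCount n (cSeq (pol n 1 fun i => lam (Fin.rev i))) +
      evCount n (cSeq (pol n (-1) fun i => lam (Fin.rev i))) + 10 := by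
  set P := pol n 1 lam with hP
  have hrev : (fun i => lam (Fin.rev i)) ≠ 0 := by
    intro h; apply hlam; funext i
    have := congrFun h (Fin.rev i)
    simpa using this
  have hP0 : P ≠ 0 := pol_ne n 1 (Or.inl rfl) lam hlam
  have hdv : ∀ (q : ℝ → Prop) [DecidablePred q],
      ((P.roots.filter q).map fun ξ => X - C ξ).prod ∣ P := fun q _ =>
    (Multiset.prod_X_sub_C_dvd_iff_le_roots hP0 _).2 (Multiset.filter_le _ _)
  have hrefl : ∀ s : Multiset ℝ, (∀ ξ ∈ s, ξ ≠ 0) → (s.map fun ξ => X - C ξ).prod ∣ P →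
      ((s.map fun ξ => ξ⁻¹).map fun ξ => X - C ξ).prod ∣ pol n 1 fun i => lam (Fin.rev i) := by
    intro s hs hd
    rw [pol_rev]
    exact (inv_dvd s hs P hd).trans (reverse_dvd_reflect n P (pol_natDegree n 1 lam))
  have h1 := countBound P n hP0 (pol_natDegree n 1 lam) (P.roots.filter fun x => 0 < x ∧ x < 1)
    (fun ξ h => (Multiset.mem_filter.1 h).2) (hdv _)
  have h2 : P.roots.count 1 ≤ evCount n (cSeq P) + 3 := by
    rw [count_roots]
    exact oneBound P n _ hP0 (pol_natDegree n 1 lam) (pow_rootMultiplicity_dvd P 1)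
  have h3 := countBound _ n (pol_ne n 1 (Or.inl rfl) _ hrev) (pol_natDegree n 1 _)
    ((P.roots.filter fun x => 1 < x).map fun ξ => ξ⁻¹) (by
      intro ξ hξ
      obtain ⟨x, hx, rfl⟩ := Multiset.mem_map.1 hξ
      have := (Multiset.mem_filter.1 hx).2
      exact ⟨by positivity, inv_lt_one_of_one_lt₀ this⟩)
    (hrefl _ (by
      intro x hx
      have := (Multiset.mem_filter.1 hx).2
      positivity) (hdv _))
  have h4 := countBound _ n (pol_ne n (-1) (Or.inr rfl) _ hlam) (pol_natDegree n (-1) _)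
    ((P.roots.filter fun x => -1 < x ∧ x < 0).map fun ξ => -ξ) (by
      intro ξ hξ
      obtain ⟨x, hx, rfl⟩ := Multiset.mem_map.1 hξ
      have := (Multiset.mem_filter.1 hx).2
      constructor <;> linarith)
    (by rw [pol_neg]; exact negProd_dvd _ _ (hdv _))
  have h5 : P.roots.count (-1) ≤ evCount n (cSeq (pol n (-1) lam)) + 3 := by
    rw [count_roots]
    refine oneBound _ n _ (pol_ne n (-1) (Or.inr rfl) _ hlam) (pol_natDegree n (-1) _) ?_
    rw [pol_neg]
    obtain ⟨R, hR⟩ := pow_rootMultiplicity_dvd P (-1)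
    have : P.comp (-X) = ((X - C (-1)) ^ (P.rootMultiplicity (-1)) * R).comp (-X) := by rw [← hR]
    rw [this, mul_comp, pow_comp]
    refine Dvd.dvd.mul_right (pow_dvd_pow_of_dvd ?_ _) _
    refine ⟨-1, ?_⟩
    simp only [sub_comp, X_comp, C_comp]
    rw [C_neg]; ring
  have h6 := countBound _ n (pol_ne n (-1) (Or.inr rfl) _ hrev) (pol_natDegree n (-1) _)
    (((P.roots.filter fun x => x < -1).map fun ξ => ξ⁻¹).map fun ξ => -ξ) (by
      intro ξ hξ
      obtain ⟨y, hy, rfl⟩ := Multiset.mem_map.1 hξ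
      obtain ⟨x, hx, rfl⟩ := Multiset.mem_map.1 hy
      have := (Multiset.mem_filter.1 hx).2
      rw [← inv_neg]
      have h1 : 1 < -x := by linarith
      exact ⟨by positivity, inv_lt_one_of_one_lt₀ h1⟩)
    (by
      rw [pol_neg]
      refine negProd_dvd _ _ (hrefl _ (by
        intro x hx
        have := (Multiset.mem_filter.1 hx).2
        intro h0; rw [h0] at this; norm_num at this) (hdv _)))
  simp only [Multiset.card_map] at h3 h4 h6
  have h7 := region_split P.roots
  rw [count_roots P (a := 0)] at h7
  omega

open scoped Classical in
lemma mult_zero_le (n : ℕ) (lam : Fin (n + 1) → ℝ) (hlam : lam ≠ 0) :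
    (pol n 1 lam).rootMultiplicity 0 ≤
      ((Finset.Icc 1 n).filter fun k => ∀ j : Fin (n + 1), (j : ℕ) < k → lam j = 0).card := by
  set P := pol n 1 lam with hP
  have hP0 : P ≠ 0 := pol_ne n 1 (Or.inl rfl) lam hlam
  set r := P.rootMultiplicity 0 with hr
  have hd : X ^ r ∣ P := by
    have := pow_rootMultiplicity_dvd P 0
    simpa using this
  have hz : ∀ j : Fin (n + 1), (j : ℕ) < r → lam j = 0 := by
    intro j hj
    have := X_pow_dvd_iff.1 hd j hj
    rw [hP, pol_coeff, dif_pos j.2] at this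
    simpa using this
  have hrn : r ≤ n := by
    have := natDegree_le_of_dvd hd hP0
    rw [natDegree_X_pow] at this
    exact this.trans (pol_natDegree n 1 lam)
  have : Finset.Icc 1 r ⊆ (Finset.Icc 1 n).filter fun k => ∀ j : Fin (n + 1), (j : ℕ) < k → lam j = 0 := by
    intro k hk
    rw [Finset.mem_Icc] at hk
    rw [mem_filter, Finset.mem_Icc]
    exact ⟨⟨hk.1, by omega⟩, fun j hj => hz j (by omega)⟩
  have := Finset.card_le_card this
  simpa using this

/-- reversed initial segment -/
def seg (n m : ℕ) (hm : m ≤ n) (i : Fin (m + 1)) : Fin (n + 1) := ⟨m - i, by omega⟩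

def BadSet (N : ℕ) (η : ℝ) : Set (Fin N → ℝ) :=
  {a | |linStat (uW N η) a 1| ≤ |linStat (sW N η) a 1| ∧ linStat (sW N η) a 1 ≠ 0}

lemma cSeq_event (n : ℕ) (η : ℝ) (hη : η = 1 ∨ η = -1) (lam : Fin (n + 1) → ℝ) (m : ℕ) (hm1 : 1 ≤ m)
    (hm : m ≤ n) (h : cSeq (pol n η lam) (m - 1) * cSeq (pol n η lam) m ≤ 0)
    (h0 : cSeq (pol n η lam) m ≠ 0) : (fun i => lam (seg n m hm i)) ∈ BadSet (m + 1) η := by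
  set a : Fin (m + 1) → ℝ := fun i => lam (seg n m hm i) with ha
  have hη2 : ∀ i : Fin (m + 1), η ^ (m - (i : ℕ)) = η ^ m * η ^ (i : ℕ) := by
    intro i
    have e : η ^ m = η ^ (m - (i : ℕ)) * η ^ (i : ℕ) := by rw [← pow_add]; congr 1; omega
    rw [e, mul_assoc, eta_mul_self hη, mul_one]
  have hcoef : ∀ i : Fin (m + 1), (pol n η lam).coeff (m - (i : ℕ)) = η ^ m * (η ^ (i : ℕ) * a i) := by
    intro i
    rw [pol_coeff, dif_pos (by omega), hη2 i]; simp only [ha, seg]; ring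
  have hcm : cSeq (pol n η lam) m = η ^ m * (linStat (uW (m + 1) η) a 1 + linStat (sW (m + 1) η) a 1) := by
    unfold cSeq
    rw [← Finset.sum_range_reflect, Finset.sum_range, linStat, linStat, ← Finset.sum_add_distrib, Finset.mul_sum]
    refine Finset.sum_congr rfl fun i _ => ?_
    rw [show m + 1 - 1 - (i : ℕ) = m - i by omega, hcoef, Nat.cast_sub (by omega)]
    simp only [uW, sW, Equiv.Perm.one_apply]; ring
  have hcm1 : cSeq (pol n η lam) (m - 1) = η ^ m * linStat (uW (m + 1) η) a 1 := by
    obtain ⟨k, rfl⟩ : ∃ k, m = k + 1 := ⟨m - 1, by omega⟩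
    have e : cSeq (pol n η lam) (k + 1 - 1) = ∑ j ∈ Finset.range (k + 1 + 1),
        (((k + 1 : ℕ) : ℝ) - j) * (pol n η lam).coeff j := by
      rw [Finset.sum_range_succ, sub_self, zero_mul, add_zero]
      simp [cSeq]
    rw [e, ← Finset.sum_range_reflect, Finset.sum_range, linStat, Finset.mul_sum]
    refine Finset.sum_congr rfl fun i _ => ?_
    rw [show k + 1 + 1 - 1 - (i : ℕ) = k + 1 - i by omega, hcoef, Nat.cast_sub (by omega)]
    simp only [uW, Equiv.Perm.one_apply]; ring
  set x := linStat (uW (m + 1) η) a 1 with hx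
  set s := linStat (sW (m + 1) η) a 1 with hs
  have e2 := eta_mul_self hη m
  rw [hcm, hcm1] at h
  have h1 : x * (x + s) ≤ 0 := by
    have : η ^ m * x * (η ^ m * (x + s)) = (η ^ m * η ^ m) * (x * (x + s)) := by ring
    rw [this, e2, one_mul] at h
    exact h
  have h2 : x + s ≠ 0 := by intro h3; rw [hcm, h3, mul_zero] at h0; exact h0 rfl
  have h3 : s ≠ 0 := by
    intro h4
    rw [h4, add_zero] at h1 h2
    nlinarith [mul_self_pos.2 h2]
  refine ⟨?_, h3⟩
  change |x| ≤ |s|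
  apply abs_le_of_sq_le_sq' _ (abs_nonneg s) |> abs_le.2
  rw [sq_abs]
  nlinarith [sq_nonneg (x + s)]

end Roots

section MeasureStep

lemma perm_mp (k : ℕ) (ν : Measure ℝ) [IsProbabilityMeasure ν] (τ : Equiv.Perm (Fin k)) :
    MeasurePreserving (fun (lam : Fin k → ℝ) i => lam (τ i)) (Measure.pi fun _ => ν)
      (Measure.pi fun _ => ν) := by
  have hm : Measurable (fun (lam : Fin k → ℝ) i => lam (τ i)) := by fun_prop
  refine ⟨hm, ?_⟩
  symm
  apply Measure.pi_eq
  intro s hs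
  rw [Measure.map_apply hm (MeasurableSet.univ_pi hs)]
  have : (fun (lam : Fin k → ℝ) i => lam (τ i)) ⁻¹' (Set.univ.pi s) =
      Set.univ.pi fun i => s (τ.symm i) := by
    ext lam
    simp only [Set.mem_preimage, Set.mem_univ_pi]
    constructor
    · intro h i
      have := h (τ.symm i)
      simpa using this
    · intro h i
      have := h (τ i)
      rwa [Equiv.symm_apply_apply] at this
  rw [this, Measure.pi_pi]
  exact Equiv.prod_comp τ.symm fun i => ν (s i)

lemma linStat_meas {N : ℕ} (w : Fin N → ℝ) : Measurable fun a : Fin N → ℝ => linStat w a 1 := by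
  unfold linStat
  fun_prop

lemma badSet_meas (N : ℕ) (η : ℝ) : MeasurableSet (BadSet N η) := by
  unfold BadSet
  have h1 := linStat_meas (uW N η)
  have h2 := linStat_meas (sW N η)
  have h3 := measurableSet_le (_root_.measurable_abs.comp h1) (_root_.measurable_abs.comp h2)
  exact h3.inter (measurableSet_eq_fun h2 measurable_const).compl

lemma linStat_perm {N : ℕ} (w a : Fin N → ℝ) (σ : Equiv.Perm (Fin N)) :
    linStat w (fun i => a (σ i)) 1 = linStat w a σ := by
  simp [linStat]

open scoped Classical in
lemma bad_prob (n N : ℕ) (hN : 0 < N) (η : ℝ) (hη : η = 1 ∨ η = -1) (ν : Measure ℝ)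
    [IsProbabilityMeasure ν] (e : Fin N ↪ Fin (n + 1)) :
    (Measure.pi fun _ : Fin (n + 1) => ν) {lam | (fun i => lam (e i)) ∈ BadSet N η} ≤
      ENNReal.ofReal (700000000 / N) := by
  set μ : Measure (Fin (n + 1) → ℝ) := Measure.pi fun _ => ν with hμ
  set E : Equiv.Perm (Fin N) → Set (Fin (n + 1) → ℝ) :=
    fun σ => {lam | (fun i => lam (e (σ i))) ∈ BadSet N η} with hE
  have hEm : ∀ σ, MeasurableSet (E σ) := fun σ =>
    (show Measurable (fun (lam : Fin (n + 1) → ℝ) i => lam (e (σ i))) by fun_prop) (badSet_meas N η)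
  have hEμ : ∀ σ, μ (E σ) = μ (E 1) := by
    intro σ
    have h := (perm_mp (n + 1) ν (σ.viaFintypeEmbedding e)).measure_preimage (hEm 1).nullMeasurableSet
    rw [← hμ] at h
    rw [← h]
    congr 1
    ext lam
    simp [hE, Equiv.Perm.viaFintypeEmbedding_apply_image]
  set K : ℝ := (Fintype.card (Equiv.Perm (Fin N)) : ℝ) with hK
  have hKpos : 0 < K := by rw [hK]; exact_mod_cast Fintype.card_pos
  have hNpos : (0 : ℝ) < N := by exact_mod_cast hN
  have hsum : ∑ σ, μ (E σ) ≤ ENNReal.ofReal (700000000 / N * K) := by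
    have h1 : ∑ σ, μ (E σ) = ∫⁻ lam, ∑ σ, (E σ).indicator 1 lam ∂μ := by
      rw [lintegral_finsetSum _ fun σ _ => measurable_one.indicator (hEm σ)]
      refine Finset.sum_congr rfl fun σ _ => ?_
      rw [lintegral_indicator_one (hEm σ)]
    rw [h1]
    calc _ ≤ ∫⁻ _lam, ENNReal.ofReal (700000000 / N * K) ∂μ := by
          refine lintegral_mono fun lam => ?_
          have h2 := fixed_bound_all hN η hη fun i => lam (e i)
          set c := (univ.filter fun σ : Equiv.Perm (Fin N) =>
            |linStat (uW N η) (fun i => lam (e i)) σ| ≤ |linStat (sW N η) (fun i => lam (e i)) σ| ∧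
              linStat (sW N η) (fun i => lam (e i)) σ ≠ 0) with hc
          have h3 : ∑ σ, (E σ).indicator (1 : (Fin (n + 1) → ℝ) → ℝ≥0∞) lam = (c.card : ℝ≥0∞) := by
            rw [hc, Finset.card_filter, Nat.cast_sum]
            refine Finset.sum_congr rfl fun σ _ => ?_
            have h4 : lam ∈ E σ ↔ (|linStat (uW N η) (fun i => lam (e i)) σ| ≤
                |linStat (sW N η) (fun i => lam (e i)) σ| ∧
                linStat (sW N η) (fun i => lam (e i)) σ ≠ 0) := by
              rw [← linStat_perm (uW N η), ← linStat_perm (sW N η)]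
              rfl
            rw [Set.indicator_apply]
            by_cases h5 : lam ∈ E σ
            · rw [if_pos h5, if_pos (h4.1 h5)]; simp
            · rw [if_neg h5, if_neg (fun h => h5 (h4.2 h))]; simp
          rw [h3, ← ENNReal.ofReal_natCast]
          apply ENNReal.ofReal_le_ofReal
          rw [div_mul_eq_mul_div, le_div_iff₀ hNpos, mul_comm]
          exact h2
      _ = _ := by simp
  simp only [hEμ, Finset.sum_const, nsmul_eq_mul, Finset.card_univ] at hsum
  change μ (E 1) ≤ _
  have hK2 : (Fintype.card (Equiv.Perm (Fin N)) : ℝ≥0∞) = ENNReal.ofReal K := by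
    rw [hK, ENNReal.ofReal_natCast]
  rw [hK2, mul_comm, ENNReal.ofReal_mul (by positivity)] at hsum
  refine (ENNReal.mul_le_mul_iff_left ?_ ENNReal.ofReal_ne_top).1 hsum
  simpa using hKpos

lemma seg_inj (n m : ℕ) (hm : m ≤ n) : Function.Injective (seg n m hm) := by
  intro i j h
  simp only [seg, Fin.mk.injEq] at h
  ext; omega

/-- number of bad events -/
noncomputable def bad (n : ℕ) (η : ℝ) (f : Fin (n + 1) → Fin (n + 1)) (m : ℕ) :
    Set (Fin (n + 1) → ℝ) :=
  {lam | ∃ hm : m ≤ n, (fun i => lam (f (seg n m hm i))) ∈ BadSet (m + 1) η}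

lemma bad_eq (n : ℕ) (η : ℝ) (f : Fin (n + 1) → Fin (n + 1)) (m : ℕ) (hm : m ≤ n) :
    bad n η f m = {lam | (fun i => lam (f (seg n m hm i))) ∈ BadSet (m + 1) η} := by
  ext lam
  exact ⟨fun ⟨_, h⟩ => h, fun h => ⟨hm, h⟩⟩

open scoped Classical in
lemma evCount_lint (n : ℕ) (η : ℝ) (hη : η = 1 ∨ η = -1) (ν : Measure ℝ)
    [IsProbabilityMeasure ν] (f : Fin (n + 1) → Fin (n + 1)) (hf : Function.Injective f) :
    ∃ g : (Fin (n + 1) → ℝ) → ℝ≥0∞, Measurable g ∧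
      (∀ lam, (evCount n (cSeq (pol n η fun i => lam (f i))) : ℝ≥0∞) ≤ g lam) ∧
      ∫⁻ lam, g lam ∂(Measure.pi fun _ : Fin (n + 1) => ν) ≤
        ENNReal.ofReal (700000000 * ∑ m ∈ Finset.Icc 1 n, 1 / ((m : ℝ) + 1)) := by
  have hmeas : ∀ m ∈ Finset.Icc 1 n, MeasurableSet (bad n η f m) := by
    intro m hm
    rw [Finset.mem_Icc] at hm
    rw [bad_eq n η f m hm.2]
    exact (show Measurable (fun (lam : Fin (n + 1) → ℝ) i => lam (f (seg n m hm.2 i))) by fun_prop)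
      (badSet_meas (m + 1) η)
  refine ⟨fun lam => ∑ m ∈ Finset.Icc 1 n, (bad n η f m).indicator 1 lam, ?_, ?_, ?_⟩
  · exact Finset.measurable_sum _ fun m hm => measurable_one.indicator (hmeas m hm)
  · intro lam
    rw [evCount, Finset.card_filter, Nat.cast_sum]
    refine Finset.sum_le_sum fun m hm => ?_
    rw [Finset.mem_Icc] at hm
    split_ifs with h
    · have := cSeq_event n η hη (fun i => lam (f i)) m hm.1 hm.2 h.1 h.2
      rw [Set.indicator_of_mem (show lam ∈ bad n η f m from ⟨hm.2, this⟩)]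
      simp
    · simp
  · rw [lintegral_finsetSum' _ fun m hm => (measurable_one.indicator (hmeas m hm)).aemeasurable,
      Finset.mul_sum, ENNReal.ofReal_sum_of_nonneg (fun m _ => by positivity)]
    refine Finset.sum_le_sum fun m hm => ?_
    rw [lintegral_indicator_one (hmeas m hm)]
    rw [Finset.mem_Icc] at hm
    rw [bad_eq n η f m hm.2]
    have := bad_prob n (m + 1) (by omega) η hη ν
      ⟨fun i => f (seg n m hm.2 i), hf.comp (seg_inj n m hm.2)⟩
    refine this.trans (le_of_eq ?_)
    congr 1
    push_cast; ring

open scoped Classical in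
lemma zero_lint (n : ℕ) (ν : Measure ℝ) [IsProbabilityMeasure ν] (hp : (ν {0}).toReal < 1) :
    ∃ g : (Fin (n + 1) → ℝ) → ℝ≥0∞, Measurable g ∧
      (∀ lam, lam ≠ 0 → ((pol n 1 lam).rootMultiplicity 0 : ℝ≥0∞) ≤ g lam) ∧
      ∫⁻ lam, g lam ∂(Measure.pi fun _ : Fin (n + 1) => ν) ≤
        ENNReal.ofReal ((ν {0}).toReal / (1 - (ν {0}).toReal)) := by
  set p := (ν {0}).toReal with hpdef
  have hp0 : 0 ≤ p := ENNReal.toReal_nonneg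
  set Z : ℕ → Set (Fin (n + 1) → ℝ) := fun k => {lam | ∀ j : Fin (n + 1), (j : ℕ) < k → lam j = 0} with hZ
  have hZpi : ∀ k, Z k = Set.pi ((univ.filter fun j : Fin (n + 1) => (j : ℕ) < k : Finset _) : Set (Fin (n + 1)))
      fun _ => ({0} : Set ℝ) := by
    intro k; ext lam; simp [hZ, Set.mem_pi]
  have hmeas : ∀ k, MeasurableSet (Z k) := by
    intro k
    rw [hZpi]
    exact MeasurableSet.pi (Set.to_countable _) fun _ _ => measurableSet_singleton 0
  have hprob : ∀ k ≤ n, (Measure.pi fun _ : Fin (n + 1) => ν) (Z k) = ENNReal.ofReal (p ^ k) := by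
    intro k hk
    rw [hZpi, Measure.pi_pi_finset, Finset.prod_const]
    have : (univ.filter fun j : Fin (n + 1) => (j : ℕ) < k).card = k := by
      rw [Fin.card_filter_val_lt]; omega
    rw [this, ENNReal.ofReal_pow hp0, hpdef, ENNReal.ofReal_toReal (measure_ne_top _ _)]
  refine ⟨fun lam => ∑ k ∈ Finset.Icc 1 n, (Z k).indicator 1 lam, ?_, ?_, ?_⟩
  · exact Finset.measurable_sum _ fun m hm => measurable_one.indicator (hmeas m)
  · intro lam hlam
    have h := mult_zero_le n lam hlam
    have h' : ((pol n 1 lam).rootMultiplicity 0 : ℝ≥0∞) ≤ (((Finset.Icc 1 n).filter fun k => ∀ j : Fin (n + 1), (j : ℕ) < k → lam j = 0).card : ℝ≥0∞) := by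
      exact_mod_cast h
    refine h'.trans (le_of_eq ?_)
    rw [Finset.card_filter, Nat.cast_sum]
    refine Finset.sum_congr rfl fun k _ => ?_
    rw [Set.indicator_apply]
    by_cases h5 : lam ∈ Z k
    · rw [if_pos h5, if_pos (show ∀ j : Fin (n + 1), (j : ℕ) < k → lam j = 0 from h5)]; simp
    · rw [if_neg h5, if_neg (show ¬ ∀ j : Fin (n + 1), (j : ℕ) < k → lam j = 0 from h5)]; simp
  · rw [lintegral_finsetSum _ fun m _ => measurable_one.indicator (hmeas m)]
    have : ∀ k ∈ Finset.Icc 1 n, ∫⁻ lam, (Z k).indicator 1 lam ∂(Measure.pi fun _ : Fin (n + 1) => ν) =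
        ENNReal.ofReal (p ^ k) := by
      intro k hk
      rw [lintegral_indicator_one (hmeas k), hprob k (Finset.mem_Icc.1 hk).2]
    rw [Finset.sum_congr rfl this, ← ENNReal.ofReal_sum_of_nonneg (fun m _ => by positivity)]
    apply ENNReal.ofReal_le_ofReal
    rw [le_div_iff₀ (by linarith)]
    have hg : ∀ N : ℕ, (∑ k ∈ Finset.Icc 1 N, p ^ k) * (1 - p) = p - p ^ (N + 1) := by
      intro N
      induction N with
      | zero => simp
      | succ N ih =>
        rw [Finset.sum_Icc_succ_top (by omega), add_mul, ih]; ring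
    rw [hg]
    have : 0 ≤ p ^ (n + 1) := by positivity
    linarith

lemma harm_le (n : ℕ) (hn : 1 ≤ n) : ∑ m ∈ Finset.Icc 1 n, 1 / ((m : ℝ) + 1) ≤ Real.log n + 1 := by
  induction n, hn using Nat.le_induction with
  | base => norm_num
  | succ k hk ih =>
    rw [Finset.sum_Icc_succ_top (by omega)]
    have hk0 : (0 : ℝ) < k := by exact_mod_cast hk
    have h1 : 1 / ((k : ℝ) + 1) ≤ Real.log ((k + 1 : ℕ) : ℝ) - Real.log k := by
      have h2 := Real.log_le_sub_one_of_pos (show (0 : ℝ) < k / (k + 1) by positivity)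
      rw [Real.log_div (by positivity) (by positivity)] at h2
      have h3 : (k : ℝ) / (k + 1) - 1 = - (1 / (k + 1)) := by field_simp; ring
      push_cast
      linarith
    have h4 : 1 / (((k + 1 : ℕ) : ℝ) + 1) ≤ 1 / ((k : ℝ) + 1) := by
      apply one_div_le_one_div_of_le (by positivity)
      push_cast; linarith
    linarith

end MeasureStep

-- The coefficients are i.i.d. with common law `ν`, `p₀ = ν {0} < 1`; the expected
-- total number of real roots (with multiplicity), restricted to the event that not
-- all coefficients vanish, is at most `C log n + p₀/(1-p₀)`.
open scoped Classical in
theorem stmt_2 :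
    ∃ C > (0:ℝ), ∀ (n : ℕ), 2 ≤ n →
      ∀ (μ : Measure (Fin (n+1) → ℝ)) (ν : Measure ℝ), IsProbabilityMeasure ν →
      μ = Measure.pi (fun _ => ν) →
      (ν {0}).toReal < 1 →
      (∫⁻ lam, (if lam ≠ 0 then
          (((∑ k : Fin (n+1), Polynomial.C (lam k) * Polynomial.X ^ (k:ℕ)).roots.card : ℝ≥0∞))
          else 0) ∂μ)
        ≤ ENNReal.ofReal (C * Real.log n + (ν {0}).toReal / (1 - (ν {0}).toReal)) := by
  refine ⟨15000000000, by norm_num, ?_⟩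
  intro n hn μ ν hν hμ hp
  obtain ⟨g0, m0, b0, i0⟩ := zero_lint n ν hp
  obtain ⟨g1, m1, b1, i1⟩ := evCount_lint n 1 (Or.inl rfl) ν id Function.injective_id
  obtain ⟨g2, m2, b2, i2⟩ := evCount_lint n (-1) (Or.inr rfl) ν id Function.injective_id
  obtain ⟨g3, m3, b3, i3⟩ := evCount_lint n 1 (Or.inl rfl) ν Fin.rev Fin.rev_injective
  obtain ⟨g4, m4, b4, i4⟩ := evCount_lint n (-1) (Or.inr rfl) ν Fin.rev Fin.rev_injective
  rw [← hμ] at i0 i1 i2 i3 i4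
  have hprob : μ Set.univ = 1 := by rw [hμ]; exact measure_univ
  set S := 700000000 * ∑ m ∈ Finset.Icc 1 n, 1 / ((m : ℝ) + 1) with hS
  have hS0 : 0 ≤ S := by positivity
  have hSle : S ≤ 700000000 * (Real.log n + 1) :=
    mul_le_mul_of_nonneg_left (harm_le n (by omega)) (by norm_num)
  set q := (ν {0}).toReal / (1 - (ν {0}).toReal) with hq
  have hq0 : 0 ≤ q := div_nonneg ENNReal.toReal_nonneg (by linarith)
  calc _ ≤ ∫⁻ lam, (g0 lam + 2 * g1 lam + 2 * g2 lam + g3 lam + g4 lam + 10) ∂μ := by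
        refine lintegral_mono fun lam => ?_
        dsimp only
        split_ifs with h
        · have h1 := roots_card_le n lam h
          have h2 : ((pol n 1 lam).roots.card : ℝ≥0∞) ≤ (pol n 1 lam).rootMultiplicity 0 +
            2 * evCount n (cSeq (pol n 1 lam)) + 2 * evCount n (cSeq (pol n (-1) lam)) +
            evCount n (cSeq (pol n 1 fun i => lam (Fin.rev i))) +
            evCount n (cSeq (pol n (-1) fun i => lam (Fin.rev i))) + 10 := by exact_mod_cast h1
          have e : (∑ k : Fin (n+1), Polynomial.C (lam k) * Polynomial.X ^ (k:ℕ)) = pol n 1 lam := by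
            simp [pol]
          rw [e]
          refine h2.trans ?_
          have c1 := b1 lam
          have c2 := b2 lam
          simp only [id] at c1 c2
          gcongr
          · exact b0 lam h
          · exact b3 lam
          · exact b4 lam
        · exact zero_le
    _ = ∫⁻ lam, g0 lam ∂μ + 2 * ∫⁻ lam, g1 lam ∂μ + 2 * ∫⁻ lam, g2 lam ∂μ + ∫⁻ lam, g3 lam ∂μ +
          ∫⁻ lam, g4 lam ∂μ + 10 := by
        rw [lintegral_add_right _ measurable_const, lintegral_add_right _ m4, lintegral_add_right _ m3,
          lintegral_add_right _ (m2.const_mul 2), lintegral_add_right _ (m1.const_mul 2),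
          lintegral_const_mul _ m1, lintegral_const_mul _ m2, lintegral_const, hprob, mul_one]
    _ ≤ ENNReal.ofReal q + ENNReal.ofReal 2 * ENNReal.ofReal S + ENNReal.ofReal 2 * ENNReal.ofReal S +
          ENNReal.ofReal S + ENNReal.ofReal S + ENNReal.ofReal 10 := by
        rw [show ENNReal.ofReal 2 = 2 by simp, show ENNReal.ofReal 10 = 10 by simp]
        gcongr
    _ = ENNReal.ofReal (q + 2 * S + 2 * S + S + S + 10) := by
        rw [← ENNReal.ofReal_mul (by norm_num)]
        rw [← ENNReal.ofReal_add (by positivity) (by positivity),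
          ← ENNReal.ofReal_add (by positivity) (by positivity),
          ← ENNReal.ofReal_add (by positivity) (by positivity),
          ← ENNReal.ofReal_add (by positivity) (by positivity),
          ← ENNReal.ofReal_add (by positivity) (by positivity)]
    _ ≤ _ := by
        apply ENNReal.ofReal_le_ofReal
        have hl : Real.log 2 ≤ Real.log n := Real.log_le_log (by norm_num) (by exact_mod_cast hn)
        have := Real.log_two_gt_d9
        linarith
end

section
/- Let $(\xi_1,\ldots,\xi_k)$ be a vector of exchangeable random variables whose distribution is absolutely continuous with respect to Lebesgue measure on $\mathbb{R}^k$. Then $\mathbb{P}\{|\sum_{j=1}^k j\xi_j| \le |\sum_{j=1}^k \xi_j|\} \le C/k$ for an absolute constant $C$. -/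
open Finset MeasureTheory

noncomputable def cnt : List ℝ → ℝ → (ℝ → ℝ) → ℝ
  | [], x, F => F x
  | b :: l, x, F => cnt l (x + b) F + cnt l (x - b) F

noncomputable def ind (a b : ℝ) : ℝ → ℝ := fun t => if a ≤ t ∧ t ≤ b then 1 else 0

lemma cnt_mono (l : List ℝ) : ∀ (x : ℝ) (F G : ℝ → ℝ), (∀ t, F t ≤ G t) → cnt l x F ≤ cnt l x G := by
  induction l with
  | nil => intro x F G h; exact h x
  | cons b l ih => intro x F G h; exact add_le_add (ih _ _ _ h) (ih _ _ _ h)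

lemma cnt_one (l : List ℝ) : ∀ (x : ℝ), cnt l x (fun _ => 1) = 2 ^ l.length := by
  induction l with
  | nil => intro x; simp [cnt]
  | cons b l ih => intro x; simp only [cnt, ih, List.length_cons]; ring

lemma cnt_sum (l : List ℝ) (N : ℕ) (F : ℕ → ℝ → ℝ) : ∀ (x : ℝ),
    cnt l x (fun t => ∑ i ∈ range N, F i t) = ∑ i ∈ range N, cnt l x (F i) := by
  induction l with
  | nil => intro x; simp [cnt]
  | cons b l ih => intro x; simp only [cnt, ih, sum_add_distrib]

lemma cnt_symm (l : List ℝ) : ∀ (x y : ℝ) (F : ℝ → ℝ),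
    cnt l x (fun t => F (y - t)) = cnt l (y - x) F := by
  induction l with
  | nil => intro x y F; simp [cnt]
  | cons b l ih =>
    intro x y F
    simp only [cnt, ih]
    rw [add_comm]
    congr 2 <;> ring

lemma cnt_refl (W c H : ℝ) (hH : H ≤ c - W) (l : List ℝ) : (∀ b ∈ l, |b| ≤ W) → ∀ x < H,
    cnt l x (ind (c - W) (c + W)) ≤ cnt l x (ind (2 * H - c - W) (2 * H - c + 3 * W)) := by
  induction l with
  | nil =>
    intro _ x hx
    simp only [cnt, ind]
    rw [if_neg (by intro h; linarith [h.1])]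
    split_ifs <;> norm_num
  | cons b l ih =>
    intro hb x hx
    have hb0 : |b| ≤ W := hb b (by simp)
    have key : ∀ x' < H + W,
        cnt l x' (ind (c - W) (c + W)) ≤ cnt l x' (ind (2 * H - c - W) (2 * H - c + 3 * W)) := by
      intro x' hx'
      rcases lt_or_ge x' H with h | h
      · exact ih (fun b hb' => hb b (by simp [hb'])) x' h
      · have := cnt_symm l x' (2 * x') (ind (c - W) (c + W))
        rw [show 2 * x' - x' = x' by ring] at this
        rw [← this]
        apply cnt_mono
        intro t
        simp only [ind]
        split_ifs with h1 h2
        · exact le_rfl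
        · exact absurd ⟨by linarith [h1.2], by linarith [h1.1]⟩ h2
        · norm_num
        · norm_num
    have := abs_le.1 hb0
    exact add_le_add (key _ (by linarith)) (key _ (by linarith))

/-- concentration away from the mean -/
lemma cnt_bound (l : List ℝ) (W m D : ℝ) (hW : 0 < W) (hD : 0 ≤ D) (hb : ∀ b ∈ l, |b| ≤ W) :
    cnt l m (ind (m - D - W) (m - D + W)) * D ≤ 4 * W * 2 ^ l.length := by
  have h0 : cnt l m (ind (m - D - W) (m - D + W)) = cnt l m (ind (m + D - W) (m + D + W)) := by
    have := cnt_symm l m (2 * m) (ind (m - D - W) (m - D + W))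
    rw [show 2 * m - m = m by ring] at this
    rw [← this]
    congr 1
    funext t
    simp only [ind]
    congr 1
    apply propext
    constructor <;> rintro ⟨h1, h2⟩ <;> constructor <;> linarith
  rw [h0]
  have hnn : 0 ≤ cnt l m (ind (m + D - W) (m + D + W)) := by
    have := cnt_mono l m (fun _ => 0) (ind (m + D - W) (m + D + W))
      (by intro t; simp only [ind]; split_ifs <;> norm_num)
    have h2 : cnt l m (fun _ => 0) = 0 := by
      simpa using cnt_sum l 0 (fun _ _ => 0) m
    linarith
  have htot : cnt l m (ind (m + D - W) (m + D + W)) ≤ 2 ^ l.length := by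
    rw [← cnt_one l m]
    apply cnt_mono
    intro t; simp only [ind]; split_ifs <;> norm_num
  have hp : (0:ℝ) < 2 ^ l.length := by positivity
  rcases le_or_gt D W with hDW | hDW
  · nlinarith
  -- N windows
  set N := ⌈(D - W) / (3 * W)⌉₊ with hN
  have hN1 : (D - W) / (3 * W) ≤ N := Nat.le_ceil _
  have hN1' : D - W ≤ N * (3 * W) := by rwa [div_le_iff₀ (by positivity)] at hN1
  have hmain : (N:ℝ) * cnt l m (ind (m + D - W) (m + D + W)) ≤ 2 ^ l.length := by
    rw [← cnt_one l m]
    have hlow : ∀ i ∈ range N, cnt l m (ind (m + D - W) (m + D + W)) ≤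
        cnt l m (ind (m + D - 3 * W - 6 * W * i) (m + D + W - 6 * W * i)) := by
      intro i hi
      have hi' : (i:ℝ) < (D - W) / (3 * W) := Nat.lt_ceil.1 (mem_range.1 hi)
      rw [lt_div_iff₀ (by positivity)] at hi'
      have h0i : (0:ℝ) ≤ i * (3 * W) := by positivity
      have := cnt_refl W (m + D) (m + D - W - i * (3 * W)) (by linarith) l hb m (by linarith)
      convert this using 3 <;> ring
    calc (N:ℝ) * cnt l m (ind (m + D - W) (m + D + W))
        = ∑ i ∈ range N, cnt l m (ind (m + D - W) (m + D + W)) := by simp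
      _ ≤ ∑ i ∈ range N, cnt l m (ind (m + D - 3 * W - 6 * W * i) (m + D + W - 6 * W * i)) :=
          sum_le_sum hlow
      _ = cnt l m (fun t => ∑ i ∈ range N, ind (m + D - 3 * W - 6 * W * i) (m + D + W - 6 * W * i) t) :=
          (cnt_sum l N (fun i => ind (m + D - 3 * W - 6 * W * i) (m + D + W - 6 * W * i)) m).symm
      _ ≤ _ := by
          apply cnt_mono
          intro t
          simp only [ind, ← Finset.sum_filter]
          simp only [sum_const, nsmul_eq_mul, mul_one]
          have : ((range N).filter (fun i : ℕ => m + D - 3 * W - 6 * W * (i:ℝ) ≤ t ∧ t ≤ m + D + W - 6 * W * (i:ℝ))).card ≤ 1 := by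
            rw [card_le_one]
            intro i hi j hj
            simp only [mem_filter] at hi hj
            by_contra hne
            rcases Nat.lt_or_gt_of_ne hne with h | h
            · have : (i:ℝ) + 1 ≤ j := by exact_mod_cast h
              nlinarith
            · have : (j:ℝ) + 1 ≤ i := by exact_mod_cast h
              nlinarith
          exact_mod_cast this
  nlinarith

noncomputable def tw {k : ℕ} (z : Fin k → ℝ) : ℝ := ∑ j : Fin k, ((j:ℕ) + 1 : ℝ) * z j

noncomputable def bb {k : ℕ} (z : Fin k → ℝ) (i : Fin k) : ℝ :=
  (((i.rev : Fin k) : ℕ) - (i : ℕ) : ℝ) * (z i.rev - z i) / 2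

lemma sum_bb_all {k : ℕ} (z : Fin k → ℝ) : ∑ i, bb z i = 2 * tw z - (k + 1) * ∑ i, z i := by
  have h1 : ∑ i : Fin k, (((i.rev : Fin k) : ℕ) - (i : ℕ) : ℝ) * z i.rev =
      ∑ i : Fin k, ((i : ℕ) - ((i.rev : Fin k) : ℕ) : ℝ) * z i := by
    rw [← Equiv.sum_comp Fin.revPerm]
    simp
  have h2 : ∑ i, bb z i = ∑ i : Fin k, ((i : ℕ) - ((i.rev : Fin k) : ℕ) : ℝ) * z i := by
    have : ∑ i, bb z i = (∑ i : Fin k, (((i.rev : Fin k) : ℕ) - (i : ℕ) : ℝ) * z i.rev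
      + ∑ i : Fin k, ((i : ℕ) - ((i.rev : Fin k) : ℕ) : ℝ) * z i) / 2 := by
      rw [← sum_add_distrib, sum_div]
      refine sum_congr rfl fun i _ => ?_
      simp only [bb]; ring
    rw [this, h1]; ring
  rw [h2, tw, mul_sum, mul_sum, ← sum_sub_distrib]
  refine sum_congr rfl fun i _ => ?_
  rw [Fin.val_rev, Nat.cast_sub (by omega)]
  push_cast; ring

lemma sum_bb_half {k : ℕ} (z : Fin k → ℝ) :
    ∑ i with i < i.rev, bb z i = tw z - (k + 1) / 2 * ∑ i, z i := by
  have h := sum_bb_all z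
  have hs : ∀ i, bb z i.rev = bb z i := by intro i; simp only [bb, Fin.rev_rev]; ring
  have h1 : ∑ i with ¬ i < i.rev, bb z i = ∑ i with i < i.rev, bb z i := by
    have e1 : ∑ i with i < i.rev, bb z i = ∑ i with i.rev < i, bb z i := by
      rw [sum_filter, sum_filter, ← Equiv.sum_comp Fin.revPerm]
      simp [hs]
    rw [e1, sum_filter, sum_filter]
    refine sum_congr rfl fun i _ => ?_
    rcases lt_trichotomy i i.rev with h | h | h
    · rw [if_neg (by simpa using h), if_neg h.asymm]
    · have hz : bb z i = 0 := by simp only [bb]; rw [← h]; simp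
      simp [hz]
    · rw [if_pos h.asymm, if_pos h]
  have h3 := sum_filter_add_sum_filter_not univ (fun i : Fin k => i < i.rev) (bb z)
  rw [h1, h] at h3
  linarith

lemma bb_abs {k : ℕ} (z : Fin k → ℝ) (δ : ℝ) (hδ : ∀ i j, z i - z j ≤ δ) (i : Fin k) :
    |bb z i| ≤ k * δ / 2 := by
  have h0 : 0 ≤ δ := by simpa using hδ i i
  have h1 : |(((i.rev : Fin k) : ℕ) - (i : ℕ) : ℝ)| ≤ k := by
    have a1 : (i.rev.val : ℝ) ≤ k := by exact_mod_cast i.rev.isLt.le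
    have a2 : (i.val : ℝ) ≤ k := by exact_mod_cast i.isLt.le
    have a3 : (0:ℝ) ≤ i.rev.val := by positivity
    have a4 : (0:ℝ) ≤ i.val := by positivity
    rw [abs_le]; constructor <;> linarith
  have h2 : |z i.rev - z i| ≤ δ := by
    rw [abs_le]; constructor <;> linarith [hδ i.rev i, hδ i i.rev]
  rw [bb, abs_div, abs_mul, abs_two]
  gcongr

noncomputable def GG {k : ℕ} : List (Fin k) → (Equiv.Perm (Fin k) → ℝ) → Equiv.Perm (Fin k) → ℝ
  | [], F, σ => F σ
  | i :: l, F, σ => GG l F σ + GG l F (σ * Equiv.swap i i.rev)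

lemma sum_GG {k : ℕ} (l : List (Fin k)) (F : Equiv.Perm (Fin k) → ℝ) :
    ∑ σ, GG l F σ = 2 ^ l.length * ∑ σ, F σ := by
  induction l with
  | nil => simp [GG]
  | cons i l ih =>
    simp only [GG, sum_add_distrib, List.length_cons]
    have := Equiv.sum_comp (Equiv.mulRight (Equiv.swap i i.rev)) (GG l F)
    simp only [Equiv.coe_mulRight] at this
    rw [this, ih]; ring

lemma tw_swap {k : ℕ} (z : Fin k → ℝ) (i : Fin k) (hi : i ≠ i.rev) :
    tw (z ∘ Equiv.swap i i.rev) = tw z - 2 * bb z i := by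
  have : tw (z ∘ Equiv.swap i i.rev) - tw z = - 2 * bb z i := by
    rw [tw, tw, ← sum_sub_distrib]
    rw [← sum_subset (subset_univ {i, i.rev})]
    · rw [sum_pair hi]
      simp [bb]; ring
    · intro j _ hj
      simp only [mem_insert, mem_singleton, not_or] at hj
      simp [Equiv.swap_apply_of_ne_of_ne hj.1 hj.2]
  linarith

lemma bb_swap {k : ℕ} (z : Fin k → ℝ) (i j : Fin k) (h1 : j ≠ i) (h2 : j ≠ i.rev) :
    bb (z ∘ Equiv.swap i i.rev) j = bb z j := by
  have h3 : j.rev ≠ i := by rintro rfl; simp at h2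
  have h4 : j.rev ≠ i.rev := by simpa using h1
  simp [bb, Equiv.swap_apply_of_ne_of_ne h1 h2, Equiv.swap_apply_of_ne_of_ne h3 h4]

lemma GG_cnt {k : ℕ} (y : Fin k → ℝ) (F : ℝ → ℝ) (l : List (Fin k)) : l.Nodup →
    (∀ i ∈ l, i < i.rev) → ∀ σ : Equiv.Perm (Fin k),
    GG l (fun σ => F (tw (y ∘ σ))) σ =
      cnt (l.map (bb (y ∘ σ))) (tw (y ∘ σ) - (l.map (bb (y ∘ σ))).sum) F := by
  induction l with
  | nil => intro _ _ σ; simp [GG, cnt]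
  | cons i l ih =>
    intro hnd hl σ
    have hi : i < i.rev := hl i (by simp)
    have hnd' := List.nodup_cons.1 hnd
    have hl' : ∀ j ∈ l, j < j.rev := fun j hj => hl j (by simp [hj])
    have e : l.map (bb (y ∘ (σ * Equiv.swap i i.rev : Equiv.Perm (Fin k)))) = l.map (bb (y ∘ σ)) := by
      apply List.map_congr_left
      intro j hj
      rw [Equiv.Perm.coe_mul, ← Function.comp_assoc]
      apply bb_swap
      · rintro rfl; exact hnd'.1 hj
      · rintro rfl
        have := hl' _ hj
        simp only [Fin.rev_rev] at this
        exact absurd hi this.asymm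
    have e2 : tw (y ∘ (σ * Equiv.swap i i.rev : Equiv.Perm (Fin k))) =
        tw (y ∘ σ) - 2 * bb (y ∘ σ) i := by
      rw [Equiv.Perm.coe_mul, ← Function.comp_assoc, tw_swap _ _ hi.ne]
    simp only [GG, ih hnd'.2 hl', List.map_cons, cnt, List.sum_cons, e, e2]
    congr 2 <;> ring

/-- Stage 2 -/
lemma stage2 {k : ℕ} (y : Fin k → ℝ) (hy : ∑ i, y i = 1) (δ W : ℝ) (hδ : ∀ i j, y i - y j ≤ δ)
    (hW : 0 < W) (hWδ : k * δ / 2 ≤ W) :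
    (∑ σ : Equiv.Perm (Fin k), ind (-W) W (tw (y ∘ σ))) * k ≤ 8 * W * (k.factorial : ℝ) := by
  set l : List (Fin k) := (univ.filter (fun i : Fin k => i < i.rev)).toList with hl
  have h1 := sum_GG l (fun σ => ind (-W) W (tw (y ∘ σ)))
  have h2 : ∀ σ : Equiv.Perm (Fin k), GG l (fun σ => ind (-W) W (tw (y ∘ σ))) σ * ((k+1)/2) ≤
      4 * W * 2 ^ l.length := by
    intro σ
    rw [GG_cnt y _ l (nodup_toList _) (by intro i hi; simpa [hl] using hi) σ]
    have hs : (l.map (bb (y ∘ σ))).sum = tw (y ∘ σ) - (k+1)/2 := by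
      rw [hl, Finset.sum_map_toList, sum_bb_half]
      have : ∑ i, (y ∘ σ) i = 1 := by rw [← hy]; exact Equiv.sum_comp σ y
      rw [this, mul_one]
    rw [hs]
    have := cnt_bound (l.map (bb (y ∘ σ))) W ((k+1)/2) ((k+1)/2) hW (by positivity) (by
      intro b hb
      obtain ⟨i, _, rfl⟩ := List.mem_map.1 hb
      exact (bb_abs (y ∘ σ) δ (fun i j => hδ _ _) i).trans hWδ)
    rw [List.length_map] at this
    convert this using 3
    · ring
    · congr 1 <;> ring
  have h3 := sum_le_sum (s := univ) (fun σ _ => h2 σ)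
  rw [← sum_mul, h1, sum_const, card_univ, Fintype.card_perm, Fintype.card_fin, nsmul_eq_mul] at h3
  have hp : (0:ℝ) < 2 ^ l.length := by positivity
  set Q := ∑ σ : Equiv.Perm (Fin k), ind (-W) W (tw (y ∘ σ)) with hQ
  have hQ0 : 0 ≤ Q := sum_nonneg (by intro σ _; simp only [ind]; split_ifs <;> norm_num)
  have h4 : Q * ((k+1)/2) ≤ 4 * W * k.factorial := by
    refine le_of_mul_le_mul_left ?_ hp
    linarith
  linarith

lemma ind_nonneg (a b t : ℝ) : 0 ≤ ind a b t := by
  simp only [ind]; split_ifs <;> norm_num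

lemma chain (m : ℕ) (g w : Fin (m+1) → ℝ) (δ K : ℝ) (hδ : 0 < δ)
    (h1 : ∀ i : Fin m, δ / 2 ≤ g i.succ - g i.castSucc)
    (h2 : ∀ i : Fin m, g i.succ - g i.castSucc ≤ δ * (w i.succ - w i.castSucc))
    (hw : ∀ i j, w i - w j ≤ K) :
    ((m:ℝ) + 1) * ∑ r, ind (-1) 1 (g r) ≤
      (4 / δ + 1) * ∑ r, ind (-(1 + K * δ)) (1 + K * δ) (g r) := by
  have m1 : Monotone (fun r : Fin (m+1) => g r - (r:ℕ) * (δ / 2)) := by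
    rw [Fin.monotone_iff_le_succ]
    intro i
    have := h1 i
    simp only [Fin.val_succ, Fin.val_castSucc]
    push_cast
    linarith
  have m2 : Antitone (fun r : Fin (m+1) => g r - δ * w r) := by
    rw [Fin.antitone_iff_succ_le]
    intro i
    have := h2 i
    linarith
  have m3 : ∀ r s : Fin (m+1), r ≤ s → |g s - g r| ≤ K * δ := by
    intro r s hrs
    have a1 : g r - (r:ℕ) * (δ / 2) ≤ g s - (s:ℕ) * (δ / 2) := m1 hrs
    have a2 : g s - δ * w s ≤ g r - δ * w r := m2 hrs
    have a3 : ((r:ℕ):ℝ) ≤ (s:ℕ) := by exact_mod_cast hrs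
    have a4 := hw s r
    have a5 : 0 ≤ g s - g r := by nlinarith
    rw [abs_of_nonneg a5]
    nlinarith
  by_cases hE : ∃ r0, -1 ≤ g r0 ∧ g r0 ≤ 1
  · obtain ⟨r0, hr0⟩ := hE
    have hJ : ∀ r, ind (-(1 + K * δ)) (1 + K * δ) (g r) = 1 := by
      intro r
      have : |g r - g r0| ≤ K * δ := by
        rcases le_total r r0 with h | h
        · rw [abs_sub_comm]; exact m3 _ _ h
        · exact m3 _ _ h
      rw [abs_le] at this
      simp only [ind]
      rw [if_pos]
      constructor <;> linarith
    simp only [hJ, sum_const, card_univ, Fintype.card_fin, nsmul_eq_mul, mul_one]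
    have hb : ∑ r, ind (-1) 1 (g r) ≤ 4 / δ + 1 := by
      simp only [ind, ← Finset.sum_filter]
      simp only [sum_const, nsmul_eq_mul, mul_one]
      set S := univ.filter (fun r : Fin (m+1) => -1 ≤ g r ∧ g r ≤ 1) with hS
      have hne : S.Nonempty := ⟨r0, by simp [hS, hr0]⟩
      have i1 := S.min'_mem hne
      have i2 := S.max'_mem hne
      have hle : S.min' hne ≤ S.max' hne := S.min'_le _ i2
      have hsub : S ⊆ Finset.Icc (S.min' hne) (S.max' hne) := by
        intro r hr
        exact Finset.mem_Icc.2 ⟨S.min'_le _ hr, S.le_max' _ hr⟩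
      have hc := card_le_card hsub
      rw [Fin.card_Icc] at hc
      have a1 := m1 hle
      simp only at a1
      simp only [hS, mem_filter] at i1 i2
      have hc' : (S.card : ℝ) ≤ ((S.max' hne : Fin (m+1)) : ℕ) + 1 - ((S.min' hne : Fin (m+1)) : ℕ) := by
        rw [le_sub_iff_add_le]
        have : S.card + ((S.min' hne : Fin (m+1)) : ℕ) ≤ ((S.max' hne : Fin (m+1)) : ℕ) + 1 := by
          have : ((S.min' hne : Fin (m+1)) : ℕ) ≤ ((S.max' hne : Fin (m+1)) : ℕ) := hle
          omega
        exact_mod_cast this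
      have : ((S.card : ℝ) - 1) ≤ 4 / δ := by
        rw [le_div_iff₀ hδ]
        simp only [hS] at *
        nlinarith
      linarith
    push_cast
    nlinarith [hb, (by positivity : (0:ℝ) < (m:ℝ) + 1)]
  · have : ∀ r, ind (-1) 1 (g r) = 0 := by
      intro r
      simp only [ind]
      rw [if_neg]
      exact fun h => hE ⟨r, h⟩
    simp only [this, sum_const_zero, mul_zero]
    exact mul_nonneg (by positivity) (sum_nonneg fun r _ => ind_nonneg _ _ _)

lemma sum_fiber {m : ℕ} (a : Fin (m+1)) (F : Equiv.Perm (Fin (m+1)) → ℝ) :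
    ∑ π, F π = ∑ τ : Equiv.Perm (Fin (m+1)) with τ 0 = a, ∑ r, F (τ * Fin.cycleRange r) := by
  have h1 : ∀ π : Equiv.Perm (Fin (m+1)), F π = ∑ r, if π r = a then F π else 0 := by
    intro π
    rw [sum_eq_single (π.symm a)]
    · simp
    · intro b _ hb
      rw [if_neg]
      rintro rfl
      simp at hb
    · simp
  rw [sum_congr rfl (fun π _ => h1 π), sum_comm, sum_filter]
  have h2 : ∀ r : Fin (m+1), (∑ π : Equiv.Perm (Fin (m+1)), if π r = a then F π else 0) =
      ∑ τ : Equiv.Perm (Fin (m+1)), if τ 0 = a then F (τ * Fin.cycleRange r) else 0 := by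
    intro r
    rw [← Equiv.sum_comp (Equiv.mulRight (Fin.cycleRange r))]
    simp
  rw [sum_congr rfl (fun r _ => h2 r), sum_comm]
  refine sum_congr rfl fun τ _ => ?_
  split_ifs <;> simp

lemma cycleRange_step {m : ℕ} (i : Fin m) (f : Fin (m+1) → ℝ) (w : Fin (m+1) → ℝ) :
    ∑ j, w j * f (Fin.cycleRange i.succ j) - ∑ j, w j * f (Fin.cycleRange i.castSucc j) =
      (w i.succ - w i.castSucc) * (f 0 - f i.succ) := by
  rw [← sum_sub_distrib, ← sum_subset (subset_univ {i.castSucc, i.succ})]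
  · rw [sum_pair (Fin.castSucc_lt_succ).ne]
    rw [Fin.cycleRange_self, Fin.cycleRange_self, Fin.cycleRange_of_gt (Fin.castSucc_lt_succ),
      Fin.cycleRange_of_lt (Fin.castSucc_lt_succ), Fin.coeSucc_eq_succ]
    ring
  · intro j _ hj
    simp only [mem_insert, mem_singleton, not_or] at hj
    rcases lt_or_ge j i.castSucc with h | h
    · rw [Fin.cycleRange_of_lt h, Fin.cycleRange_of_lt (h.trans Fin.castSucc_lt_succ)]; ring
    · have h' : i.castSucc < j := lt_of_le_of_ne h (Ne.symm hj.1)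
      have h'' : i.succ < j := lt_of_le_of_ne (Fin.castSucc_lt_iff_succ_le.1 h') (Ne.symm hj.2)
      rw [Fin.cycleRange_of_gt h', Fin.cycleRange_of_gt h'']; ring

lemma fiber (m : ℕ) (w u : Fin (m+1) → ℝ) (a : Fin (m+1)) (δ K c : ℝ) (hδ : 0 < δ)
    (hw1 : ∀ i : Fin m, 1 ≤ w i.succ - w i.castSucc) (hw : ∀ i j, w i - w j ≤ K)
    (hu1 : ∀ i, i ≠ a → δ / 2 ≤ u a - u i) (hu2 : ∀ i, u a - u i ≤ δ) :
    ((m:ℝ) + 1) * ∑ π : Equiv.Perm (Fin (m+1)), ind (-1) 1 (c + ∑ i, w i * u (π i)) ≤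
      (4 / δ + 1) * ∑ π : Equiv.Perm (Fin (m+1)),
        ind (-(1 + K * δ)) (1 + K * δ) (c + ∑ i, w i * u (π i)) := by
  rw [sum_fiber a, sum_fiber a, mul_sum, mul_sum]
  apply sum_le_sum
  intro τ hτ
  have hτ0 : τ 0 = a := by simpa using hτ
  have hst : ∀ i : Fin m, (c + ∑ j, w j * u ((τ * Fin.cycleRange i.succ) j)) -
      (c + ∑ j, w j * u ((τ * Fin.cycleRange i.castSucc) j)) =
      (w i.succ - w i.castSucc) * (u a - u (τ i.succ)) := by
    intro i
    have := cycleRange_step i (u ∘ τ) w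
    simp only [Function.comp, hτ0] at this
    simp only [Equiv.Perm.mul_apply]
    linarith
  refine chain m (fun r => c + ∑ i, w i * u ((τ * Fin.cycleRange r) i)) w δ K hδ ?_ ?_ hw
  · intro i
    simp only [hst]
    have hne : τ i.succ ≠ a := by
      rw [← hτ0]; intro h; exact (Fin.succ_ne_zero i) (τ.injective h)
    nlinarith [hu1 _ hne, hw1 i]
  · intro i
    simp only [hst]
    nlinarith [hu2 (τ i.succ), hw1 i]

/-- fibre lemma over a general finite type with injective natural weights -/
lemma fiberU {U : Type*} [Fintype U] [DecidableEq U] (w : U → ℕ) (hwi : Function.Injective w)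
    (K : ℕ) (hwK : ∀ i, w i ≤ K)
    (u : U → ℝ) (a : U) (δ c : ℝ) (hδ : 0 < δ)
    (hu1 : ∀ i, i ≠ a → δ / 2 ≤ u a - u i) (hu2 : ∀ i, u a - u i ≤ δ) :
    (Fintype.card U : ℝ) * ∑ π : Equiv.Perm U, ind (-1) 1 (c + ∑ i, (w i : ℝ) * u (π i)) ≤
      (4 / δ + 1) * ∑ π : Equiv.Perm U,
        ind (-(1 + K * δ)) (1 + K * δ) (c + ∑ i, (w i : ℝ) * u (π i)) := by
  obtain ⟨m, hm⟩ : ∃ m, Fintype.card U = m + 1 :=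
    Nat.exists_eq_succ_of_ne_zero (Fintype.card_pos_iff.2 ⟨a⟩).ne'
  let _ : LinearOrder U := LinearOrder.lift' w hwi
  let e : Fin (m+1) ≃o U := Fintype.orderIsoFinOfCardEq U hm
  have hlt : ∀ i j : U, i < j → w i < w j := fun i j h => h
  have key := fiber m (fun i => (w (e i) : ℝ)) (u ∘ e) (e.symm a) δ K c hδ
    (by
      intro i
      have h := hlt _ _ (e.strictMono (Fin.castSucc_lt_succ (i := i)))
      have : (w (e i.castSucc) : ℝ) + 1 ≤ w (e i.succ) := by exact_mod_cast h
      linarith)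
    (by
      intro i j
      have h1 : (w (e i) : ℝ) ≤ K := by exact_mod_cast hwK _
      have h2 : (0:ℝ) ≤ w (e j) := by positivity
      linarith)
    (by
      intro i hi
      simp only [Function.comp, OrderIso.apply_symm_apply]
      apply hu1
      rintro rfl
      simp at hi)
    (by
      intro i
      simp only [Function.comp, OrderIso.apply_symm_apply]
      exact hu2 _)
  have hre : ∀ G : ℝ → ℝ, ∑ π : Equiv.Perm U, G (c + ∑ i, (w i : ℝ) * u (π i)) =
      ∑ π : Equiv.Perm (Fin (m+1)), G (c + ∑ i, (w (e i) : ℝ) * (u ∘ e) (π i)) := by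
    intro G
    rw [← Equiv.sum_comp (e.toEquiv.permCongr)]
    refine sum_congr rfl fun π _ => ?_
    rw [← Equiv.sum_comp e.toEquiv]
    simp [Equiv.permCongr_apply]
  rw [hre, hre, hm]
  push_cast
  exact key

lemma stage1 {k : ℕ} (y : Fin k → ℝ) (a : Fin k) (δ : ℝ) (hδ : 0 < δ) (h2 : ∀ i, y a - y i ≤ δ) :
    ((univ.filter (fun i => δ / 2 ≤ y a - y i)).card : ℝ) *
      ∑ σ : Equiv.Perm (Fin k), ind (-1) 1 (tw (y ∘ σ)) ≤
    (4 / δ + 1) * ∑ σ : Equiv.Perm (Fin k), ind (-(1 + k * δ)) (1 + k * δ) (tw (y ∘ σ)) := by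
  classical
  let p : Fin k → Prop := fun i => i = a ∨ δ / 2 ≤ y a - y i
  let U := {i // p i}
  let H := Equiv.Perm U
  have hav : ∀ F : Equiv.Perm (Fin k) → ℝ, (Fintype.card H : ℝ) * ∑ σ, F σ =
      ∑ σ, ∑ π : H, F (Equiv.Perm.ofSubtype π * σ) := by
    intro F
    rw [sum_comm]
    have : ∀ π : H, ∑ σ, F (Equiv.Perm.ofSubtype π * σ) = ∑ σ, F σ := fun π =>
      Equiv.sum_comp (Equiv.mulLeft (Equiv.Perm.ofSubtype π)) F
    simp [this]
  have hH : (0:ℝ) < Fintype.card H := by exact_mod_cast Fintype.card_pos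
  have hcard : ((univ.filter (fun i => δ / 2 ≤ y a - y i)).card : ℝ) ≤ Fintype.card U := by
    rw [Fintype.card_subtype]
    exact_mod_cast card_le_card (fun i hi => by simp only [mem_filter, p] at hi ⊢; tauto)
  have hnn : 0 ≤ ∑ σ : Equiv.Perm (Fin k), ind (-1) 1 (tw (y ∘ σ)) :=
    sum_nonneg fun _ _ => ind_nonneg _ _ _
  refine (mul_le_mul_of_nonneg_right hcard hnn).trans ?_
  refine le_of_mul_le_mul_left ?_ hH
  rw [mul_left_comm, hav, mul_left_comm, hav, mul_sum, mul_sum]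
  apply sum_le_sum
  intro σ _
  have htw : ∀ π : H, tw (y ∘ (Equiv.Perm.ofSubtype π * σ : Equiv.Perm (Fin k))) =
      (∑ i with ¬ p i, (((σ.symm i : Fin k) : ℕ) + 1 : ℝ) * y i) +
        ∑ i : U, ((((σ.symm i : Fin k) : ℕ) + 1 : ℕ) : ℝ) * y (π i) := by
    intro π
    rw [tw, ← Equiv.sum_comp σ.symm, ← sum_filter_add_sum_filter_not univ p, add_comm]
    congr 1
    · refine sum_congr rfl fun i hi => ?_
      simp only [mem_filter, mem_univ, true_and] at hi
      simp [Equiv.Perm.ofSubtype_apply_of_not_mem π hi]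
    · rw [← Finset.sum_subtype_eq_sum_filter, Finset.subtype_univ]
      refine sum_congr rfl fun i _ => ?_
      simp
  simp only [htw]
  refine fiberU (U := U) (fun i => ((σ.symm i : Fin k) : ℕ) + 1) ?_ k ?_ (fun i => y i)
    ⟨a, Or.inl rfl⟩ δ _ hδ ?_ ?_
  · intro i j hij
    have : σ.symm (i : Fin k) = σ.symm j := Fin.ext (by simpa using hij)
    exact Subtype.ext (σ.symm.injective this)
  · intro i; exact (σ.symm i).isLt
  · rintro ⟨i, hi⟩ hne
    rcases hi with h | h
    · exact absurd (Subtype.ext h) hne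
    · exact h
  · intro i; exact h2 _

lemma count_bound {k : ℕ} (hk : 1 ≤ k) (y : Fin k → ℝ) (hy : ∑ i, y i = 1) :
    (∑ σ : Equiv.Perm (Fin k), ind (-1) 1 (tw (y ∘ σ))) * k ≤ 1000 * (k.factorial : ℝ) := by
  set E := ∑ σ : Equiv.Perm (Fin k), ind (-1) 1 (tw (y ∘ σ)) with hE
  have hkf : (0:ℝ) < k.factorial := by exact_mod_cast k.factorial_pos
  have htriv : ∀ A B, ∑ σ : Equiv.Perm (Fin k), ind A B (tw (y ∘ σ)) ≤ k.factorial := by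
    intro A B
    calc _ ≤ ∑ σ : Equiv.Perm (Fin k), (1:ℝ) :=
          sum_le_sum fun σ _ => by simp only [ind]; split_ifs <;> norm_num
      _ = _ := by simp [Fintype.card_perm]
  have hE0 : 0 ≤ E := sum_nonneg fun _ _ => ind_nonneg _ _ _
  have hk1 : (1:ℝ) ≤ k := by exact_mod_cast hk
  rcases le_or_gt k 4 with hk4 | hk4
  · have : (k:ℝ) ≤ 4 := by exact_mod_cast hk4
    have := htriv (-1) 1
    nlinarith
  have hk5 : (5:ℝ) ≤ k := by exact_mod_cast hk4
  have : Nonempty (Fin k) := ⟨⟨0, hk⟩⟩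
  obtain ⟨a, ha⟩ := Finite.exists_max y
  obtain ⟨b, hb⟩ := Finite.exists_min y
  set δ := y a - y b with hδ
  have hsp : ∀ i j, y i - y j ≤ δ := fun i j => by linarith [ha i, hb j]
  rcases lt_or_ge (k * δ) 1 with hs | hs
  · -- the event is empty
    have : E = 0 := by
      apply sum_eq_zero
      intro σ _
      simp only [ind]
      rw [if_neg]
      rintro ⟨h1, h2⟩
      have hsum := sum_bb_all (y ∘ σ)
      have hs1 : ∑ i, (y ∘ σ) i = 1 := by rw [← hy]; exact Equiv.sum_comp σ y
      rw [hs1] at hsum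
      have habs : |∑ i, bb (y ∘ σ) i| ≤ ∑ i : Fin k, (1 / 2 : ℝ) :=
        (abs_sum_le_sum_abs _ _).trans (sum_le_sum fun i _ =>
          (bb_abs (y ∘ σ) δ (fun i j => hsp _ _) i).trans (by linarith))
      simp only [sum_const, card_univ, Fintype.card_fin, nsmul_eq_mul] at habs
      rw [hsum, abs_le] at habs
      linarith [habs.1]
    rw [this]; simp
  have hδ0 : 0 < δ := by
    by_contra h
    push Not at h
    nlinarith
  set J := ∑ σ : Equiv.Perm (Fin k), ind (-(1 + k * δ)) (1 + k * δ) (tw (y ∘ σ)) with hJ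
  have hJ0 : 0 ≤ J := sum_nonneg fun _ _ => ind_nonneg _ _ _
  have hJ1 := htriv (-(1 + k * δ)) (1 + k * δ)
  have hJ2 := stage2 y hy δ (1 + k * δ) hsp (by positivity) (by linarith)
  rw [← hJ] at hJ1 hJ2
  have hJ3 : J ≤ 16 * δ * k.factorial := by
    refine le_of_mul_le_mul_right ?_ (by linarith : (0:ℝ) < k)
    nlinarith
  have hBJ : (4 / δ + 1) * J ≤ 80 * k.factorial := by
    rcases le_or_gt δ 1 with h | h
    · have : 4 / δ + 1 ≤ 5 / δ := by
        rw [div_add_one hδ0.ne']; gcongr; linarith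
      calc (4 / δ + 1) * J ≤ 5 / δ * (16 * δ * k.factorial) := by gcongr
        _ = 80 * k.factorial := by field_simp; ring
    · have : 4 / δ ≤ 4 := by rw [div_le_iff₀ hδ0]; linarith
      nlinarith
  have s1 := stage1 y a δ hδ0 (fun i => hsp _ _)
  have s2 := stage1 (fun i => - y i) b δ hδ0 (fun i => by linarith [hsp i b])
  have hneg : ∀ A, ∑ σ : Equiv.Perm (Fin k), ind (-A) A (tw ((fun i => - y i) ∘ σ)) =
      ∑ σ : Equiv.Perm (Fin k), ind (-A) A (tw (y ∘ σ)) := by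
    intro A
    refine sum_congr rfl fun σ _ => ?_
    have : tw ((fun i => - y i) ∘ σ) = - tw (y ∘ σ) := by simp [tw]
    rw [this]
    simp only [ind]
    congr 1
    apply propext
    constructor <;> rintro ⟨h1, h2⟩ <;> constructor <;> linarith
  rw [hneg, hneg, ← hE, ← hJ] at s2
  rw [← hE, ← hJ] at s1
  have hcov : (k:ℝ) ≤ ((univ.filter (fun i => δ / 2 ≤ y a - y i)).card : ℝ) +
      ((univ.filter (fun i => δ / 2 ≤ - y b - - y i)).card : ℝ) := by
    have h1 : (univ : Finset (Fin k)) ⊆ (univ.filter (fun i => δ / 2 ≤ y a - y i)) ∪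
        (univ.filter (fun i => δ / 2 ≤ - y b - - y i)) := by
      intro i _
      simp only [mem_union, mem_filter, mem_univ, true_and]
      by_contra h
      push Not at h
      linarith [h.1, h.2]
    have h2 := (card_le_card h1).trans (card_union_le _ _)
    rw [card_univ, Fintype.card_fin] at h2
    exact_mod_cast h2
  have : (k:ℝ) * E ≤ 160 * k.factorial := by
    have := mul_le_mul_of_nonneg_right hcov hE0
    linarith
  linarith

theorem stmt_3 :
    ∃ C > (0:ℝ), ∀ (k : ℕ), 1 ≤ k →
      ∀ (μ : Measure (Fin k → ℝ)), IsProbabilityMeasure μ →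
      (∀ σ : Equiv.Perm (Fin k), μ.map (fun x => x ∘ σ) = μ) →
      μ ≪ (volume : Measure (Fin k → ℝ)) →
      (μ {x | |∑ j : Fin k, ((j:ℕ) + 1 : ℝ) * x j| ≤ |∑ j, x j|}) ≤ ENNReal.ofReal (C / k) := by
  refine ⟨1000, by norm_num, ?_⟩
  intro k hk μ hμ hex hac
  set E : Set (Fin k → ℝ) := {x | |∑ j : Fin k, ((j:ℕ) + 1 : ℝ) * x j| ≤ |∑ j, x j|} with hE
  have hEm : MeasurableSet E := measurableSet_le (by fun_prop) (by fun_prop)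
  have hk0 : (0:ℝ) < k := by exact_mod_cast hk
  have hnull : ∀ᵐ x ∂μ, ∑ j, x j ≠ 0 := by
    apply hac.ae_le
    let L : (Fin k → ℝ) →ₗ[ℝ] ℝ := ∑ j, LinearMap.proj j
    have hL : ∀ x, L x = ∑ j, x j := by intro x; simp [L]
    have hker : LinearMap.ker L ≠ ⊤ := by
      intro h
      have : (Pi.single ⟨0, hk⟩ 1 : Fin k → ℝ) ∈ LinearMap.ker L := by rw [h]; trivial
      rw [LinearMap.mem_ker, hL] at this
      simp at this
    have := Measure.addHaar_submodule (volume : Measure (Fin k → ℝ)) (LinearMap.ker L) hker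
    change ∀ᵐ x : Fin k → ℝ ∂volume, ∑ j, x j ≠ 0
    rw [ae_iff]
    convert this using 2
    ext x
    simp [hL]
  have hmeas : ∀ σ : Equiv.Perm (Fin k), Measurable (fun x : Fin k → ℝ => x ∘ σ) := by
    intro σ
    exact measurable_pi_lambda _ fun i => measurable_pi_apply _
  have hσ : ∀ σ : Equiv.Perm (Fin k),
      μ E = ∫⁻ x, E.indicator (fun _ => (1:ENNReal)) (x ∘ σ) ∂μ := by
    intro σ
    rw [← lintegral_map (f := E.indicator (fun _ => (1:ENNReal))) (measurable_const.indicator hEm)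
      (hmeas σ), hex σ, lintegral_indicator_const hEm, one_mul]
  have hpt : ∀ᵐ x ∂μ, ∑ σ : Equiv.Perm (Fin k), E.indicator (fun _ => (1:ENNReal)) (x ∘ σ) ≤
      ENNReal.ofReal (1000 / k * k.factorial) := by
    filter_upwards [hnull] with x hx
    set S := ∑ j, x j with hS
    have hc := count_bound hk (fun i => x i / S) (by rw [← sum_div]; exact div_self hx)
    have hi : ∀ σ : Equiv.Perm (Fin k), E.indicator (fun _ => (1:ENNReal)) (x ∘ σ) =
        ENNReal.ofReal (ind (-1) 1 (tw ((fun i => x i / S) ∘ σ))) := by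
      intro σ
      have hs1 : ∑ j, (x ∘ σ) j = S := Equiv.sum_comp σ x
      have ht : tw ((fun i => x i / S) ∘ σ) = tw (x ∘ σ) / S := by
        simp only [tw, sum_div, Function.comp, mul_div_assoc]
      have hiff : x ∘ σ ∈ E ↔ (-1 ≤ tw (x ∘ σ) / S ∧ tw (x ∘ σ) / S ≤ 1) := by
        rw [← abs_le, abs_div, div_le_one (abs_pos.2 hx)]
        simp only [hE, Set.mem_ofPred_eq, hs1]
        rfl
      rw [ht]
      by_cases h : x ∘ σ ∈ E
      · rw [Set.indicator_of_mem h]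
        simp only [ind]
        rw [if_pos (hiff.1 h)]; simp
      · rw [Set.indicator_of_notMem h]
        simp only [ind]
        rw [if_neg (fun h' => h (hiff.2 h'))]; simp
    simp only [hi]
    rw [← ENNReal.ofReal_sum_of_nonneg (fun _ _ => ind_nonneg _ _ _)]
    apply ENNReal.ofReal_le_ofReal
    rw [div_mul_eq_mul_div, le_div_iff₀ hk0]
    exact hc
  have hfin : (k.factorial : ENNReal) * μ E ≤ k.factorial * ENNReal.ofReal (1000 / k) := by
    calc (k.factorial : ENNReal) * μ E = ∑ σ : Equiv.Perm (Fin k), μ E := by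
          simp [Fintype.card_perm]
      _ = ∑ σ : Equiv.Perm (Fin k), ∫⁻ x, E.indicator (fun _ => (1:ENNReal)) (x ∘ σ) ∂μ :=
          sum_congr rfl fun σ _ => hσ σ
      _ = ∫⁻ x, ∑ σ : Equiv.Perm (Fin k), E.indicator (fun _ => (1:ENNReal)) (x ∘ σ) ∂μ :=
          (lintegral_finsetSum _ fun σ _ =>
            (measurable_const.indicator hEm).comp (hmeas σ)).symm
      _ ≤ ∫⁻ x, ENNReal.ofReal (1000 / k * k.factorial) ∂μ := lintegral_mono_ae hpt
      _ = k.factorial * ENNReal.ofReal (1000 / k) := by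
          rw [lintegral_const, measure_univ, mul_one, ENNReal.ofReal_mul (by positivity),
            ENNReal.ofReal_natCast, mul_comm]
  exact (ENNReal.mul_le_mul_iff_right (by exact_mod_cast k.factorial_ne_zero)
    (ENNReal.natCast_ne_top _)).1 hfin
end
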